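/- Let n ∈ ℕ and n-1 ≤ r ≤ 2n-3, 1 ≤ p ≤ n. Every (0, n, r+2-n, r)-Magog pentagon is a full (0, n, r+2-n)-Magog trapezoid; hence the number of (n,0,r)-alternating sign pentagons P with ρ(P) = p equals the number of (0, n, r+2-n)-Magog trapezoids T with τ(T) = p. -/

import Mathlib

open Finset

/-- An alternating sign triangle of order `n`: a triangular array with rows `i = 1,…,n`,
row `i` occupying columns `i,…,2n-i` (so the central column is column `n`).
Entries outside this region are `0`. -/
structure AST (n : ℕ) where
  entry : ℕ → ℕ → ℤ
  support : ∀ i j, entry i j ≠ 0 → 1 ≤ i ∧ i ≤ n ∧ i ≤ j ∧ j ≤ 2 * n - i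
  entries : ∀ i j, entry i j = -1 ∨ entry i j = 0 ∨ entry i j = 1
  rowSum : ∀ i, 1 ≤ i → i ≤ n → ∑ j ∈ Icc i (2 * n - i), entry i j = 1
  altRow : ∀ i j₁ j₂, j₁ < j₂ → entry i j₁ ≠ 0 → entry i j₂ ≠ 0 →
      (∀ j, j₁ < j → j < j₂ → entry i j = 0) → entry i j₁ * entry i j₂ = -1
  altCol : ∀ j i₁ i₂, i₁ < i₂ → entry i₁ j ≠ 0 → entry i₂ j ≠ 0 →
      (∀ i, i₁ < i → i < i₂ → entry i j = 0) → entry i₁ j * entry i₂ j = -1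
  topOne : ∀ i j, entry i j ≠ 0 → (∀ i', i' < i → entry i' j = 0) → entry i j = 1

namespace AST

variable {n : ℕ} (T : AST n)

/-- The sum of the entries of column `j`. -/
def colSum (j : ℕ) : ℤ := ∑ i ∈ Icc 1 n, T.entry i j

/-- The bottom entry of column `j` (the entry of column `j` with the largest row index). -/
def bottom (j : ℕ) : ℤ := T.entry (min j (2 * n - j)) j

/-- A `1`-column: a column summing to `1`. -/
def IsOneCol (j : ℕ) : Prop := T.colSum j = 1

/-- An `11`-column: a `1`-column with bottom entry `1`. -/
def IsElevenCol (j : ℕ) : Prop := T.colSum j = 1 ∧ T.bottom j = 1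

/-- A `10`-column: a `1`-column with bottom entry `0`. -/
def IsTenCol (j : ℕ) : Prop := T.colSum j = 1 ∧ T.bottom j = 0

instance : DecidablePred T.IsOneCol := fun j =>
  inferInstanceAs (Decidable (T.colSum j = 1))
instance : DecidablePred T.IsElevenCol := fun j =>
  inferInstanceAs (Decidable (T.colSum j = 1 ∧ T.bottom j = 1))
instance : DecidablePred T.IsTenCol := fun j =>
  inferInstanceAs (Decidable (T.colSum j = 1 ∧ T.bottom j = 0))

/-- The statistic `ρ`: `1` + (number of `11`-columns strictly left of the central column)
+ (number of `10`-columns strictly right of the central column). -/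
def rho : ℕ :=
  1 + ((Icc 1 (n - 1)).filter T.IsElevenCol).card
    + ((Icc (n + 1) (2 * n - 1)).filter T.IsTenCol).card

end AST

/-- The label in `{0,…,2n-3}` of the non-central column with natural index
`j ∈ {1,…,2n-1} \ {n}` of an AST of order `n` (labels go left to right, skipping the
central column). -/
def AST.label (n j : ℕ) : ℕ := if j < n then j - 1 else j - 2

namespace AST

variable {n : ℕ} (T : AST n)

/-- `T` is an `(n,l,r)`-alternating sign pentagon: every non-central `1`-column has its
label between `l` and `r`. -/
def IsASP (l r : ℕ) : Prop :=
  ∀ j, 1 ≤ j → j ≤ 2 * n - 1 → j ≠ n → T.IsOneCol j → l ≤ AST.label n j ∧ AST.label n j ≤ r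

end AST

/-- An `(m,n,k,l)`-Magog pentagon: the intersection of the top `k` rows and the first `l`
south-east diagonals (counted from the top right) of a Magog array of order `n`.
`entry j i` is the entry `a_{j,i}` (row `i`, with `i ≤ j ≤ n`); the cell `(j,i)` lies on
south-east diagonal `n - j + 2i - 1`, so it belongs to the pentagon iff `n + 2i ≤ l + j + 1`.
Rows are weakly increasing, (display-)columns are weakly decreasing, and the first row is
bounded by `a_{j,1} ≤ m + j`.  Cells of the trapezoid shape cut off by the diagonal
condition are (as in the defining array convention) equal to `1`; cells outside the
trapezoid shape are normalized to `0`.  An `(m,n,k)`-Magog trapezoid is the case `l = 2n-1`. -/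
structure MagogPentagon (m n k l : ℕ) where
  entry : ℕ → ℕ → ℕ
  pos : ∀ i j, 1 ≤ i → i ≤ k → i ≤ j → j ≤ n → n + 2 * i ≤ l + j + 1 → 1 ≤ entry j i
  rowInc : ∀ i j, 1 ≤ i → i ≤ k → i ≤ j → j + 1 ≤ n → n + 2 * i ≤ l + j + 1 →
      entry j i ≤ entry (j + 1) i
  colDec : ∀ i j, 1 ≤ i → i + 1 ≤ k → i ≤ j → j + 1 ≤ n → n + 2 * (i + 1) ≤ l + (j + 1) + 1 →
      entry (j + 1) (i + 1) ≤ entry j i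
  bound : ∀ j, 1 ≤ j → j ≤ n → entry j 1 ≤ m + j
  cut : ∀ i j, 1 ≤ i → i ≤ k → i ≤ j → j ≤ n → l + j + 1 < n + 2 * i → entry j i = 1
  outside : ∀ i j, ¬(1 ≤ i ∧ i ≤ k ∧ i ≤ j ∧ j ≤ n) → entry j i = 0

namespace MagogPentagon

/-- The statistic `τ(M) = n + ∑_{i=1}^{k} (a_{n-1,i} - a_{n,i})`. -/
def tau {m n k l : ℕ} (M : MagogPentagon m n k l) : ℤ :=
  (n : ℤ) + ∑ i ∈ Finset.Icc 1 k, ((M.entry (n - 1) i : ℤ) - (M.entry n i : ℤ))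

end MagogPentagon



section KernelDefs
open MvPolynomial

/-- coefficient of a polynomial at an exponent vector given as a plain function -/
noncomputable def co {R : Type*} [CommRing R] {n : ℕ} (N : Fin n → ℕ) :
    MvPolynomial (Fin n) R →ₗ[R] R :=
  MvPolynomial.lcoeff R (Finsupp.equivFunOnFinite.symm N)

/-- product over pairs `i < j` -/
def pairProd {A : Type*} [CommRing A] {n : ℕ} (k : A → A → A) (x : Fin n → A) : A :=
  ∏ i, ∏ j, if i < j then k (x i) (x j) else 1

variable {R : Type*} [CommRing R] {n : ℕ}

theorem co_apply (N : Fin n → ℕ) (P : MvPolynomial (Fin n) R) :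
    co N P = coeff (Finsupp.equivFunOnFinite.symm N) P := rfl

theorem pairProd_mul {A : Type*} [CommRing A] (k l : A → A → A) (x : Fin n → A) :
    pairProd (fun a b => k a b * l a b) x = pairProd k x * pairProd l x := by
  unfold pairProd
  rw [← Finset.prod_mul_distrib]
  refine Finset.prod_congr rfl fun i _ => ?_
  rw [← Finset.prod_mul_distrib]
  refine Finset.prod_congr rfl fun j _ => ?_
  split_ifs <;> simp

theorem pairProd_map {A B : Type*} [CommRing A] [CommRing B] (f : A →+* B)
    (k : A → A → A) (k' : B → B → B) (h : ∀ a b, f (k a b) = k' (f a) (f b)) (x : Fin n → A) :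
    f (pairProd k x) = pairProd k' (fun i => f (x i)) := by
  unfold pairProd
  rw [map_prod]
  refine Finset.prod_congr rfl fun i _ => ?_
  rw [map_prod]
  refine Finset.prod_congr rfl fun j _ => ?_
  split_ifs <;> simp [h]

/-- splitting off an index -/
theorem pairProd_succAbove {A : Type*} [CommRing A] (k : A → A → A) (x : Fin (n+1) → A)
    (e : Fin (n+1)) :
    pairProd k x = (∏ p : Fin n, if e.succAbove p < e then k (x (e.succAbove p)) (x e)
        else k (x e) (x (e.succAbove p))) * pairProd k (fun p => x (e.succAbove p)) := by
  unfold pairProd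
  rw [Fin.prod_univ_succAbove _ e, Fin.prod_univ_succAbove _ e]
  simp only [lt_irrefl, if_false, one_mul]
  simp_rw [fun i => Fin.prod_univ_succAbove (fun j => if e.succAbove i < j then
    k (x (e.succAbove i)) (x j) else 1) e]
  rw [Finset.prod_mul_distrib, ← mul_assoc, ← Finset.prod_mul_distrib]
  congr 1
  · refine Finset.prod_congr rfl fun p _ => ?_
    rcases lt_or_gt_of_ne (Fin.succAbove_ne e p) with h | h
    · simp [h, not_lt_of_gt h]
    · simp [h, not_lt_of_gt h]
  · simp only [Fin.succAbove_lt_succAbove_iff]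

theorem pairProd_succ {A : Type*} [CommRing A] (k : A → A → A) (x : Fin (n+1) → A) :
    pairProd k x = (∏ p : Fin n, k (x 0) (x p.succ)) * pairProd k (fun p => x p.succ) := by
  rw [pairProd_succAbove k x 0]
  simp

theorem pairProd_last {A : Type*} [CommRing A] (k : A → A → A) (x : Fin (n+1) → A) :
    pairProd k x = (∏ p : Fin n, k (x p.castSucc) (x (Fin.last n))) *
      pairProd k (fun p => x p.castSucc) := by
  rw [pairProd_succAbove k x (Fin.last n)]
  simp [Fin.castSucc_lt_last]

/-- sign of the conversion to Vandermonde -/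
def vsign (R : Type*) [CommRing R] (n : ℕ) : R := pairProd (n := n) (fun _ _ => (-1 : R)) (fun _ => 0)

theorem pairProd_sub_eq {A : Type*} [CommRing A] (x : Fin n → A) :
    pairProd (fun a b => a - b) x = vsign A n * (Matrix.vandermonde x).det := by
  rw [Matrix.det_vandermonde]
  have : (∏ i : Fin n, ∏ j ∈ Ioi i, (x j - x i)) = pairProd (fun a b => b - a) x := by
    unfold pairProd
    refine Finset.prod_congr rfl fun i _ => ?_
    rw [← Finset.prod_filter]
    congr 1
    ext; simp
  rw [this]
  have h2 : vsign A n = pairProd (fun _ _ => (-1:A)) x := by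
    unfold vsign pairProd; rfl
  rw [h2, ← pairProd_mul]
  congr 1
  ext a b; ring

theorem co_X_mul_perm (σ : Fin n → ℕ) (N : Fin n → ℕ) (h : MvPolynomial (Fin n) R) :
    co N ((∏ p, (X p : MvPolynomial (Fin n) R) ^ (σ p)) * h) =
      if (∀ p, σ p ≤ N p) then co (fun p => N p - σ p) h else 0 := by
  have : (∏ p, (X p : MvPolynomial (Fin n) R) ^ (σ p)) =
      monomial (Finsupp.equivFunOnFinite.symm σ) 1 := by
    rw [monomial_eq, Finsupp.prod_fintype]
    · simp
    · simp
  rw [this, co_apply, coeff_monomial_mul', co_apply]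
  have e : (Finsupp.equivFunOnFinite.symm σ ≤ Finsupp.equivFunOnFinite.symm N) ↔ ∀ p, σ p ≤ N p := by
    rw [Finsupp.le_def]; rfl
  simp only [e, one_mul]
  split_ifs
  · congr 1
    ext p; simp
  · rfl

theorem co_det_mul (N : Fin n → ℕ) (h : MvPolynomial (Fin n) R) :
    co N ((Matrix.vandermonde (X : Fin n → MvPolynomial (Fin n) R)).det * h) =
      ∑ σ : Equiv.Perm (Fin n), ((Equiv.Perm.sign σ : ℤ) : R) *
        (if (∀ p, (σ p : ℕ) ≤ N p) then co (fun p => N p - (σ p : ℕ)) h else 0) := by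
  rw [← Matrix.det_transpose, Matrix.det_apply', Finset.sum_mul, map_sum]
  refine Finset.sum_congr rfl fun σ _ => ?_
  simp only [Matrix.transpose_apply, Matrix.vandermonde_apply]
  rw [mul_assoc, ← co_X_mul_perm (fun p => (σ p : ℕ)) N h]
  rw [← smul_eq_mul (_ : R), ← map_smul]
  congr 1
  rw [Algebra.smul_def]
  simp

/-- `Δ`-functional kills symmetric polynomials of positive degree. -/
theorem co_det_mul_symm [IsDomain R] [CharZero R] (s h : MvPolynomial (Fin n) R) (hs : s.IsSymmetric) (h0 : coeff 0 s = 0)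
    (N : Fin n → ℕ) (hN : ∀ p, N p + 1 ≤ n) :
    co N ((Matrix.vandermonde (X : Fin n → MvPolynomial (Fin n) R)).det * (s * h)) = 0 := by
  classical
  rw [← mul_assoc, co_apply, coeff_mul]
  refine Finset.sum_eq_zero fun x hx => ?_
  suffices H : coeff x.1 ((Matrix.vandermonde (X : Fin n → MvPolynomial (Fin n) R)).det * s) = 0 by
    rw [H, zero_mul]
  have hle : ∀ p, x.1 p + 1 ≤ n := by
    intro p
    have := HasAntidiagonal.mem_antidiagonal.1 hx
    have h2 := DFunLike.congr_fun this p
    simp at h2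
    have := hN p
    omega
  by_cases hinj : Function.Injective (fun p => x.1 p)
  · -- a permutation
    have hb : Function.Bijective (fun p : Fin n => (⟨x.1 p, by have := hle p; omega⟩ : Fin n)) := by
      refine Finite.injective_iff_bijective.1 fun a b hab => hinj (by simpa using hab)
    have hsum : ∑ p, x.1 p = ∑ p : Fin n, (p : ℕ) :=
      (Equiv.sum_comp (Equiv.ofBijective _ hb) (fun p : Fin n => (p : ℕ)))
    have h3 := co_det_mul (fun p => x.1 p) s
    rw [co_apply] at h3
    have e : Finsupp.equivFunOnFinite.symm (fun p => x.1 p) = x.1 := by ext; simp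
    rw [e] at h3
    rw [h3]
    refine Finset.sum_eq_zero fun σ _ => ?_
    split_ifs with hσ
    · have hs2 : ∑ p, (σ p : ℕ) = ∑ p : Fin n, (p : ℕ) :=
        Equiv.sum_comp σ (fun p : Fin n => (p : ℕ))
      have : ∀ p, (σ p : ℕ) = x.1 p := by
        have := (Finset.sum_eq_sum_iff_of_le (fun p _ => hσ p)).1 (hs2.trans hsum.symm)
        exact fun p => this p (mem_univ _)
      have z : (fun p => x.1 p - (σ p : ℕ)) = fun _ => 0 := by ext p; rw [this]; simp
      rw [z, co_apply]
      have : Finsupp.equivFunOnFinite.symm (fun _ : Fin n => 0) = 0 := by ext; simp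
      rw [this, h0, mul_zero]
    · simp
  · -- two equal exponents
    simp only [Function.Injective, not_forall] at hinj
    obtain ⟨a, b, hab, hne⟩ := hinj
    set P := ((Matrix.vandermonde (X : Fin n → MvPolynomial (Fin n) R)).det * s) with hP
    have hr : rename (Equiv.swap a b) P = -P := by
      rw [hP, map_mul, hs]
      have : rename (Equiv.swap a b) (Matrix.vandermonde (X : Fin n → MvPolynomial (Fin n) R)).det
          = ((Matrix.vandermonde (X : Fin n → MvPolynomial (Fin n) R)).submatrix (Equiv.swap a b) id).det := by
        rw [AlgHom.map_det]
        congr 1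
        ext i j
        simp [Matrix.vandermonde_apply]
      rw [this, Matrix.det_permute, Equiv.Perm.sign_swap hne]
      simp
    have hm : x.1.mapDomain (Equiv.swap a b) = x.1 := by
      ext p
      rw [Finsupp.mapDomain_equiv_apply]
      simp only [Equiv.symm_swap]
      by_cases h1 : p = a
      · subst h1; simpa using hab.symm
      · by_cases h2 : p = b
        · subst h2; simpa using hab
        · rw [Equiv.swap_apply_of_ne_of_ne h1 h2]
    have hc := coeff_rename_mapDomain (Equiv.swap a b) (Equiv.injective _) P x.1
    rw [hm, hr, coeff_neg] at hc
    have : (2 : R) * coeff x.1 P = 0 := by linear_combination -hc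
    simpa using this

end KernelDefs


section Key1
open MvPolynomial
variable {R : Type*} [CommRing R] {n : ℕ}

theorem co_det_skip (h : MvPolynomial (Fin (n+1)) R) :
    ∑ e : Fin (n+1), co (fun p => if p = e then 0 else n+1)
      ((Matrix.vandermonde (X : Fin (n+1) → MvPolynomial (Fin (n+1)) R)).det * h) =
    (-1)^n * co (fun _ => n) ((Matrix.vandermonde (X : Fin (n+1) → MvPolynomial (Fin (n+1)) R)).det * h) := by
  simp_rw [co_det_mul]
  rw [Finset.sum_comm]
  have h1 : ∀ σ : Equiv.Perm (Fin (n+1)), ∑ e : Fin (n+1), ((Equiv.Perm.sign σ : ℤ) : R) *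
        (if (∀ p, (σ p : ℕ) ≤ if p = e then 0 else n+1) then
          co (fun p => (if p = e then 0 else n+1) - (σ p : ℕ)) h else 0) =
        ((Equiv.Perm.sign σ : ℤ) : R) * 
          co (fun p => (if σ p = 0 then 0 else n+1) - (σ p : ℕ)) h := by
    intro σ
    rw [Finset.sum_eq_single (σ.symm 0)]
    · rw [if_pos]
      · congr 3
        ext p
        simp only [Equiv.eq_symm_apply]
      · intro p
        split_ifs with hp
        · subst hp; simp
        · omega
    · intro e _ he
      rw [if_neg, mul_zero]
      intro hh
      have := hh e
      simp at this
      exact he (by simp [← this])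
    · simp
  rw [Finset.sum_congr rfl fun σ _ => h1 σ, Finset.mul_sum]
  have h2 : ∀ σ : Equiv.Perm (Fin (n+1)), (-1)^n * (((Equiv.Perm.sign σ : ℤ) : R) *
        (if (∀ p, (σ p : ℕ) ≤ n) then co (fun p => n - (σ p : ℕ)) h else 0)) = 
        (((Equiv.Perm.sign (finRotate (n+1) * σ) : ℤ) : R) *
         co (fun p => (if (finRotate (n+1) * σ) p = 0 then 0 else n+1) - ((finRotate (n+1) * σ) p : ℕ)) h) := by
    intro σ
    have key : ∀ y : Fin (n+1), n - (y : ℕ) = (if finRotate (n+1) y = 0 then 0 else n+1) -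
        (finRotate (n+1) y : ℕ) := by
      intro y
      rcases Fin.eq_castSucc_or_eq_last y with ⟨q, hq⟩ | hq
      · subst hq
        simp [Fin.coeSucc_eq_succ]
      · subst hq; simp
    have : (fun p => n - (σ p : ℕ)) = (fun p => (if (finRotate (n+1) * σ) p = 0 then 0 else n+1) - ((finRotate (n+1) * σ) p : ℕ)) :=
      funext fun p => key (σ p)
    rw [if_pos (fun p => by have := (σ p).2; omega), map_mul, sign_finRotate, ← this]
    push_cast
    ring
  rw [Finset.sum_congr rfl fun σ _ => h2 σ]
  exact ((Group.mulLeft_bijective (finRotate (n+1))).sum_comp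
    (fun σ : Equiv.Perm (Fin (n+1)) => ((Equiv.Perm.sign σ : ℤ) : R) * 
          co (fun p => (if σ p = 0 then 0 else n+1) - (σ p : ℕ)) h)).symm

/-- the kernel of the alternating sign triangles -/
def kk {A : Type*} [CommRing A] (x y : A) : A := (x - y) * (1 + y + x * y)

/-- The word functional -/
noncomputable def TT (N : Fin n → ℕ) (f : Fin n → Polynomial R) : R :=
  co N (pairProd kk (X : Fin n → MvPolynomial (Fin n) R) * ∏ p, Polynomial.aeval (X p : MvPolynomial (Fin n) R) (f p))

theorem pairProd_kk {A : Type*} [CommRing A] (x : Fin n → A) : pairProd kk x = 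
    vsign A n * (Matrix.vandermonde x).det * pairProd (fun x y => 1 + y + x * y) x := by
  rw [← pairProd_sub_eq, ← pairProd_mul]; rfl

theorem vsign_C : vsign (MvPolynomial (Fin n) R) n = C (vsign R n) := by
  unfold vsign
  rw [pairProd_map (C : R →+* MvPolynomial (Fin n) R) _ (fun _ _ => -1) (by simp)]
  rfl

theorem co_C_mul (N : Fin n → ℕ) (c : R) (P : MvPolynomial (Fin n) R) : co N (C c * P) = c * co N P := by
  rw [co_apply, coeff_C_mul, co_apply]

theorem TT_eq (N : Fin n → ℕ) (f : Fin n → Polynomial R) : TT N f = vsign R n *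
    co N ((Matrix.vandermonde (X : Fin n → MvPolynomial (Fin n) R)).det * 
      (pairProd (fun x y => 1 + y + x * y) (X : Fin n → MvPolynomial (Fin n) R) *
      ∏ p, Polynomial.aeval (X p : MvPolynomial (Fin n) R) (f p))) := by
  unfold TT
  rw [pairProd_kk, vsign_C, mul_assoc, mul_assoc, co_C_mul]

theorem co_skip (e : Fin (n+1)) (N : Fin n → ℕ) (P : MvPolynomial (Fin (n+1)) R) :
    co (e.insertNth 0 N) P = co N (killCompl (Fin.succAbove_right_injective (p := e)) P) := by
  rw [co_apply, co_apply]
  have hm : (Finsupp.equivFunOnFinite.symm (e.insertNth 0 N : Fin (n+1) → ℕ)) =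
      (Finsupp.equivFunOnFinite.symm N).mapDomain e.succAbove := by
    ext p
    rcases Fin.eq_self_or_eq_succAbove e p with rfl | ⟨q, rfl⟩
    · rw [Finsupp.mapDomain_of_notMem_range]
      · simp
      · simp
    · rw [Finsupp.mapDomain_apply Fin.succAbove_right_injective]; simp
  rw [hm]
  induction P using MvPolynomial.induction_on' with
  | monomial u a =>
    by_cases hu : (u.support : Set (Fin (n+1))) ⊆ Set.range e.succAbove
    · have : u = (u.comapDomain e.succAbove (Fin.succAbove_right_injective.injOn)).mapDomain e.succAbove := by
        rw [Finsupp.mapDomain_comapDomain _ Fin.succAbove_right_injective _ hu]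
      rw [this, killCompl_monomial_mapDomain, coeff_monomial, coeff_monomial]
      simp only [(Finsupp.mapDomain_injective (Fin.succAbove_right_injective (p := e))).eq_iff]
    · rw [killCompl_monomial_eq_zero_of_not_subset _ _ hu, coeff_monomial, if_neg]
      · simp
      · rintro rfl
        apply hu
        intro x hx
        have := Finsupp.mapDomain_support hx
        simp only [Finset.mem_image] at this
        obtain ⟨a, _, rfl⟩ := this
        exact ⟨a, rfl⟩
  | add p q hp hq => simp [hp, hq]

end Key1


section Key1b
open MvPolynomial
variable {R : Type*} [CommRing R] {n : ℕ}

theorem TT_sum (f : Fin (n+1) → Polynomial R) : TT (fun _ => n) f = (-1)^n * 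
    ∑ e : Fin (n+1), TT (fun p => if p = e then 0 else n+1) f := by
  simp_rw [TT_eq]
  rw [← Finset.mul_sum, co_det_skip]
  have : ((-1:R)^n)*(-1)^n = 1 := by rw [← mul_pow]; simp
  linear_combination (-(vsign R (n+1) * co (fun _ => n) ((Matrix.vandermonde (X : Fin (n+1) → MvPolynomial (Fin (n+1)) R)).det * 
      (pairProd (fun x y => 1 + y + x * y) (X : Fin (n+1) → MvPolynomial (Fin (n+1)) R) *
      ∏ p, Polynomial.aeval (X p : MvPolynomial (Fin (n+1)) R) (f p))))) * this

theorem sign_card (e : Fin (n+1)) : (∏ p : Fin n, if p.castSucc < e then (-1:R) else 1) = (-1)^(e:ℕ) := by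
  rw [Finset.prod_ite, Finset.prod_const, Finset.prod_const_one, mul_one]
  congr 1
  have : (Finset.univ.filter fun p : Fin n => p.castSucc < e) = (Finset.univ.filter fun p : Fin n => (p:ℕ) < (e:ℕ)) := by
    ext p; simp [Fin.lt_def]
  rw [this, Fin.card_filter_val_lt]
  have := e.2; omega

theorem TT_skip (f : Fin (n+1) → Polynomial R) (e : Fin (n+1)) :
    (-1)^n * TT (fun p => if p = e then 0 else n+1) f = (-1)^(e:ℕ) * (f e).coeff 0 *
      TT (fun _ : Fin n => n) (fun p => if p.castSucc < e then f (e.succAbove p)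
        else (1 + Polynomial.X) * f (e.succAbove p)) := by
  have hN : (fun p => if p = e then 0 else n+1) = e.insertNth (α := fun _ => ℕ) 0 (fun _ : Fin n => n+1) := by
    ext p
    rcases Fin.eq_self_or_eq_succAbove e p with rfl | ⟨q, rfl⟩ <;> simp
  unfold TT
  rw [hN, co_skip, map_mul]
  have hf := pairProd_map (killCompl (R := R) (Fin.succAbove_right_injective (p := e))).toRingHom kk kk 
    (by intros; simp [kk]) (X : Fin (n+1) → MvPolynomial (Fin (n+1)) R)
  have hk1 : ∀ p, killCompl (R := R) (Fin.succAbove_right_injective (p := e)) (X (e.succAbove p)) = X p := by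
    intro p
    have := killCompl_rename_app (R := R) (Fin.succAbove_right_injective (p := e)) (X p)
    rwa [rename_X] at this
  have hk0 : killCompl (R := R) (Fin.succAbove_right_injective (p := e)) (X e) = 0 := by
    simp [killCompl]
  simp only [AlgHom.toRingHom_eq_coe, RingHom.coe_coe] at hf
  rw [hf, pairProd_succAbove kk _ e, map_prod, Fin.prod_univ_succAbove _ e]
  simp only [hk1, hk0, ← Polynomial.aeval_algHom_apply]
  have h0 : Polynomial.aeval (0 : MvPolynomial (Fin n) R) (f e) = C ((f e).coeff 0) := by
    rw [← Polynomial.coeff_zero_eq_aeval_zero']; rfl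
  rw [h0]
  have hprod : C ((-1:R)^n) * ((∏ p : Fin n, if e.succAbove p < e then kk (X p) (0: MvPolynomial (Fin n) R) else kk 0 (X p)) *
      ∏ p, Polynomial.aeval (X p : MvPolynomial (Fin n) R) (f (e.succAbove p))) =
      (∏ p : Fin n, (X p : MvPolynomial (Fin n) R)^1) * (C ((-1 : R)^(e:ℕ)) * ∏ p : Fin n, Polynomial.aeval (X p : MvPolynomial (Fin n) R) 
        (if p.castSucc < e then f (e.succAbove p)
        else (1 + Polynomial.X) * f (e.succAbove p))) := by
    rw [← sign_card, map_prod]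
    have : C ((-1:R)^n) = ∏ p : Fin n, (-1 : MvPolynomial (Fin n) R) := by simp
    rw [this]
    simp only [← Finset.prod_mul_distrib]
    refine Finset.prod_congr rfl fun p _ => ?_
    simp only [Fin.succAbove_lt_iff_castSucc_lt]
    split_ifs
    · simp [kk]
    · simp [kk]; ring
  rw [← co_C_mul]
  trans co (fun _ => n+1) ((∏ p : Fin n, (X p : MvPolynomial (Fin n) R)^1) * (C ((-1 : R)^(e:ℕ) * (f e).coeff 0) *
     (pairProd kk (X : Fin n → MvPolynomial (Fin n) R) * ∏ p : Fin n, Polynomial.aeval (X p : MvPolynomial (Fin n) R) 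
        (if p.castSucc < e then f (e.succAbove p)
        else (1 + Polynomial.X) * f (e.succAbove p)))))
  · congr 1
    rw [C_mul]
    linear_combination (C ((f e).coeff 0) * pairProd kk (X : Fin n → MvPolynomial (Fin n) R)) * hprod
  · rw [co_X_mul_perm, if_pos (by simp)]
    simp only [Nat.add_sub_cancel]
    rw [co_C_mul]

theorem TT_key (f : Fin (n+1) → Polynomial R) : TT (fun _ => n) f = 
    ∑ e : Fin (n+1), (-1)^(e:ℕ) * (f e).coeff 0 *
      TT (fun _ : Fin n => n) (fun p => if p.castSucc < e then f (e.succAbove p)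
        else (1 + Polynomial.X) * f (e.succAbove p)) := by
  rw [TT_sum, Finset.mul_sum]
  exact Finset.sum_congr rfl fun e _ => TT_skip f e

theorem TT_update_add (N : Fin n → ℕ) (f : Fin n → Polynomial R) (p : Fin n) (a b : Polynomial R) :
    TT N (Function.update f p (a + b)) = TT N (Function.update f p a) + TT N (Function.update f p b) := by
  unfold TT
  have : ∀ c, (∏ q, Polynomial.aeval (X q : MvPolynomial (Fin n) R) (Function.update f p c q)) =
     Polynomial.aeval (X p : MvPolynomial (Fin n) R) c * ∏ q ∈ univ.erase p, Polynomial.aeval (X q : MvPolynomial (Fin n) R) (f q) := by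
    intro c
    rw [← Finset.mul_prod_erase univ _ (mem_univ p)]
    congr 1
    · simp
    · refine Finset.prod_congr rfl fun q hq => ?_
      rw [Function.update_of_ne (Finset.ne_of_mem_erase hq)]
  rw [this, this, this, ← map_add]
  congr 1
  rw [map_add]; ring

theorem TT_update_smul (N : Fin n → ℕ) (f : Fin n → Polynomial R) (p : Fin n) (c : R) (a : Polynomial R) :
    TT N (Function.update f p (c • a)) = c * TT N (Function.update f p a) := by
  unfold TT
  have : ∀ c, (∏ q, Polynomial.aeval (X q : MvPolynomial (Fin n) R) (Function.update f p c q)) =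
     Polynomial.aeval (X p : MvPolynomial (Fin n) R) c * ∏ q ∈ univ.erase p, Polynomial.aeval (X q : MvPolynomial (Fin n) R) (f q) := by
    intro c
    rw [← Finset.mul_prod_erase univ _ (mem_univ p)]
    congr 1
    · simp
    · refine Finset.prod_congr rfl fun q hq => ?_
      rw [Function.update_of_ne (Finset.ne_of_mem_erase hq)]
  rw [this, this, ← co_C_mul]
  congr 1
  rw [map_smul, smul_eq_C_mul]; ring

/-- adjacent relation -/
theorem TT_rel [IsDomain R] [CharZero R] (N : ℕ) (f : Fin n → Polynomial R) (a b : Fin n) (hab : (b:ℕ) = a + 1) (L : Polynomial R) :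
    TT (fun _ => N) (Function.update (Function.update f a ((1+Polynomial.X) * L)) b ((1+Polynomial.X) * L))
    - TT (fun _ => N) (Function.update (Function.update f a L) b ((1+Polynomial.X) * L))
    + TT (fun _ => N) (Function.update (Function.update f a L) b L) = 0 := by
  have hne : a ≠ b := by rintro rfl; omega
  unfold TT
  have hpr : ∀ c d, (∏ q, Polynomial.aeval (X q : MvPolynomial (Fin n) R) (Function.update (Function.update f a c) b d q)) =
     Polynomial.aeval (X a : MvPolynomial (Fin n) R) c * Polynomial.aeval (X b : MvPolynomial (Fin n) R) d *
       ∏ q ∈ (univ.erase b).erase a, Polynomial.aeval (X q : MvPolynomial (Fin n) R) (f q) := by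
    intro c d
    rw [← Finset.mul_prod_erase univ _ (mem_univ b), ← Finset.mul_prod_erase (univ.erase b) _ (Finset.mem_erase.2 ⟨hne, mem_univ a⟩)]
    rw [Function.update_self, Function.update_of_ne hne, Function.update_self]
    rw [← mul_assoc, mul_comm (Polynomial.aeval (X b : MvPolynomial (Fin n) R) d)]
    congr 1
    refine Finset.prod_congr rfl fun q hq => ?_
    simp only [Finset.mem_erase] at hq
    rw [Function.update_of_ne hq.2.1, Function.update_of_ne hq.1]
  rw [hpr, hpr, hpr, ← map_sub, ← map_add]
  set G := ∏ q ∈ (univ.erase b).erase a, Polynomial.aeval (X q : MvPolynomial (Fin n) R) (f q)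
  set K' : MvPolynomial (Fin n) R := ∏ x : Fin n × Fin n, if x.1 < x.2 ∧ x ≠ (a, b) then kk (X x.1) (X x.2) else 1 with hK'
  have hK : pairProd kk (X : Fin n → MvPolynomial (Fin n) R) = kk (X a) (X b) * K' := by
    unfold pairProd
    rw [← Fintype.prod_prod_type' (fun i j : Fin n => if i < j then kk (X i : MvPolynomial (Fin n) R) (X j) else 1)]
    have e1 : kk (X a) (X b) = ∏ x : Fin n × Fin n, if x = (a,b) then kk (X x.1 : MvPolynomial (Fin n) R) (X x.2) else 1 := by
      rw [Finset.prod_ite_eq' univ (a,b) (fun x => kk (X x.1 : MvPolynomial (Fin n) R) (X x.2))]; simp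
    rw [e1, hK', ← Finset.prod_mul_distrib]
    refine Finset.prod_congr rfl fun x _ => ?_
    by_cases hx : x = (a,b)
    · subst hx
      have : a < b := by rw [Fin.lt_def]; omega
      simp [this]
    · simp [hx]
  set P := pairProd kk (X : Fin n → MvPolynomial (Fin n) R) * (Polynomial.aeval (X a : MvPolynomial (Fin n) R) L * Polynomial.aeval (X b : MvPolynomial (Fin n) R) L * (1 + X a + X a * X b) * G) with hP
  have hPe : pairProd kk X *
          ((Polynomial.aeval (X a)) ((1 + Polynomial.X) * L) * (Polynomial.aeval (X b)) ((1 + Polynomial.X) * L) * G) -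
        pairProd kk X * ((Polynomial.aeval (X a)) L * (Polynomial.aeval (X b)) ((1 + Polynomial.X) * L) * G) +
      pairProd kk X * ((Polynomial.aeval (X a)) L * (Polynomial.aeval (X b)) L * G) = P := by
    rw [hP]
    simp only [map_mul, map_add, map_one, Polynomial.aeval_X]
    ring
  rw [hPe]
  have hKs : rename (Equiv.swap a b) K' = K' := by
    rw [hK', map_prod]
    refine Fintype.prod_equiv ((Equiv.swap a b).prodCongr (Equiv.swap a b)) _ _ fun x => ?_
    obtain ⟨i, j⟩ := x
    have : (i < j ∧ (i, j) ≠ (a, b)) ↔ (Equiv.swap a b i < Equiv.swap a b j ∧ (Equiv.swap a b i, Equiv.swap a b j) ≠ (a,b)) := by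
      simp only [Equiv.swap_apply_def, ne_eq, Prod.mk.injEq, Fin.lt_def, Fin.ext_iff]
      split_ifs <;> omega
    simp only [Equiv.prodCongr_apply, Prod.map_apply]
    by_cases h : (i < j ∧ (i, j) ≠ (a, b))
    · rw [if_pos h, if_pos (this.1 h)]; simp [kk]
    · rw [if_neg h, if_neg (fun h' => h (this.2 h'))]; simp
  have hGs : rename (Equiv.swap a b) G = G := by
    rw [map_prod]
    refine Finset.prod_congr rfl fun q hq => ?_
    simp only [Finset.mem_erase] at hq
    rw [← Polynomial.aeval_algHom_apply, rename_X, Equiv.swap_apply_of_ne_of_ne hq.1 hq.2.1]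
  have hr : rename (Equiv.swap a b) P = -P := by
    rw [hP, hK]
    simp only [map_mul, hKs, hGs, kk, map_sub, map_add, map_one, rename_X, Equiv.swap_apply_left, Equiv.swap_apply_right,
      ← Polynomial.aeval_algHom_apply]
    ring
  have hc := coeff_rename_mapDomain (Equiv.swap a b) (Equiv.injective _) P (Finsupp.equivFunOnFinite.symm fun _ => N)
  have hm : (Finsupp.equivFunOnFinite.symm fun _ => N).mapDomain (Equiv.swap a b) = (Finsupp.equivFunOnFinite.symm fun _ : Fin n => N) := by
    ext p
    rw [Finsupp.mapDomain_equiv_apply]; simp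
  rw [hm, hr, coeff_neg] at hc
  rw [co_apply]
  have : (2 : R) * coeff (Finsupp.equivFunOnFinite.symm fun _ => N) P = 0 := by linear_combination -hc
  simpa using this

end Key1b


section Rot
open MvPolynomial
variable {R : Type*} [CommRing R] {n : ℕ}

theorem co_det_mul_prod [IsDomain R] [CharZero R] (a b h : MvPolynomial (Fin n) R)
    (N : Fin n → ℕ) (hN : ∀ p, N p + 1 ≤ n) :
    co N ((Matrix.vandermonde (X : Fin n → MvPolynomial (Fin n) R)).det * ((∏ q, (a + b * X q)) * h)) = 
    co N ((Matrix.vandermonde (X : Fin n → MvPolynomial (Fin n) R)).det * (a ^ n * h)) := by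
  have h1 : (∏ q, (a + b * (X q : MvPolynomial (Fin n) R))) = a ^ n + ∑ k ∈ Finset.range n, a ^ (n - (k+1)) * b ^ (k+1) * esymm (Fin n) R (k+1) := by
    have : ∀ q, a + b * (X q : MvPolynomial (Fin n) R) = b * X q + a := fun q => add_comm _ _
    simp_rw [this]
    rw [Finset.prod_add, Finset.sum_powerset, Finset.sum_range_succ']
    simp only [card_univ, Fintype.card_fin, powersetCard_zero, Finset.sum_singleton, Finset.prod_empty, sdiff_empty, Finset.prod_const, one_mul]
    rw [add_comm]
    congr 1
    refine Finset.sum_congr rfl fun k hk => ?_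
    rw [esymm, Finset.mul_sum]
    refine Finset.sum_congr rfl fun t ht => ?_
    rw [Finset.mem_powersetCard] at ht
    rw [Finset.prod_mul_distrib, Finset.prod_const, ht.2, ← Finset.compl_eq_univ_sdiff, Finset.card_compl, ht.2, Fintype.card_fin]
    ring
  rw [h1, add_mul, mul_add, map_add, add_eq_left, Finset.sum_mul, Finset.mul_sum, map_sum]
  refine Finset.sum_eq_zero fun k _ => ?_
  have := co_det_mul_symm (esymm (Fin n) R (k+1)) (a ^ (n - (k+1)) * b ^ (k+1) * h) (esymm_isSymmetric _ _ _) ?_ N hN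
  · refine Eq.trans (congrArg _ ?_) this; ring
  · rw [← constantCoeff_eq, esymm, map_sum]
    refine Finset.sum_eq_zero fun t ht => ?_
    rw [Finset.mem_powersetCard] at ht
    rw [map_prod]
    obtain ⟨x, hx⟩ : t.Nonempty := by rw [← Finset.card_pos]; omega
    exact Finset.prod_eq_zero hx (by simp)

theorem TT_gauge [IsDomain R] [CharZero R] (N : Fin n → ℕ) (hN : ∀ p, N p + 1 ≤ n) (f : Fin n → Polynomial R) :
    TT N (fun p => (1 + Polynomial.X) * f p) = TT N f := by
  rw [TT_eq, TT_eq]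
  congr 1
  have := co_det_mul_prod 1 1 (pairProd (fun x y => 1 + y + x * y) (X : Fin n → MvPolynomial (Fin n) R) *
      ∏ p, Polynomial.aeval (X p : MvPolynomial (Fin n) R) (f p)) N hN
  rw [one_pow, one_mul] at this
  rw [← this]
  congr 2
  simp only [map_mul, Finset.prod_mul_distrib]
  simp
  ring

theorem TT_gauge_pow [IsDomain R] [CharZero R] (N : Fin n → ℕ) (hN : ∀ p, N p + 1 ≤ n) (f : Fin n → Polynomial R) (k : ℕ) :
    TT N (fun p => (1 + Polynomial.X)^k * f p) = TT N f := by
  induction k with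
  | zero => simp
  | succ k ih => 
    rw [← ih, ← TT_gauge N hN (fun p => (1 + Polynomial.X)^k * f p)]
    refine congrArg _ (funext fun p => ?_)
    ring

theorem co_rename_const (N : ℕ) (e : Equiv.Perm (Fin n)) (P : MvPolynomial (Fin n) R) :
    co (fun _ => N) (rename e P) = co (fun _ => N) P := by
  have hc := coeff_rename_mapDomain e (Equiv.injective _) P (Finsupp.equivFunOnFinite.symm fun _ => N)
  have hm : (Finsupp.equivFunOnFinite.symm fun _ => N).mapDomain e = (Finsupp.equivFunOnFinite.symm fun _ : Fin n => N) := by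
    ext p
    rw [Finsupp.mapDomain_equiv_apply]; simp
  rw [hm] at hc
  exact hc

theorem exists_trunc_inv {R : Type*} [CommRing R] (w : Polynomial R) (hw : w.coeff 0 = 1) (m : ℕ) :
    ∃ w' v : Polynomial R, w * w' + Polynomial.X ^ m * v = 1 := by
  obtain ⟨g, hg⟩ : Polynomial.X ∣ 1 - w := by rw [Polynomial.X_dvd_iff]; simp [hw]
  refine ⟨∑ k ∈ range m, (1 - w)^k, g^m, ?_⟩
  have := mul_geom_sum (1 - w) m
  have h2 : w * ∑ k ∈ range m, (1 - w)^k = 1 - (1 - w)^m := by linear_combination -this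
  rw [h2, hg]; ring

theorem TT_cons_eq (N : Fin (n+1) → ℕ) (g : Polynomial R) (f : Fin n → Polynomial R) :
    TT N (Fin.cons g f : Fin (n+1) → Polynomial R) = vsign R (n+1) * co N ((Matrix.vandermonde (X : Fin (n+1) → MvPolynomial (Fin (n+1)) R)).det *
      ((∏ p : Fin n, (1 + (1 + X 0) * X p.succ)) * (Polynomial.aeval (X 0 : MvPolynomial (Fin (n+1)) R) g * 
        (pairProd (fun x y => 1 + y + x * y) (fun p : Fin n => (X p.succ : MvPolynomial (Fin (n+1)) R)) * 
          ∏ p : Fin n, Polynomial.aeval (X p.succ : MvPolynomial (Fin (n+1)) R) (f p))))) := by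
  rw [TT_eq]
  congr 3
  rw [pairProd_succ, Fin.prod_univ_succ]
  simp only [Fin.cons_zero, Fin.cons_succ]
  have : (∏ p : Fin n, (1 + X p.succ + X 0 * X p.succ : MvPolynomial (Fin (n+1)) R)) = (∏ p : Fin n, (1 + (1 + X 0) * X p.succ)) :=
    Finset.prod_congr rfl fun p _ => by ring
  rw [this]; ring

theorem TT_snoc_eq (N : ℕ) (g : Polynomial R) (f : Fin n → Polynomial R) :
    TT (fun _ => N) (Fin.snoc (α := fun _ => Polynomial R) f g) = (-1)^n * (vsign R (n+1) * co (fun _ => N) ((Matrix.vandermonde (X : Fin (n+1) → MvPolynomial (Fin (n+1)) R)).det *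
      ((∏ p : Fin n, ((1 + X 0) + X 0 * X p.succ)) * (Polynomial.aeval (X 0 : MvPolynomial (Fin (n+1)) R) g * 
        (pairProd (fun x y => 1 + y + x * y) (fun p : Fin n => (X p.succ : MvPolynomial (Fin (n+1)) R)) * 
          ∏ p : Fin n, Polynomial.aeval (X p.succ : MvPolynomial (Fin (n+1)) R) (f p)))))) := by
  unfold TT
  rw [← co_rename_const N (finRotate (n+1)), map_mul]
  have hf := pairProd_map (rename (R := R) (finRotate (n+1))).toRingHom kk kk 
    (by intros; simp [kk]) (X : Fin (n+1) → MvPolynomial (Fin (n+1)) R)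
  simp only [AlgHom.toRingHom_eq_coe, RingHom.coe_coe] at hf
  have e1 : ∀ p : Fin n, finRotate (n+1) p.castSucc = p.succ := fun p => by simp [Fin.coeSucc_eq_succ]
  rw [hf, pairProd_last, Fin.prod_univ_castSucc]
  simp only [map_mul, map_prod, ← Polynomial.aeval_algHom_apply, rename_X, e1, finRotate_last, Fin.snoc_castSucc, Fin.snoc_last]
  rw [← co_C_mul, ← co_C_mul]
  congr 1
  rw [← vsign_C, ← mul_assoc (vsign _ _), ← pairProd_sub_eq, pairProd_succ (fun a b => a - b)]
  unfold kk
  rw [pairProd_mul, Finset.prod_mul_distrib]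
  have s1 : (∏ p : Fin n, (X p.succ - X 0 : MvPolynomial (Fin (n+1)) R)) = C ((-1)^n) * ∏ p : Fin n, (X 0 - X p.succ) := by
    have : C ((-1:R)^n) = ∏ p : Fin n, (-1 : MvPolynomial (Fin (n+1)) R) := by simp
    rw [this, ← Finset.prod_mul_distrib]
    exact Finset.prod_congr rfl fun p _ => by ring
  have s2 : (∏ p : Fin n, (1 + X 0 + X p.succ * X 0 : MvPolynomial (Fin (n+1)) R)) = (∏ p : Fin n, ((1 + X 0) + X 0 * X p.succ)) :=
    Finset.prod_congr rfl fun p _ => by ring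
  rw [s1, s2]
  ring

set_option maxHeartbeats 1000000 in
theorem TT_rot [IsDomain R] [CharZero R] (g : Polynomial R) (f : Fin n → Polynomial R) :
    TT (fun _ => n) (Fin.cons ((1 + Polynomial.X)^(n+1) * g) f : Fin (n+1) → Polynomial R) = 
    (-1)^n * TT (fun _ => n) (Fin.snoc (α := fun _ => Polynomial R) f g) := by
  rw [TT_cons_eq, TT_snoc_eq, ← mul_assoc ((-1)^n), ← mul_pow]
  simp only [mul_neg, mul_one, neg_neg, one_pow, one_mul]
  congr 1
  set F := (pairProd (fun x y => 1 + y + x * y) (fun p : Fin n => (X p.succ : MvPolynomial (Fin (n+1)) R)) * 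
          ∏ p : Fin n, Polynomial.aeval (X p.succ : MvPolynomial (Fin (n+1)) R) (f p))
  set x0 : MvPolynomial (Fin (n+1)) R := X 0
  obtain ⟨w', v, hw⟩ := exists_trunc_inv (1 + Polynomial.X + Polynomial.X^2 : Polynomial R) (by simp) (n+1)
  have hw2 := congrArg (Polynomial.aeval x0) hw
  simp only [map_add, map_mul, map_one, map_pow, Polynomial.aeval_X] at hw2
  set W := Polynomial.aeval x0 w'
  set V := Polynomial.aeval x0 v
  set D := (Matrix.vandermonde (X : Fin (n+1) → MvPolynomial (Fin (n+1)) R)).det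
  have hkill : ∀ h, co (fun _ : Fin (n+1) => n) (D * h) = co (fun _ : Fin (n+1) => n) (D * ((1 + x0 + x0^2) * (W * h))) := by
    intro h
    have : D * h = D * ((1 + x0 + x0^2) * (W * h)) + (∏ p, X p ^ ((Pi.single 0 (n+1) : Fin (n+1) → ℕ) p)) * (V * D * h) := by
      have e : (∏ p, (X p : MvPolynomial (Fin (n+1)) R) ^ ((Pi.single 0 (n+1) : Fin (n+1) → ℕ) p)) = x0 ^ (n+1) := by
        rw [Fin.prod_univ_succ]
        simp [x0]
      rw [e]
      linear_combination -D * h * hw2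
    rw [this, map_add, co_X_mul_perm, if_neg, add_zero]
    intro hh
    have := hh 0
    simp at this
  refine (hkill _).trans (Eq.trans ?_ (hkill _).symm)
  have a1 := co_det_mul_prod (n := n+1) 1 (1 + x0) (W * ((1 + x0)^(n+1) * (Polynomial.aeval x0 g * F))) (fun _ => n) (by simp)
  have a2 := co_det_mul_prod (n := n+1) (1 + x0) x0 (W * (Polynomial.aeval x0 g * F)) (fun _ => n) (by simp)
  rw [Fin.prod_univ_succ] at a1 a2
  have b1 : D * ((1 + x0 + x0 ^ 2) *
      (W * ((∏ p : Fin n, (1 + (1 + x0) * X p.succ)) * (Polynomial.aeval x0 ((1 + Polynomial.X)^(n+1) * g) * F)))) = 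
     D * (((1 + (1 + x0) * X 0) * ∏ i : Fin n, (1 + (1 + x0) * X i.succ)) * (W * ((1 + x0)^(n+1) * (Polynomial.aeval x0 g * F)))) := by
    simp only [map_mul, map_pow, map_add, map_one, Polynomial.aeval_X]
    rw [show (X 0 : MvPolynomial (Fin (n+1)) R) = x0 from rfl]
    ring
  have b2 : D * ((1 + x0 + x0 ^ 2) * (W * ((∏ p : Fin n, (1 + x0 + x0 * X p.succ)) * (Polynomial.aeval x0 g * F)))) =
     D * (((1 + x0 + x0 * X 0) * ∏ i : Fin n, (1 + x0 + x0 * X i.succ)) * (W * (Polynomial.aeval x0 g * F))) := by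
    rw [show (X 0 : MvPolynomial (Fin (n+1)) R) = x0 from rfl]
    ring
  rw [b1, b2, a1, a2]
  refine congrArg _ ?_
  ring

end Rot


section Mob
open MvPolynomial
variable {R : Type*} [CommRing R] {n : ℕ}

theorem coeff_mul_of_low {A : Type*} [CommRing A] (F G : PowerSeries A) (u : PowerSeries A) (k : ℕ)
    (h : F - G = PowerSeries.X ^ (k+1) * u) : PowerSeries.coeff k F = PowerSeries.coeff k G := by
  have : PowerSeries.coeff k (F - G) = 0 := by
    rw [h, PowerSeries.coeff_X_pow_mul', if_neg (by omega)]
  rw [map_sub] at this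
  linear_combination this

/-- inversion relation `X = -1/(1+Y)` -/
def MobRel {A : Type*} [CommRing A] (ζ : PowerSeries A) (D : ℕ) (P Q : Polynomial A) : Prop :=
  P.natDegree ≤ D ∧ Q.natDegree ≤ D ∧ ∀ c s, c + s = D →
    (-1)^s * PowerSeries.coeff s ((P : PowerSeries A) * ζ^(c+1)) = Q.coeff c

theorem MobRel.mul {A : Type*} [CommRing A] {ζ : PowerSeries A} (hζ : (1 + PowerSeries.X) * ζ = 1)
    {D : ℕ} {P Q : Polynomial A} (h : MobRel ζ D P Q) (a b : A) :
    MobRel ζ (D+1) ((Polynomial.C a + Polynomial.C b * Polynomial.X) * P)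
      ((Polynomial.C (a - b) + Polynomial.C a * Polynomial.X) * Q) := by
  obtain ⟨h1, h2, h3⟩ := h
  have hd : ∀ a b : A, (Polynomial.C a + Polynomial.C b * Polynomial.X : Polynomial A).natDegree ≤ 1 := by
    intro a b
    rw [add_comm]; exact Polynomial.natDegree_linear_le
  refine ⟨?_, ?_, ?_⟩
  · refine (Polynomial.natDegree_mul_le).trans ?_
    have := hd a b; omega
  · refine (Polynomial.natDegree_mul_le).trans ?_
    have := hd (a-b) a; omega
  intro c s hcs
  have hQ : Q.coeff (D+1) = 0 := Polynomial.coeff_eq_zero_of_natDegree_lt (by omega)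
  have hP : P.coeff (D+1) = 0 := Polynomial.coeff_eq_zero_of_natDegree_lt (by omega)
  have hz0 : PowerSeries.coeff 0 ζ = 1 := by
    have := congrArg (PowerSeries.coeff 0) hζ
    simpa [PowerSeries.coeff_mul, PowerSeries.coeff_one] using this
  have hmul : ((((Polynomial.C a + Polynomial.C b * Polynomial.X) * P : Polynomial A) : PowerSeries A) * ζ^(c+1)) =
     PowerSeries.C a * ((P : PowerSeries A) * ζ^(c+1)) + PowerSeries.C b * (PowerSeries.X * ((P : PowerSeries A) * ζ^(c+1))) := by
    simp only [Polynomial.coe_mul, Polynomial.coe_add, Polynomial.coe_C, Polynomial.coe_X]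
    ring
  have key : (-1)^s * PowerSeries.coeff s ((P : PowerSeries A) * ζ^(c+1)) = Q.coeff c + (Polynomial.X * Q).coeff c := by
    rcases Nat.eq_zero_or_pos s with rfl | hs
    · have hc : c = D + 1 := by omega
      subst hc
      rw [hQ, Polynomial.coeff_X_mul, zero_add, ← h3 D 0 rfl]
      simp only [PowerSeries.coeff_zero_eq_constantCoeff, map_mul, map_pow] at hz0 ⊢
      rw [hz0]; simp
    · obtain ⟨s, rfl⟩ := Nat.exists_eq_add_of_lt hs
      rw [zero_add] at hcs ⊢
      have e2 := h3 c s (by omega)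
      rcases Nat.eq_zero_or_pos c with rfl | hc
      · have e3 : (P : PowerSeries A) = (P : PowerSeries A) * ζ^(0+1) + PowerSeries.X * ((P : PowerSeries A) * ζ^(0+1)) := by
          linear_combination (-(P : PowerSeries A)) * hζ
        have e4 := congrArg (PowerSeries.coeff (s+1)) e3
        have : s + 1 = D + 1 := by omega
        rw [map_add, PowerSeries.coeff_succ_X_mul, Polynomial.coeff_coe, this, hP, ← this] at e4
        simp only [Polynomial.coeff_X_mul_zero, add_zero]
        rw [← e2]
        linear_combination ((-1)^s) * e4
      · obtain ⟨c, rfl⟩ := Nat.exists_eq_add_of_lt hc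
        rw [zero_add] at *
        have e1 := h3 c (s+1) (by omega)
        have e3 : (P : PowerSeries A) * ζ^(c+1) = (P : PowerSeries A) * ζ^(c+1+1) + PowerSeries.X * ((P : PowerSeries A) * ζ^(c+1+1)) := by
          linear_combination (-(P : PowerSeries A) * ζ^(c+1)) * hζ
        have e4 := congrArg (PowerSeries.coeff (s+1)) e3
        rw [map_add, PowerSeries.coeff_succ_X_mul] at e4
        rw [Polynomial.coeff_X_mul, ← e1, ← e2, e4]
        ring
  have key2 : (-1)^s * PowerSeries.coeff s (PowerSeries.X * ((P : PowerSeries A) * ζ^(c+1))) = - Q.coeff c := by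
    rcases Nat.eq_zero_or_pos s with rfl | hs
    · have hc : c = D + 1 := by omega
      subst hc
      rw [hQ]; simp
    · obtain ⟨s, rfl⟩ := Nat.exists_eq_add_of_lt hs
      rw [zero_add] at *
      rw [PowerSeries.coeff_succ_X_mul, ← h3 c s (by omega)]; ring
  have hq : ((Polynomial.C (a - b) + Polynomial.C a * Polynomial.X) * Q) = Polynomial.C (a-b) * Q + Polynomial.C a * (Polynomial.X * Q) := by ring
  rw [hmul, hq, map_add, PowerSeries.coeff_C_mul, PowerSeries.coeff_C_mul, Polynomial.coeff_add, Polynomial.coeff_C_mul, Polynomial.coeff_C_mul]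
  linear_combination a * key + b * key2

theorem MobRel.one {A : Type*} [CommRing A] {ζ : PowerSeries A} (hζ : (1 + PowerSeries.X) * ζ = 1) : MobRel ζ 0 1 1 := by
  refine ⟨by simp, by simp, ?_⟩
  intro c s hcs
  obtain ⟨rfl, rfl⟩ : c = 0 ∧ s = 0 := by omega
  have := congrArg (PowerSeries.coeff 0) hζ
  simpa [PowerSeries.coeff_mul, PowerSeries.coeff_one] using this

theorem MobRel.prod {A : Type*} [CommRing A] {ζ : PowerSeries A} (hζ : (1 + PowerSeries.X) * ζ = 1) (x : Fin n → A) :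
    MobRel ζ (2*n) (∏ p, kk (Polynomial.C (x p)) Polynomial.X) (∏ p, kk Polynomial.X (Polynomial.C (x p))) := by
  induction n with
  | zero => simpa using MobRel.one hζ
  | succ n ih =>
    have h := ((ih (fun p => x p.succ)).mul hζ 1 (1 + x 0)).mul hζ (x 0) (-1)
    rw [Fin.prod_univ_succ, Fin.prod_univ_succ]
    convert h using 1
    · ring
    · unfold kk; simp; ring
    · unfold kk; simp; ring

theorem co_cons (a : ℕ) (N : Fin n → ℕ) (P : MvPolynomial (Fin (n+1)) R) :
    co (Fin.cons a N : Fin (n+1) → ℕ) P = co N ((finSuccEquiv R n P).coeff a) := by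
  rw [co_apply, co_apply, finSuccEquiv_coeff_coeff]
  congr 1

theorem TT_cons (a : ℕ) (N : Fin n → ℕ) (g : Polynomial R) (f : Fin n → Polynomial R) :
    TT (Fin.cons a N : Fin (n+1) → ℕ) (Fin.cons g f : Fin (n+1) → Polynomial R) = 
      co N ((g.map C * ∏ p : Fin n, kk Polynomial.X (Polynomial.C (X p : MvPolynomial (Fin n) R))).coeff a * 
       (pairProd kk (X : Fin n → MvPolynomial (Fin n) R) * ∏ p, Polynomial.aeval (X p : MvPolynomial (Fin n) R) (f p))) := by
  unfold TT
  rw [co_cons, map_mul, ← Polynomial.coeff_mul_C]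
  congr 2
  have hf := pairProd_map (finSuccEquiv R n).toRingHom kk kk 
    (by intros; simp [kk]) (X : Fin (n+1) → MvPolynomial (Fin (n+1)) R)
  have hf2 := pairProd_map (Polynomial.C : MvPolynomial (Fin n) R →+* Polynomial (MvPolynomial (Fin n) R)) kk kk 
    (by intros; simp [kk]) (X : Fin n → MvPolynomial (Fin n) R)
  have hf' : finSuccEquiv R n (pairProd kk X) = pairProd kk (fun i => finSuccEquiv R n (X i)) := hf
  rw [hf', pairProd_succ, Fin.prod_univ_succ, map_mul, map_prod, map_mul, map_prod, hf2]
  have ha : ∀ (x : MvPolynomial (Fin (n+1)) R) (q : Polynomial R), finSuccEquiv R n (Polynomial.aeval x q) = Polynomial.aeval (finSuccEquiv R n x) q :=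
    fun x q => (Polynomial.aeval_algHom_apply (finSuccEquiv R n).toAlgHom x q).symm
  simp only [ha, finSuccEquiv_X_zero, finSuccEquiv_X_succ, Fin.cons_zero, Fin.cons_succ]
  have e1 : Polynomial.aeval (Polynomial.X : Polynomial (MvPolynomial (Fin n) R)) g = g.map C := by
    induction g using Polynomial.induction_on' with
    | add p q hp hq => rw [map_add, Polynomial.map_add, hp, hq]
    | monomial k a => rw [Polynomial.aeval_monomial, Polynomial.map_monomial, ← Polynomial.C_mul_X_pow_eq_monomial]; rfl
  have e2 : ∀ p : Fin n, Polynomial.aeval (Polynomial.C (X p : MvPolynomial (Fin n) R)) (f p) = Polynomial.C (Polynomial.aeval (X p : MvPolynomial (Fin n) R) (f p)) := 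
    fun p => Polynomial.aeval_algebraMap_apply (Polynomial (MvPolynomial (Fin n) R)) (X p) (f p)
  simp only [e1, e2]
  ring

theorem co_rename (N : Fin n → ℕ) (e : Equiv.Perm (Fin n)) (P : MvPolynomial (Fin n) R) :
    co (fun p => N (e.symm p)) (rename e P) = co N P := by
  have hc := coeff_rename_mapDomain e (Equiv.injective _) P (Finsupp.equivFunOnFinite.symm N)
  have hm : (Finsupp.equivFunOnFinite.symm N).mapDomain e = (Finsupp.equivFunOnFinite.symm fun p => N (e.symm p)) := by
    ext p
    rw [Finsupp.mapDomain_equiv_apply]; simp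
  rw [hm] at hc
  exact hc

theorem TT_snoc (a : ℕ) (N : Fin n → ℕ) (g : Polynomial R) (f : Fin n → Polynomial R) :
    TT (Fin.snoc (α := fun _ => ℕ) N a) (Fin.snoc (α := fun _ => Polynomial R) f g) = 
      co N ((g.map C * ∏ p : Fin n, kk (Polynomial.C (X p : MvPolynomial (Fin n) R)) Polynomial.X).coeff a * 
       (pairProd kk (X : Fin n → MvPolynomial (Fin n) R) * ∏ p, Polynomial.aeval (X p : MvPolynomial (Fin n) R) (f p))) := by
  unfold TT
  rw [← co_rename _ (finRotate (n+1))]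
  have e1 : ∀ p : Fin n, finRotate (n+1) p.castSucc = p.succ := fun p => by simp [Fin.coeSucc_eq_succ]
  have hN : (fun p => Fin.snoc (α := fun _ => ℕ) N a ((finRotate (n+1)).symm p)) = (Fin.cons a N : Fin (n+1) → ℕ) := by
    ext p
    refine Fin.cases ?_ (fun q => ?_) p
    · have : (finRotate (n+1)).symm 0 = Fin.last n := by rw [Equiv.symm_apply_eq]; simp
      rw [this]; simp
    · have : (finRotate (n+1)).symm q.succ = q.castSucc := by rw [Equiv.symm_apply_eq, e1]
      rw [this]; simp
  rw [hN, co_cons, map_mul, map_mul, ← Polynomial.coeff_mul_C]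
  congr 2
  have hr := pairProd_map (rename (R := R) (finRotate (n+1))).toRingHom kk kk 
    (by intros; simp [kk]) (X : Fin (n+1) → MvPolynomial (Fin (n+1)) R)
  simp only [AlgHom.toRingHom_eq_coe, RingHom.coe_coe] at hr
  have hf := pairProd_map (finSuccEquiv R n).toRingHom kk kk 
    (by intros; simp [kk]) (fun i => rename (finRotate (n+1)) (X i : MvPolynomial (Fin (n+1)) R))
  have hf2 := pairProd_map (Polynomial.C : MvPolynomial (Fin n) R →+* Polynomial (MvPolynomial (Fin n) R)) kk kk 
    (by intros; simp [kk]) (X : Fin n → MvPolynomial (Fin n) R)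
  have hf' : finSuccEquiv R n (pairProd kk (fun i => rename (finRotate (n+1)) (X i))) = pairProd kk (fun i => finSuccEquiv R n (rename (finRotate (n+1)) (X i))) := hf
  rw [hr, hf', pairProd_last, Fin.prod_univ_castSucc, map_mul, map_mul, map_prod, map_prod, map_mul, map_prod, hf2]
  have ha : ∀ (x : MvPolynomial (Fin (n+1)) R) (q : Polynomial R), finSuccEquiv R n (Polynomial.aeval x q) = Polynomial.aeval (finSuccEquiv R n x) q :=
    fun x q => (Polynomial.aeval_algHom_apply (finSuccEquiv R n).toAlgHom x q).symm
  simp only [← Polynomial.aeval_algHom_apply, ha, rename_X, e1, finRotate_last, finSuccEquiv_X_zero, finSuccEquiv_X_succ, Fin.snoc_castSucc, Fin.snoc_last]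
  have e1 : Polynomial.aeval (Polynomial.X : Polynomial (MvPolynomial (Fin n) R)) g = g.map C := by
    induction g using Polynomial.induction_on' with
    | add p q hp hq => rw [map_add, Polynomial.map_add, hp, hq]
    | monomial k a => rw [Polynomial.aeval_monomial, Polynomial.map_monomial, ← Polynomial.C_mul_X_pow_eq_monomial]; rfl
  have e2 : ∀ p : Fin n, Polynomial.aeval (Polynomial.C (X p : MvPolynomial (Fin n) R)) (f p) = Polynomial.C (Polynomial.aeval (X p : MvPolynomial (Fin n) R) (f p)) := 
    fun p => Polynomial.aeval_algebraMap_apply (Polynomial (MvPolynomial (Fin n) R)) (X p) (f p)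
  simp only [e1, e2]
  ring

theorem TT_mob (t : R) (Z v : Polynomial R) (s : ℕ) (hs1 : 1 ≤ s) (hs2 : s ≤ n+1) 
    (hZ : (1 + Polynomial.X)^(2*(n+1)-s+1) * Z + Polynomial.X^(n+1) * v = 1)
    (N : Fin n → ℕ) (f : Fin n → Polynomial R) :
    TT (Fin.snoc (α := fun _ => ℕ) N n) (Fin.snoc (α := fun _ => Polynomial R) f 
      (Z * ((-Polynomial.X)^(n+1-s) * (1 + Polynomial.C (1 - t) * Polynomial.X)))) =
    (-1)^n * TT (Fin.cons (2*(n+1)-s) N : Fin (n+1) → ℕ) (Fin.cons (Polynomial.C t + Polynomial.X) f : Fin (n+1) → Polynomial R) := by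
  rw [TT_cons, TT_snoc, ← co_C_mul]
  refine congrArg _ ?_
  rw [← mul_assoc (C _)]
  refine congrArg (fun x => x * _) ?_
  set A := MvPolynomial (Fin n) R
  obtain ⟨ζ, hζ⟩ : ∃ ζ : PowerSeries A, (1 + PowerSeries.X) * ζ = 1 := 
    ⟨PowerSeries.invOfUnit (1 + PowerSeries.X) 1, PowerSeries.mul_invOfUnit _ _ (by simp)⟩
  have hM := ((MobRel.prod hζ (X : Fin n → A))).mul hζ 1 (C (1-t))
  have h3 := hM.2.2 (2*(n+1)-s) (s-1) (by omega)
  obtain ⟨k, hk⟩ : ∃ k, n + 1 = s + k := ⟨n+1-s, by omega⟩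
  have hl : (Polynomial.map C (Polynomial.C t + Polynomial.X) * ∏ p : Fin n, kk Polynomial.X (Polynomial.C (X p : A))) =
    ((Polynomial.C (1 - C (1-t)) + Polynomial.C 1 * Polynomial.X) * ∏ p : Fin n, kk Polynomial.X (Polynomial.C (X p : A))) := by
    congr 1
    simp
  rw [hl, ← h3]
  set Q := ∏ p : Fin n, kk (Polynomial.C (X p : A)) Polynomial.X with hQ
  set L := (Polynomial.C 1 + Polynomial.C (C (1-t)) * Polynomial.X : Polynomial A)
  have hZ2 := congrArg (fun q => ((Polynomial.map (C : R →+* A) q : Polynomial A) : PowerSeries A)) hZ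
  simp only [Polynomial.map_add, Polynomial.map_mul, Polynomial.map_pow, Polynomial.map_one, Polynomial.map_X, 
    Polynomial.coe_add, Polynomial.coe_mul, Polynomial.coe_pow, Polynomial.coe_one, Polynomial.coe_X] at hZ2
  have hlow : PowerSeries.coeff (s-1) (((L * Q : Polynomial A) : PowerSeries A) * ζ^(2*(n+1)-s+1)) = 
      PowerSeries.coeff (s-1) (((L * Q * Z.map C : Polynomial A) : PowerSeries A)) := by
    have hpow : (1 + PowerSeries.X)^(2*(n+1)-s+1) * ζ^(2*(n+1)-s+1) = 1 := by rw [← mul_pow, hζ, one_pow]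
    refine coeff_mul_of_low _ _ (((L * Q : Polynomial A) : PowerSeries A) * ζ^(2*(n+1)-s+1) * PowerSeries.X^k * ((v.map C : Polynomial A) : PowerSeries A)) _ ?_
    rw [show s - 1 + 1 = s by omega, Polynomial.coe_mul (L*Q)]
    have e : (PowerSeries.X : PowerSeries A)^(n+1) = PowerSeries.X^s * PowerSeries.X^k := by rw [hk, pow_add]
    rw [e] at hZ2
    linear_combination (-(((L * Q : Polynomial A) : PowerSeries A)) * ζ^(2*(n+1)-s+1)) * hZ2 + (((L * Q : Polynomial A) : PowerSeries A)) * ((Z.map C : Polynomial A) : PowerSeries A) * hpow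
  rw [hlow, Polynomial.coeff_coe]
  have hfin : (Polynomial.map C (Z * ((-Polynomial.X)^(n+1-s) * (1 + Polynomial.C (1 - t) * Polynomial.X))) * Q) = 
     Polynomial.C ((-1)^k) * (Polynomial.X^k * (L * Q * Z.map C)) := by
    rw [show n + 1 - s = k by omega]
    simp only [Polynomial.map_mul, Polynomial.map_pow, Polynomial.map_neg, Polynomial.map_X, Polynomial.map_add, Polynomial.map_one, Polynomial.map_C, L]
    have hc1 : (Polynomial.C ((-1)^k : A) : Polynomial A) = (-1)^k := by
      rw [Polynomial.C_pow, Polynomial.C_neg, Polynomial.C_1]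
    rw [hc1, neg_pow (Polynomial.X : Polynomial A), Polynomial.C_1]
    ring
  have hn : n = s - 1 + k := by omega
  have hco : (Polynomial.X^k * (L * Q * Z.map C)).coeff n = (L * Q * Z.map C).coeff (s-1) := by
    rw [Polynomial.coeff_X_pow_mul', if_pos (by omega), show n - k = s - 1 by omega]
  rw [hfin, Polynomial.coeff_C_mul, hco, ← mul_assoc]
  refine congrArg (fun x => x * _) ?_
  rw [C_pow, C_neg, C_1, ← pow_add]
  conv_rhs => rw [show n + (s-1) = k + 2*(s-1) by omega, pow_add, pow_mul]
  simp

end Mob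


section Congr
open MvPolynomial
variable {R : Type*} [CommRing R] {n : ℕ}

theorem co_X_pow_mul_zero (N : Fin n → ℕ) (p : Fin n) (P : MvPolynomial (Fin n) R) :
    co N (X p ^ (N p + 1) * P) = 0 := by
  rw [co_apply, X_pow_eq_monomial, coeff_monomial_mul', if_neg]
  intro h
  have := h p
  simp at this

theorem co_ideal (N : Fin n → ℕ) (P : MvPolynomial (Fin n) R)
    (h : P ∈ Ideal.span (Set.range fun p => (X p : MvPolynomial (Fin n) R) ^ (N p + 1))) : co N P = 0 := by
  refine Submodule.span_induction (p := fun P _ => ∀ Q, co N (Q * P) = 0) ?_ ?_ ?_ ?_ h 1 |> fun h => by simpa using h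
  · rintro _ ⟨p, rfl⟩ Q
    rw [mul_comm]; exact co_X_pow_mul_zero N p Q
  · intro Q; simp
  · intro x y _ _ hx hy Q
    rw [mul_add, map_add, hx, hy, add_zero]
  · intro a x _ hx Q
    rw [smul_eq_mul, ← mul_assoc]; exact hx _

theorem TT_congr (N : Fin n → ℕ) (f g : Fin n → Polynomial R)
    (h : ∀ p, Polynomial.X ^ (N p + 1) ∣ f p - g p) : TT N f = TT N g := by
  rw [← sub_eq_zero]
  unfold TT
  rw [← map_sub, ← mul_sub]
  apply co_ideal
  apply Ideal.mul_mem_left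
  rw [← Ideal.Quotient.eq, map_prod, map_prod]
  refine Finset.prod_congr rfl fun p _ => ?_
  rw [Ideal.Quotient.eq, ← map_sub]
  obtain ⟨c, hc⟩ := h p
  rw [hc, map_mul, map_pow, Polynomial.aeval_X]
  exact Ideal.mul_mem_right _ _ (Ideal.subset_span ⟨p, rfl⟩)

theorem co_shift (N a : Fin n → ℕ) (P : MvPolynomial (Fin n) R) :
    co (fun p => N p + a p) ((∏ p, X p ^ a p) * P) = co N P := by
  have : (∏ p, (X p : MvPolynomial (Fin n) R) ^ a p) = monomial (Finsupp.equivFunOnFinite.symm a) 1 := by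
    rw [monomial_eq, Finsupp.prod_fintype _ _ (by simp)]; simp
  rw [this, co_apply, coeff_monomial_mul', if_pos (show _ ≤ _ from fun p => by simp), one_mul, co_apply]
  congr 1
  ext p; simp

theorem TT_shift (N a : Fin n → ℕ) (f : Fin n → Polynomial R) :
    TT (fun p => N p + a p) (fun p => Polynomial.X ^ a p * f p) = TT N f := by
  unfold TT
  rw [← co_shift N a]
  refine congrArg _ ?_
  simp only [map_mul, map_pow, Polynomial.aeval_X, Finset.prod_mul_distrib]
  ring
end Congr


section Lists
variable {R : Type*} [CommRing R]

/-- list form of the word functional -/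
noncomputable def TL (N : ℕ) (l : List (Polynomial R)) : R :=
  TT (fun _ : Fin l.length => N) (fun i => l.getD i 0)

theorem TL_eq (N : ℕ) (l : List (Polynomial R)) (n : ℕ) (h : l.length = n) (f : Fin n → Polynomial R)
    (hf : ∀ i : Fin n, l.getD i 0 = f i) : TL N l = TT (fun _ : Fin n => N) f := by
  subst h
  unfold TL
  congr 1
  ext1 i; exact hf i

theorem getD_mid {A : Type*} (x y : List A) (f d : A) : (x ++ f :: y).getD x.length d = f := by
  rw [List.getD_append_right _ _ _ _ le_rfl]; simp

theorem getD_mid_ne {A : Type*} (x y : List A) (f g d : A) (i : ℕ) (h : i ≠ x.length) :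
    (x ++ f :: y).getD i d = (x ++ g :: y).getD i d := by
  rcases lt_or_gt_of_ne h with h | h
  · rw [List.getD_append _ _ _ _ h, List.getD_append _ _ _ _ h]
  · rw [List.getD_append_right _ _ _ _ h.le, List.getD_append_right _ _ _ _ h.le]
    obtain ⟨k, hk⟩ : ∃ k, i - x.length = k + 1 := ⟨i - x.length - 1, by omega⟩
    rw [hk]; simp

theorem TL_mid (N : ℕ) (x y : List (Polynomial R)) (f : Polynomial R) :
    TL N (x ++ f :: y) = TT (fun _ : Fin (x.length + (y.length + 1)) => N)
      (Function.update (fun i => (x ++ 0 :: y).getD i 0) ⟨x.length, by omega⟩ f) := by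
  apply TL_eq
  · simp
  · intro i
    by_cases h : i = ⟨x.length, by omega⟩
    · subst h; rw [Function.update_self, getD_mid]
    · rw [Function.update_of_ne h]
      apply getD_mid_ne
      intro h'; apply h; ext; exact h'

theorem TL_mid2 (N : ℕ) (x y : List (Polynomial R)) (f g : Polynomial R) :
    TL N (x ++ f :: g :: y) = TT (fun _ : Fin (x.length + (y.length + 2)) => N)
      (Function.update (Function.update (fun i => (x ++ 0 :: 0 :: y).getD i 0) ⟨x.length, by omega⟩ f)
        ⟨x.length+1, by omega⟩ g) := by
  apply TL_eq
  · simp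
  · intro i
    by_cases h : i = ⟨x.length+1, by omega⟩
    · subst h; rw [Function.update_self]
      have := getD_mid (x ++ [f]) y g 0
      simpa using this
    · rw [Function.update_of_ne h]
      have h2 := getD_mid_ne (x ++ [f]) y g 0 0 i (by simp; intro h'; apply h; ext; exact h')
      simp only [List.append_assoc, List.cons_append, List.nil_append] at h2
      rw [h2]
      by_cases h : i = ⟨x.length, by omega⟩
      · subst h; rw [Function.update_self, getD_mid]
      · rw [Function.update_of_ne h]
        apply getD_mid_ne
        intro hlen; apply h; ext; exact hlen

/-- multilinear functions on words killing the exchange relation -/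
structure IsW (φ : List (Polynomial R) → R) : Prop where
  h1 : ∀ (x y : List (Polynomial R)) (f g : Polynomial R), φ (x ++ (f+g) :: y) = φ (x ++ f :: y) + φ (x ++ g :: y)
  h2 : ∀ (x y : List (Polynomial R)) (c : R) (f : Polynomial R), φ (x ++ (c • f) :: y) = c * φ (x ++ f :: y)
  h3 : ∀ (x y : List (Polynomial R)) (L : Polynomial R),
    φ (x ++ ((1+Polynomial.X)*L) :: ((1+Polynomial.X)*L) :: y) - φ (x ++ L :: ((1+Polynomial.X)*L) :: y)
      + φ (x ++ L :: L :: y) = 0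

/-- module of such functions -/
def MM (R : Type*) [CommRing R] : Submodule R (List (Polynomial R) → R) where
  carrier := {φ | IsW φ}
  add_mem' := by
    rintro a b ⟨h1, h2, h3⟩ ⟨k1, k2, k3⟩
    refine ⟨fun x y f g => ?_, fun x y c f => ?_, fun x y L => ?_⟩
    · simp only [Pi.add_apply, h1, k1]; ring
    · simp only [Pi.add_apply, h2, k2]; ring
    · simp only [Pi.add_apply]; linear_combination h3 x y L + k3 x y L
  zero_mem' := by
    refine ⟨fun x y f g => ?_, fun x y c f => ?_, fun x y L => ?_⟩ <;> simp
  smul_mem' := by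
    rintro c a ⟨h1, h2, h3⟩
    refine ⟨fun x y f g => ?_, fun x y c f => ?_, fun x y L => ?_⟩
    · simp only [Pi.smul_apply, h1, smul_eq_mul]; ring
    · simp only [Pi.smul_apply, h2, smul_eq_mul]; ring
    · simp only [Pi.smul_apply, smul_eq_mul]; linear_combination c * h3 x y L

theorem TL_mem [IsDomain R] [CharZero R] (N : ℕ) : TL (R := R) N ∈ MM R := by
  show IsW _
  refine ⟨fun x y f g => ?_, fun x y c f => ?_, fun x y L => ?_⟩
  · rw [TL_mid, TL_mid, TL_mid, TT_update_add]
  · rw [TL_mid, TL_mid, TT_update_smul]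
  · rw [TL_mid2, TL_mid2, TL_mid2]
    exact TT_rel N _ _ _ rfl L

theorem MM.isW (φ : MM R) : IsW φ.1 := φ.2

/-- letter operators -/
noncomputable def om : Polynomial R →ₗ[R] Module.End R (MM R) where
  toFun f :=
    { toFun := fun φ => ⟨fun y => φ.1 (y ++ [f]), by
        obtain ⟨h1, h2, h3⟩ := (MM.isW φ)
        show IsW _
        refine ⟨fun x y f g => ?_, fun x y c f => ?_, fun x y L => ?_⟩
        · simpa using h1 x (y ++ [_]) f g
        · simpa using h2 x (y ++ [_]) c f
        · simpa using h3 x (y ++ [_]) L⟩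
      map_add' := fun φ ψ => rfl
      map_smul' := fun c φ => rfl }
  map_add' f g := by
    ext φ y
    have := (MM.isW φ).h1 y [] f g
    exact this
  map_smul' c f := by
    ext φ y
    have := (MM.isW φ).h2 y [] c f
    exact this

theorem om_apply (f : Polynomial R) (φ : MM R) (y : List (Polynomial R)) : (om f φ).1 y = φ.1 (y ++ [f]) := rfl

theorem om_rel (L : Polynomial R) : om ((1+Polynomial.X)*L) * om ((1+Polynomial.X)*L)
    - om L * om ((1+Polynomial.X)*L) + om L * om L = 0 := by
  ext φ y
  have := (MM.isW φ).h3 y [] L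
  simpa [om_apply] using this

theorem om_prod (l : List (Polynomial R)) (φ : MM R) (y : List (Polynomial R)) :
    ((l.map om).prod φ).1 y = φ.1 (y ++ l) := by
  induction l generalizing y with
  | nil => simp
  | cons f l ih =>
    rw [List.map_cons, List.prod_cons]
    have : (om f * (l.map om).prod) φ = om f ((l.map om).prod φ) := rfl
    rw [this, om_apply, ih]; simp

noncomputable def theta [IsDomain R] [CharZero R] (N : ℕ) : Module.End R (MM R) →ₗ[R] R where
  toFun q := (q ⟨TL N, TL_mem N⟩).1 []
  map_add' _ _ := rfl
  map_smul' _ _ := rfl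

theorem theta_prod [IsDomain R] [CharZero R] (N : ℕ) (l : List (Polynomial R)) :
    theta N (l.map om).prod = TL N l := by
  unfold theta
  simp only [LinearMap.coe_mk, AddHom.coe_mk]
  rw [om_prod]; rfl

/-- the skip sum -/
noncomputable def sk (l : List (Polynomial R)) : Module.End R (MM R) :=
  ∑ e ∈ range l.length, ((-1)^e * (l.getD e 0).coeff 0) •
    (((l.take e).map om).prod * ((l.drop (e+1)).map (fun f => om ((1+Polynomial.X)*f))).prod)

theorem sk_nil : sk ([] : List (Polynomial R)) = 0 := by simp [sk]

theorem sk_append (l : List (Polynomial R)) (f : Polynomial R) :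
    sk (l ++ [f]) = sk l * om ((1+Polynomial.X)*f) + ((-1)^l.length * f.coeff 0) • (l.map om).prod := by
  unfold sk
  rw [List.length_append, List.length_singleton, Finset.sum_range_succ, Finset.sum_mul]
  congr 1
  · refine Finset.sum_congr rfl fun e he => ?_
    rw [Finset.mem_range] at he
    rw [List.getD_append _ _ _ _ he, List.take_append_of_le_length he.le, List.drop_append_of_le_length (by omega)]
    simp [mul_assoc]
  · rw [List.getD_append_right _ _ _ _ le_rfl]
    simp

theorem TL_key [IsDomain R] [CharZero R] (n : ℕ) (l : List (Polynomial R)) (hl : l.length = n + 1) :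
    TL n l = theta n (sk l) := by
  rw [TL_eq n l (n+1) hl (fun i => l.getD i 0) (fun _ => rfl), TT_key]
  unfold sk
  rw [map_sum, hl, Finset.sum_range]
  refine Finset.sum_congr rfl fun e _ => ?_
  rw [map_smul, smul_eq_mul]
  refine congrArg _ ?_
  have : ((l.take e).map om).prod * ((l.drop (e+1)).map (fun f => om ((1+Polynomial.X)*f))).prod
    = ((l.take e ++ (l.drop (e+1)).map (fun f => (1+Polynomial.X)*f)).map om).prod := by
    simp [Function.comp_def]
  rw [this, theta_prod]
  symm
  have he := e.2
  apply TL_eq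
  · simp [hl]; omega
  · intro i
    have hi := i.2
    by_cases h : i.castSucc < e
    · rw [if_pos h]
      have h' : (i:ℕ) < e := h
      rw [Fin.succAbove_of_castSucc_lt _ _ h, List.getD_append _ _ _ _ (by simp; omega)]
      simp only [List.getD_eq_getElem?_getD, List.getElem?_take]
      rw [if_pos h']; rfl
    · rw [if_neg h]
      have h' : (e:ℕ) ≤ i := not_lt.mp h
      rw [Fin.succAbove_of_le_castSucc _ _ (not_lt.mp h), List.getD_append_right _ _ _ _ (by simp; omega)]
      have hm : min (e:ℕ) (n+1) = e := by omega
      simp only [List.getD_eq_getElem?_getD, List.getElem?_map, List.getElem?_drop, List.length_take, hl, hm]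
      rw [show (e:ℕ) + 1 + (i - e) = i + 1 by omega, Fin.val_succ]
      rw [List.getElem?_eq_getElem (by omega)]
      simp
end Lists


section Scan
variable {R : Type*} [CommRing R]

/-- letters along a column set -/
noncomputable def lets (g : ℕ → Polynomial R) (S : Finset ℕ) : ℕ → List (Polynomial R)
  | 0 => []
  | c+1 => lets g S c ++ (if c+1 ∈ S then [g (c+1)] else [])

theorem lets_congr (g : ℕ → Polynomial R) (S S' : Finset ℕ) (c : ℕ) (h : ∀ j ∈ Icc 1 c, (j ∈ S ↔ j ∈ S')) :
    lets g S c = lets g S' c := by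
  induction c with
  | zero => rfl
  | succ c ih =>
    unfold lets
    rw [ih (fun j hj => h j (by simp at hj ⊢; omega))]
    have := h (c+1) (by simp)
    simp only [this]

theorem lets_length (g : ℕ → Polynomial R) (S : Finset ℕ) (c : ℕ) :
    (lets g S c).length = (S ∩ Icc 1 c).card := by
  induction c with
  | zero => simp [lets]
  | succ c ih =>
    unfold lets
    rw [List.length_append, ih]
    have : Icc 1 (c+1) = insert (c+1) (Icc 1 c) := by ext; simp; omega
    rw [this]
    split_ifs with h
    · rw [Finset.inter_insert_of_mem h, Finset.card_insert_of_notMem (by simp)]; simp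
    · rw [Finset.inter_insert_of_notMem h]; simp

/-- partial row sums -/
def hs (S' S : Finset ℕ) (c : ℕ) : ℤ :=
  ∑ j ∈ Icc 1 c, ((if j ∈ S then 1 else 0) - (if j ∈ S' then 1 else 0))

theorem hs_zero (S' S : Finset ℕ) : hs S' S 0 = 0 := by simp [hs]

theorem hs_succ (S' S : Finset ℕ) (c : ℕ) : hs S' S (c+1) = hs S' S c +
    ((if c+1 ∈ S then 1 else 0) - (if c+1 ∈ S' then 1 else 0)) := by
  unfold hs; rw [Finset.sum_Icc_succ_top (by omega)]

theorem hs_congr (S' S'' S : Finset ℕ) (c : ℕ) (h : ∀ j ∈ Icc 1 c, (j ∈ S' ↔ j ∈ S'')) :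
    hs S' S c = hs S'' S c := by
  unfold hs
  refine Finset.sum_congr rfl fun j hj => ?_
  simp only [h j hj]

/-- column weights -/
def cw (n i : ℕ) (t : R) (j : ℕ) (e' e : Bool) : R :=
  if j < i ∨ 2 * n < j + i then (if e' = e then 1 else 0)
  else if j = i then (if e && e' then t else 1)
  else if j + i = 2 * n then (if e && !e' then t else 1) else 1

open Classical in
/-- partial row weights -/
noncomputable def PW (n i : ℕ) (t : R) (S' S : Finset ℕ) (c : ℕ) (h : ℤ) : R :=
  if (∀ c' ≤ c, hs S' S c' = 0 ∨ hs S' S c' = 1) ∧ hs S' S c = h then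
    ∏ j ∈ Icc 1 c, cw n i t j (decide (j ∈ S')) (decide (j ∈ S)) else 0

theorem PW_succ (n i : ℕ) (t : R) (S' S : Finset ℕ) (c : ℕ) (h : ℤ) (hh : h = 0 ∨ h = 1) :
    PW n i t S' S (c+1) h = PW n i t S' S c (h - ((if c+1 ∈ S then 1 else 0) - (if c+1 ∈ S' then 1 else 0))) *
      cw n i t (c+1) (decide (c+1 ∈ S')) (decide (c+1 ∈ S)) := by
  classical
  unfold PW
  have : ((∀ c' ≤ c+1, hs S' S c' = 0 ∨ hs S' S c' = 1) ∧ hs S' S (c+1) = h) ↔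
    ((∀ c' ≤ c, hs S' S c' = 0 ∨ hs S' S c' = 1) ∧ hs S' S c = (h - ((if c+1 ∈ S then 1 else 0) - (if c+1 ∈ S' then 1 else 0)))) := by
    constructor
    · rintro ⟨h1, h2⟩
      refine ⟨fun c' hc => h1 c' (by omega), ?_⟩
      rw [hs_succ] at h2; omega
    · rintro ⟨h1, h2⟩
      have h3 : hs S' S (c+1) = h := by rw [hs_succ]; omega
      refine ⟨fun c' hc => ?_, h3⟩
      rcases Nat.lt_or_ge c' (c+1) with h4 | h4
      · exact h1 c' (by omega)
      · have : c' = c+1 := by omega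
        rw [this, h3]; exact hh
  simp only [this]
  rw [ite_mul, zero_mul, Finset.prod_Icc_succ_top (by omega)]

theorem PW_bad (n i : ℕ) (t : R) (S' S : Finset ℕ) (c : ℕ) (h : ℤ) (hh : ¬(h = 0 ∨ h = 1)) :
    PW n i t S' S c h = 0 := by
  unfold PW
  rw [if_neg]
  rintro ⟨h1, h2⟩
  have := h1 c le_rfl
  rw [h2] at this; exact hh this

theorem PW_congr (n i : ℕ) (t : R) (S' S'' S : Finset ℕ) (c : ℕ) (h : ℤ) (hS : ∀ j ∈ Icc 1 c, (j ∈ S' ↔ j ∈ S'')) :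
    PW n i t S' S c h = PW n i t S'' S c h := by
  unfold PW
  have h1 : ∀ c' ≤ c, hs S' S c' = hs S'' S c' := fun c' hc => hs_congr _ _ _ _ fun j hj => hS j (by simp at hj ⊢; omega)
  have h2 : (∀ c' ≤ c, hs S' S c' = 0 ∨ hs S' S c' = 1) ↔ (∀ c' ≤ c, hs S'' S c' = 0 ∨ hs S'' S c' = 1) := by
    refine forall₂_congr fun c' hc => ?_
    rw [h1 c' hc]
  have h3 : ∏ j ∈ Icc 1 c, cw n i t j (decide (j ∈ S')) (decide (j ∈ S)) = ∏ j ∈ Icc 1 c, cw n i t j (decide (j ∈ S'')) (decide (j ∈ S)) := by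
    refine Finset.prod_congr rfl fun j hj => ?_
    simp only [hS j hj]
  rw [h1 c le_rfl, h3]
  simp only [h2]

/-- scanning sums -/
noncomputable def AA (n i : ℕ) (t : R) (g : ℕ → Polynomial R) (S : Finset ℕ) (c : ℕ) (h : ℤ) : Module.End R (MM R) :=
  ∑ S' ∈ (Icc 1 c).powerset, PW n i t S' S c h • ((lets g S' c).map om).prod

theorem AA_bad (n i : ℕ) (t : R) (g : ℕ → Polynomial R) (S : Finset ℕ) (c : ℕ) (h : ℤ) (hh : ¬(h = 0 ∨ h = 1)) :
    AA n i t g S c h = 0 := by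
  unfold AA
  refine Finset.sum_eq_zero fun S' _ => ?_
  rw [PW_bad _ _ _ _ _ _ _ hh, zero_smul]

theorem AA_succ (n i : ℕ) (t : R) (g : ℕ → Polynomial R) (S : Finset ℕ) (c : ℕ) (h : ℤ) (hh : h = 0 ∨ h = 1) :
    AA n i t g S (c+1) h = cw n i t (c+1) false (decide (c+1 ∈ S)) • AA n i t g S c (h - (if c+1 ∈ S then 1 else 0))
     + cw n i t (c+1) true (decide (c+1 ∈ S)) • (AA n i t g S c (h - (if c+1 ∈ S then 1 else 0) + 1) * om (g (c+1))) := by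
  unfold AA
  have : Icc 1 (c+1) = insert (c+1) (Icc 1 c) := by ext; simp; omega
  rw [this, Finset.sum_powerset_insert (by simp), Finset.smul_sum, Finset.sum_mul, Finset.smul_sum]
  congr 1
  · refine Finset.sum_congr rfl fun S' hS' => ?_
    have hn : c + 1 ∉ S' := fun hc => by
      have := Finset.mem_powerset.mp hS' hc; simp at this
    rw [PW_succ _ _ _ _ _ _ _ hh]
    simp only [lets, hn, if_false, List.append_nil, sub_zero, decide_false]
    rw [smul_smul, mul_comm]
  · refine Finset.sum_congr rfl fun S' hS' => ?_
    have hn : c + 1 ∈ insert (c+1) S' := by simp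
    have hc : ∀ j ∈ Icc 1 c, (j ∈ insert (c+1) S' ↔ j ∈ S') := by
      intro j hj; simp at hj ⊢; omega
    rw [PW_succ _ _ _ _ _ _ _ hh]
    simp only [lets, hn, if_true, decide_true]
    rw [lets_congr g _ S' c hc, PW_congr _ _ _ _ S' _ _ _ hc, List.map_append, List.prod_append]
    simp only [List.map_cons, List.map_nil, List.prod_cons, List.prod_nil, mul_one]
    rw [smul_mul_assoc, smul_smul, mul_comm, sub_add]

theorem AA_zero (n i : ℕ) (t : R) (g : ℕ → Polynomial R) (S : Finset ℕ) :
    AA n i t g S 0 0 = 1 ∧ AA n i t g S 0 1 = 0 := by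
  constructor
  · simp [AA, PW, hs_zero, lets]
  · simp [AA, PW, hs_zero, lets]

end Scan


section Inv
open Polynomial
variable {R : Type*} [CommRing R]

/-- wave letters -/
noncomputable def wv (n i : ℕ) (t : R) (s : ℕ) : Polynomial R :=
  if s ≤ i then (1+X)^s * ((-X)^(i-s) * (1 + C (1-t) * X))
  else if s + i < 2*n then (1+X)^s else (1+X)^(2*n-i-1) * (X^(i+s-2*n) * (C t + X))

theorem AA_notmem (n i : ℕ) (t : R) (g : ℕ → Polynomial R) (S : Finset ℕ) (c : ℕ) (h : c+1 ∉ S) :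
    AA n i t g S (c+1) 0 = cw n i t (c+1) false false • AA n i t g S c 0 + cw n i t (c+1) true false • (AA n i t g S c 1 * om (g (c+1)))
    ∧ AA n i t g S (c+1) 1 = cw n i t (c+1) false false • AA n i t g S c 1 := by
  constructor
  · rw [AA_succ _ _ _ _ _ _ _ (Or.inl rfl)]; simp [h]
  · rw [AA_succ _ _ _ _ _ _ _ (Or.inr rfl)]; simp only [h, if_false, decide_false, sub_zero]
    rw [AA_bad _ _ _ _ _ _ (1+1) (by norm_num)]; simp

theorem AA_mem (n i : ℕ) (t : R) (g : ℕ → Polynomial R) (S : Finset ℕ) (c : ℕ) (h : c+1 ∈ S) :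
    AA n i t g S (c+1) 0 = cw n i t (c+1) true true • (AA n i t g S c 0 * om (g (c+1)))
    ∧ AA n i t g S (c+1) 1 = cw n i t (c+1) false true • AA n i t g S c 0 + cw n i t (c+1) true true • (AA n i t g S c 1 * om (g (c+1))) := by
  constructor
  · rw [AA_succ _ _ _ _ _ _ _ (Or.inl rfl)]; simp only [h, if_true, decide_true, zero_sub]
    rw [AA_bad _ _ _ _ _ _ (-1) (by norm_num)]; simp
  · rw [AA_succ _ _ _ _ _ _ _ (Or.inr rfl)]; simp [h]

theorem lets_mem (g : ℕ → Polynomial R) (S : Finset ℕ) (c : ℕ) (h : c+1 ∈ S) : lets g S (c+1) = lets g S c ++ [g (c+1)] := by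
  simp [lets, h]
theorem lets_notmem (g : ℕ → Polynomial R) (S : Finset ℕ) (c : ℕ) (h : c+1 ∉ S) : lets g S (c+1) = lets g S c := by
  simp [lets, h]
theorem prod_append_om (l : List (Polynomial R)) (f : Polynomial R) : ((l ++ [f]).map om).prod = (l.map om).prod * om f := by
  simp

theorem em_mul_sub (a b c : Module.End R (MM R)) : a * (b - c) = a * b - a * c := mul_sub a b c
theorem em_mul_neg (a b : Module.End R (MM R)) : a * (- b) = - (a * b) := by
  rw [← neg_one_smul R b, mul_smul_comm, neg_one_smul]
theorem em_mul_smul (r : R) (a b : Module.End R (MM R)) : a * (r • b) = r • (a * b) := mul_smul_comm r a b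

theorem inv1 (n i : ℕ) (t : R) (S : Finset ℕ) (hi : i + 2 ≤ n) (c : ℕ) (hc : c ≤ i) :
    AA n (i+1) t (fun s => X * wv n i t s) S c 0 = ((-1:R)^(lets (wv n (i+1) t) S c).length) • ((lets (wv n (i+1) t) S c).map om).prod ∧
    AA n (i+1) t (fun s => X * wv n i t s) S c 1 = 0 ∧ sk (lets (wv n (i+1) t) S c) = 0 := by
  induction c with
  | zero =>
    have := AA_zero n (i+1) t (fun s => X * wv n i t s) S
    refine ⟨by rw [this.1]; simp [lets], this.2, by simp [lets, sk_nil]⟩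
  | succ c ih =>
    obtain ⟨h1, h2, h3⟩ := ih (by omega)
    have hcw : ∀ e e', cw n (i+1) t (c+1) e' e = if e' = e then 1 else 0 := by
      intro e e'; unfold cw; rw [if_pos (by omega)]
    by_cases h : c + 1 ∈ S
    · obtain ⟨a0, a1⟩ := AA_mem n (i+1) t (fun s => X * wv n i t s) S c h
      have hw : X * wv n i t (c+1) = - wv n (i+1) t (c+1) := by
        unfold wv; rw [if_pos (by omega), if_pos (by omega), show i + 1 - (c+1) = i - (c+1) + 1 by omega]; ring
      have hz : (wv n (i+1) t (c+1)).coeff 0 = 0 := by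
        rw [← neg_eq_zero, ← Polynomial.coeff_neg, ← hw]; simp
      rw [a0, a1, lets_mem _ _ _ h, sk_append, prod_append_om, h1, h2, h3, hw, hz]
      simp only [hcw]
      refine ⟨?_, by simp, by simp⟩
      simp [pow_succ, em_mul_neg]
      module
    · obtain ⟨a0, a1⟩ := AA_notmem n (i+1) t (fun s => X * wv n i t s) S c h
      rw [a0, a1, lets_notmem _ _ _ h, h1, h2, h3]
      simp [hcw]

theorem inv2 (n i : ℕ) (t : R) (S : Finset ℕ) (hi : i + 2 ≤ n) (c : ℕ) (hc : i < c) (hc2 : c + i + 1 < 2 * n) :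
    AA n (i+1) t (fun s => X * wv n i t s) S c 0 = sk (lets (wv n (i+1) t) S c) * om ((1+X)^(c+1)) +
      ((-1:R)^(lets (wv n (i+1) t) S c).length) • ((lets (wv n (i+1) t) S c).map om).prod ∧
    AA n (i+1) t (fun s => X * wv n i t s) S c 1 = sk (lets (wv n (i+1) t) S c) := by
  induction c, hc using Nat.le_induction with
  | base =>
    obtain ⟨h1, h2, h3⟩ := inv1 n i t S hi i le_rfl
    have hcw : ∀ e e', cw n (i+1) t (i+1) e' e = if e && e' then t else 1 := by
      intro e e'; unfold cw; rw [if_neg (by omega), if_pos rfl]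
    have hg : X * wv n i t (i+1) = X * (1+X)^(i+1) := by
      unfold wv; rw [if_neg (by omega), if_pos (by omega)]
    by_cases h : i + 1 ∈ S
    · obtain ⟨a0, a1⟩ := AA_mem n (i+1) t (fun s => X * wv n i t s) S i h
      have hw : wv n (i+1) t (i+1) = (1+X)^(i+2) - t • (X * (1+X)^(i+1)) := by
        unfold wv; rw [if_pos le_rfl, Polynomial.smul_eq_C_mul, C_sub, C_1]; simp; ring
      have hz : (wv n (i+1) t (i+1)).coeff 0 = 1 := by
        rw [hw, Polynomial.coeff_zero_eq_eval_zero]; simp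
      rw [a0, a1, lets_mem _ _ _ h, sk_append, prod_append_om, h1, h2, h3, hg, hz, hw]
      simp only [hcw, Nat.succ_eq_add_one]
      constructor
      · rw [List.length_append, List.length_singleton, pow_succ, map_sub, map_smul, em_mul_sub, em_mul_smul]
        simp only [Bool.and_self, if_true, zero_mul, zero_add, smul_sub, smul_smul, mul_neg, mul_one, neg_smul, smul_mul_assoc, mul_comm t, add_assoc]
        norm_num
        module
      · simp
    · obtain ⟨a0, a1⟩ := AA_notmem n (i+1) t (fun s => X * wv n i t s) S i h
      simp only [Nat.succ_eq_add_one]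
      rw [a0, a1, lets_notmem _ _ _ h, h1, h2, h3]
      simp [hcw]
  | succ c hc' ih =>
    obtain ⟨h1, h2⟩ := ih (by omega)
    have hcw : ∀ e e', cw n (i+1) t (c+1) e' e = 1 := by
      intro e e'; unfold cw; rw [if_neg (by omega), if_neg (by omega), if_neg (by omega)]
    have hg : X * wv n i t (c+1) = (1+X)^(c+1+1) - (1+X)^(c+1) := by
      unfold wv; rw [if_neg (by omega), if_pos (by omega)]; ring
    by_cases h : c + 1 ∈ S
    · obtain ⟨a0, a1⟩ := AA_mem n (i+1) t (fun s => X * wv n i t s) S c h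
      have hw : wv n (i+1) t (c+1) = (1+X)^(c+1) := by
        unfold wv; rw [if_neg (by omega), if_pos (by omega)]
      have hz : (wv n (i+1) t (c+1)).coeff 0 = 1 := by
        rw [hw, Polynomial.coeff_zero_eq_eval_zero]; simp
      have hrel := om_rel ((1+X)^(c+1) : Polynomial R)
      rw [← pow_succ'] at hrel
      rw [a0, a1, lets_mem _ _ _ h, sk_append, prod_append_om, h1, h2, hg, hz, hw, ← pow_succ']
      simp only [hcw, List.length_append, List.length_singleton, mul_one, one_smul, map_sub]
      set u := om ((1+X)^(c+1+1) : Polynomial R)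
      set l := om ((1+X)^(c+1) : Polynomial R)
      set D := sk (lets (wv n (i+1) t) S c)
      constructor
      · have : D * (l * u - l * l) = D * (u * u) := by
          have : l * u - l * l = u * u := by rw [← sub_eq_zero, ← neg_eq_zero, ← hrel]; abel
          rw [this]
        rw [pow_succ]
        calc _ = D * (l * u - l * l) + (-1:R)^(lets (wv n (i+1) t) S c).length • (((lets (wv n (i+1) t) S c).map om).prod * u) 
              - (-1:R)^(lets (wv n (i+1) t) S c).length • (((lets (wv n (i+1) t) S c).map om).prod * l) := by
              simp only [add_mul, em_mul_sub, smul_mul_assoc, mul_assoc, smul_sub]; module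
          _ = _ := by
              rw [this]; simp only [add_mul, smul_mul_assoc, mul_assoc, mul_neg, mul_one, neg_smul]; module
      · rw [em_mul_sub]; module
    · obtain ⟨a0, a1⟩ := AA_notmem n (i+1) t (fun s => X * wv n i t s) S c h
      rw [a0, a1, lets_notmem _ _ _ h, h1, h2, hg]
      simp only [hcw, one_smul, map_sub, em_mul_sub, and_true]
      abel

theorem inv3 (n i : ℕ) (t : R) (S : Finset ℕ) (hi : i + 2 ≤ n) (c : ℕ) (hc2 : 2 * n ≤ c + i + 1) (hc3 : c < 2 * n) :
    AA n (i+1) t (fun s => X * wv n i t s) S c 1 = sk (lets (wv n (i+1) t) S c) := by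
  have hc2' : 2 * n - i - 1 ≤ c := by omega
  induction c, hc2' using Nat.le_induction with
  | base =>
    obtain ⟨c, hc⟩ : ∃ c, 2 * n - i - 1 = c + 1 := ⟨2*n-i-2, by omega⟩
    rw [hc]
    obtain ⟨h1, h2⟩ := inv2 n i t S hi c (by omega) (by omega)
    have hcw : ∀ e e', cw n (i+1) t (c+1) e' e = if e && !e' then t else 1 := by
      intro e e'; unfold cw; rw [if_neg (by omega), if_neg (by omega), if_pos (by omega)]
    by_cases h : c + 1 ∈ S
    · obtain ⟨a0, a1⟩ := AA_mem n (i+1) t (fun s => X * wv n i t s) S c h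
      have hw : wv n (i+1) t (c+1) = (1+X)^c * (C t + X) := by
        unfold wv; rw [if_neg (by omega), if_neg (by omega), show 2 * n - (i+1) - 1 = c by omega, show i + 1 + (c+1) - 2 * n = 0 by omega]; simp
      have hz : (wv n (i+1) t (c+1)).coeff 0 = t := by
        rw [hw, Polynomial.coeff_zero_eq_eval_zero]; simp
      have hzw : (1 + X) * wv n (i+1) t (c+1) = t • (1+X)^(c+1) + X * wv n i t (c+1) := by
        rw [hw]; unfold wv; rw [if_neg (by omega), if_pos (by omega), Polynomial.smul_eq_C_mul]; ring
      rw [a1, lets_mem _ _ _ h, sk_append, hzw, hz, h1, h2]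
      simp only [hcw, map_add, map_smul, smul_add, mul_add, smul_smul, em_mul_smul]
      simp [mul_comm t]
      abel
    · obtain ⟨a0, a1⟩ := AA_notmem n (i+1) t (fun s => X * wv n i t s) S c h
      rw [a1, lets_notmem _ _ _ h, h2]
      simp [hcw]
  | succ c hc' ih =>
    have h1 := ih (by omega) (by omega)
    have hcw : ∀ e e', cw n (i+1) t (c+1) e' e = if e' = e then 1 else 0 := by
      intro e e'; unfold cw; rw [if_pos (by omega)]
    by_cases h : c + 1 ∈ S
    · obtain ⟨a0, a1⟩ := AA_mem n (i+1) t (fun s => X * wv n i t s) S c h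
      have hw : X * wv n i t (c+1) = (1 + X) * wv n (i+1) t (c+1) := by
        unfold wv; rw [if_neg (by omega), if_neg (by omega), if_neg (by omega), if_neg (by omega),
          show i + 1 + (c+1) - 2 * n = (i + (c+1) - 2 * n) + 1 by omega, 
          show 2 * n - i - 1 = (2 * n - (i+1) - 1) + 1 by omega]; ring
      have hz : (wv n (i+1) t (c+1)).coeff 0 = 0 := by
        have := congrArg (fun q => Polynomial.coeff q 0) hw
        simpa [add_mul] using this.symm
      rw [a1, lets_mem _ _ _ h, sk_append, h1, hw, hz]
      simp [hcw]
    · obtain ⟨a0, a1⟩ := AA_notmem n (i+1) t (fun s => X * wv n i t s) S c h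
      rw [a1, lets_notmem _ _ _ h, h1]
      simp [hcw]

/-- weighted count of partial triangles -/
noncomputable def WW (n : ℕ) (t : R) : ℕ → Finset ℕ → R
  | 0, S => if S = ∅ then 1 else 0
  | i+1, S => ∑ S' ∈ (Icc 1 (2*n-1)).powerset, PW n (i+1) t S' S (2*n-1) 1 * WW n t i S'

theorem WW_eq [IsDomain R] [CharZero R] (n : ℕ) (t : R) (i : ℕ) (hi : i + 1 ≤ n) (S : Finset ℕ) (hS : S ⊆ Icc 1 (2*n-1))
    (hc : S.card = i) : WW n t i S = TL (i-1) (lets (wv n i t) S (2*n-1)) := by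
  have hl : ∀ (S : Finset ℕ) (g : ℕ → Polynomial R), S ⊆ Icc 1 (2*n-1) → (lets g S (2*n-1)).length = S.card := by
    intro S g hS; rw [lets_length, Finset.inter_eq_left.mpr hS]
  induction i generalizing S with
  | zero =>
    have : S = ∅ := by simpa using hc
    subst this
    have h0 : lets (wv n 0 t) ∅ (2*n-1) = [] := by
      rw [← List.length_eq_zero_iff, hl _ _ hS]; simp
    rw [h0, TL_eq 0 [] 0 rfl (fun _ => 0) (fun i => i.elim0)]
    have hz : (Finsupp.equivFunOnFinite.symm fun _ : Fin 0 => 0) = 0 := by ext p; exact p.elim0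
    simp [WW, TT, pairProd, co_apply, hz]
  | succ i ih =>
    rw [Nat.add_sub_cancel, TL_key i _ (by rw [hl _ _ hS, hc]), ← inv3 n i t S (by omega) (2*n-1) (by omega) (by omega)]
    unfold AA
    rw [map_sum]
    unfold WW
    refine Finset.sum_congr rfl fun S' hS' => ?_
    rw [map_smul, smul_eq_mul, theta_prod]
    by_cases hc' : S'.card = i
    · refine congrArg _ ?_
      rw [ih (by omega) S' (Finset.mem_powerset.mp hS') hc']
      have e1 : (lets (wv n i t) S' (2*n-1)).length = i := by rw [hl _ _ (Finset.mem_powerset.mp hS'), hc']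
      have hm : ∀ (c : ℕ), lets (fun s => X * wv n i t s) S' c = (lets (wv n i t) S' c).map (fun f => X * f) := by
        intro c
        induction c with
        | zero => rfl
        | succ c ih => unfold lets; rw [ih]; split_ifs <;> simp
      rw [hm]
      set l := lets (wv n i t) S' (2*n-1)
      rw [TL_eq (i-1) l i e1 (fun p => l.getD p 0) (fun _ => rfl), 
        TL_eq i (l.map (fun f => X * f)) i (by simpa using e1) (fun p => X * l.getD p 0)
          (fun p => by rw [List.getD_eq_getElem _ _ (by simpa [e1] using p.2), List.getD_eq_getElem _ _ (by rw [e1]; exact p.2)]; simp)]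
      have := TT_shift (fun _ : Fin i => i - 1) (fun _ => 1) (fun p => l.getD p 0)
      rw [← this]
      rcases Nat.eq_zero_or_pos i with h0 | h0
      · subst h0
        congr 1
        · ext p; exact p.elim0
        · ext p; exact p.elim0
      · simp only [pow_one, Nat.sub_add_cancel h0]
    · have : PW n (i+1) t S' S (2*n-1) 1 = 0 := by
        unfold PW
        rw [if_neg]
        rintro ⟨_, h⟩
        apply hc'
        unfold hs at h
        rw [Finset.sum_sub_distrib, Finset.sum_ite_mem, Finset.sum_ite_mem, Finset.inter_eq_right.mpr hS,
          Finset.inter_eq_right.mpr (Finset.mem_powerset.mp hS')] at h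
        simp [hc] at h
        omega
      rw [this]; simp
end Inv


section Final
open Polynomial
variable {R : Type*} [CommRing R]

/-- list form with exponents -/
noncomputable def TP (l : List (ℕ × Polynomial R)) : R :=
  TT (fun i : Fin l.length => (l.getD i (0,0)).1) (fun i => (l.getD i (0,0)).2)

theorem TP_eq (l : List (ℕ × Polynomial R)) (n : ℕ) (h : l.length = n) (N : Fin n → ℕ) (f : Fin n → Polynomial R)
    (hf : ∀ i : Fin n, l.getD i (0,0) = (N i, f i)) : TP l = TT N f := by
  subst h
  unfold TP
  simp only [hf]

theorem TP_mob (m : ℕ) (t : R) (Z v : Polynomial R) (s : ℕ) (hs1 : 1 ≤ s) (hs2 : s ≤ m+1)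
    (hZ : (1 + Polynomial.X)^(2*(m+1)-s+1) * Z + Polynomial.X^(m+1) * v = 1) (l : List (ℕ × Polynomial R)) (hl : l.length = m) :
    TP (l ++ [(m, Z * ((-X)^(m+1-s) * (1 + C (1-t) * X)))]) = (-1)^m * TP ((2*(m+1)-s, C t + X) :: l) := by
  rw [TP_eq _ (m+1) (by simp [hl]) (Fin.snoc (α := fun _ => ℕ) (fun i : Fin m => (l.getD i (0,0)).1) m)
    (Fin.snoc (α := fun _ => Polynomial R) (fun i : Fin m => (l.getD i (0,0)).2) (Z * ((-X)^(m+1-s) * (1 + C (1-t) * X)))), 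
    TT_mob t Z v s hs1 hs2 hZ, TP_eq ((2*(m+1)-s, C t + X) :: l) (m+1) (by simp [hl])]
  · intro i
    refine Fin.cases ?_ (fun i => ?_) i
    · simp
    · simp
  · intro i
    refine Fin.lastCases ?_ (fun i => ?_) i
    · have := getD_mid l [] (m, Z * ((-X)^(m+1-s) * (1 + C (1-t) * X))) (0,0)
      rw [hl] at this
      rw [Fin.val_last, this]; simp
    · rw [Fin.val_castSucc, List.getD_append _ _ _ _ (by rw [hl]; exact i.2)]; simp

theorem TP_mob_all (m : ℕ) (t : R) (Z : ℕ → Polynomial R)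
    (hZ : ∀ s, 1 ≤ s → s ≤ m + 1 → ∃ v, (1 + Polynomial.X)^(2*(m+1)-s+1) * Z s + Polynomial.X^(m+1) * v = 1) 
    (ls : List ℕ) (hls : ∀ s ∈ ls, 1 ≤ s ∧ s ≤ m+1) (base : List (ℕ × Polynomial R)) (hlen : base.length + ls.length = m+1) :
    TP (base ++ ls.map (fun s => (m, Z s * ((-X)^(m+1-s) * (1 + C (1-t) * X))))) =
      ((-1)^m)^ls.length * TP (ls.map (fun s => (2*(m+1)-s, C t + X)) ++ base) := by
  induction ls using List.reverseRecOn generalizing base with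
  | nil => simp
  | append_singleton ls s ih =>
    obtain ⟨v, hv⟩ := hZ s (hls s (by simp)).1 (hls s (by simp)).2
    simp only [List.length_append, List.length_singleton] at hlen
    rw [List.map_append, List.map_singleton, ← List.append_assoc, TP_mob m t (Z s) v s (hls s (by simp)).1 (hls s (by simp)).2 hv _ (by simp; omega)]
    have := ih (fun s hs => hls s (by simp [hs])) ((2*(m+1)-s, C t + X) :: base) (by simp; omega)
    rw [List.cons_append] at this
    rw [this]
    simp [pow_succ]; ring

theorem TL_rot [IsDomain R] [CharZero R] (m : ℕ) (g : Polynomial R) (l : List (Polynomial R)) (hl : l.length = m) :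
    TL m ((1+X)^(m+1) * g :: l) = (-1)^m * TL m (l ++ [g]) := by
  rw [TL_eq _ _ (m+1) (by simp [hl]) (Fin.cons ((1+X)^(m+1) * g) (fun i : Fin m => l.getD i 0)), TT_rot,
    TL_eq m (l ++ [g]) (m+1) (by simp [hl])]
  · intro i
    refine Fin.lastCases ?_ (fun i => ?_) i
    · have := getD_mid l [] g 0
      rw [hl] at this
      rw [Fin.val_last, this]; simp
    · rw [Fin.val_castSucc, List.getD_append _ _ _ _ (by rw [hl]; exact i.2)]; simp
  · intro i
    refine Fin.cases ?_ (fun i => ?_) i <;> simp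

theorem TL_rot_all [IsDomain R] [CharZero R] (m : ℕ) (g : ℕ → Polynomial R) (ls : List ℕ) (rs : List (Polynomial R)) (hl : ls.length + rs.length = m + 1) :
    TL m (ls.map (fun s => (1+X)^(m+1) * g s) ++ rs) = ((-1)^m)^ls.length * TL m (rs ++ ls.map g) := by
  induction ls generalizing rs with
  | nil => simp
  | cons s ls ih =>
    simp only [List.length_cons] at hl
    rw [List.map_cons, List.cons_append, TL_rot _ _ _ (by simp; omega), List.append_assoc, ih _ (by simp; omega)]
    simp [pow_succ]; ring

theorem TL_gauge [IsDomain R] [CharZero R] (m k : ℕ) (l : List (Polynomial R)) (hl : l.length = m + 1) :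
    TL m (l.map (fun f => (1+X)^k * f)) = TL m l := by
  rw [TL_eq m l (m+1) hl (fun i => l.getD i 0) (fun _ => rfl), TL_eq m (l.map (fun f => (1+X)^k * f)) (m+1) (by simpa using hl) (fun i => (1+X)^k * l.getD i 0), TT_gauge_pow _ (fun p => le_rfl)]
  intro p
  rw [List.getD_eq_getElem _ _ (by simpa [hl] using p.2), List.getD_eq_getElem _ _ (by rw [hl]; exact p.2)]; simp

theorem TL_TP [IsDomain R] [CharZero R] (m k : ℕ) (l : List (Polynomial R)) (l' : List (ℕ × Polynomial R)) (hl : l.length = m + 1)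
    (h : List.Forall₂ (fun f q => ∃ a, q.1 + a = m ∧ X^(m+1) ∣ f - (1+X)^k * (X^a * q.2)) l l') : TL m l = TP l' := by
  have hl' : l'.length = m+1 := by rw [← h.length_eq, hl]
  have hg : ∀ i : Fin (m+1), ∃ a, (l'.getD i (0,0)).1 + a = m ∧ X^(m+1) ∣ l.getD i 0 - (1+X)^k * (X^a * (l'.getD i (0,0)).2) := by
    intro i
    rw [List.getD_eq_getElem l' _ (by rw [hl']; exact i.2), List.getD_eq_getElem l _ (by rw [hl]; exact i.2)]
    exact h.get (by rw [hl]; exact i.2) (by rw [hl']; exact i.2)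
  choose a ha hd using hg
  rw [TL_eq m l (m+1) hl (fun i => l.getD i 0) (fun _ => rfl), TP_eq l' (m+1) hl' (fun i => (l'.getD i (0,0)).1) (fun i => (l'.getD i (0,0)).2) (fun _ => rfl)]
  have hs := TT_shift (fun i : Fin (m+1) => (l'.getD i ((0,0) : ℕ × Polynomial R)).1) a (fun i => (l'.getD i ((0,0) : ℕ × Polynomial R)).2)
  rw [← hs]
  have ha' : (fun p : Fin (m+1) => (l'.getD p ((0,0) : ℕ × Polynomial R)).1 + a p) = fun _ => m := funext ha
  simp only [ha']
  rw [← TT_gauge_pow (fun _ => m) (fun p => le_rfl) (fun p : Fin (m+1) => X ^ a p * (l'.getD p (0,0)).2) k]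
  exact TT_congr _ _ _ hd

/-- sorted column list -/
def slist (S : Finset ℕ) (c : ℕ) : List ℕ := (List.range' 1 c).filter (fun j => j ∈ S)

theorem lets_eq (g : ℕ → Polynomial R) (S : Finset ℕ) (c : ℕ) : lets g S c = (slist S c).map g := by
  induction c with
  | zero => rfl
  | succ c ih =>
    unfold lets slist
    rw [ih, List.range'_1_concat, List.filter_append, List.map_append, slist, add_comm 1 c]
    congr 1
    split_ifs with h <;> simp [h]

/-- label of a (mirrored) column -/
def lab (m s : ℕ) : ℕ := if s ≤ m then 2*m - s else 2*m+1-s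

theorem WW_final [IsDomain R] [CharZero R] (m : ℕ) (t : R) (S : Finset ℕ) (hS : S ⊆ Icc 1 (2*m+3)) (hc : S.card = m+1)
    (hn : m+2 ∉ S) : WW (m+2) t (m+1) S = TP ((slist S (2*m+3)).map (fun s => (lab (m+1) s, C t + X))) := by
  rw [WW_eq (m+2) t (m+1) (by omega) S (by rw [show 2*(m+2)-1 = 2*m+3 by omega]; exact hS) hc, show 2 * (m+2) - 1 = 2*m+3 by omega, Nat.add_sub_cancel]
  have hlen := lets_length (wv (m+2) (m+1) t) S (2*m+3)
  rw [Finset.inter_eq_left.mpr hS, hc, lets_eq] at hlen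
  rw [lets_eq]
  have hsplit : slist S (2*m+3) = (List.range' 1 (m+1)).filter (fun j => j ∈ S) ++ (List.range' (m+2) (m+2)).filter (fun j => j ∈ S) := by
    rw [slist, ← List.filter_append]
    congr 1
    rw [show 2*m+3 = (m+1) + (m+2) by ring, ← List.range'_append]
    congr 2; ring
  rw [hsplit] at hlen ⊢
  set ls := (List.range' 1 (m+1)).filter (fun j => j ∈ S) with hls
  set rs := (List.range' (m+2) (m+2)).filter (fun j => j ∈ S) with hrs
  have hl1 : ∀ s ∈ ls, 1 ≤ s ∧ s ≤ m+1 := by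
    intro s hs; simp [hls, List.mem_range'_1] at hs; omega
  have hr1 : ∀ s ∈ rs, m + 3 ≤ s ∧ s ≤ 2*m+3 := by
    intro s hs; simp [hrs, List.mem_range'_1] at hs
    have : s ≠ m+2 := by rintro rfl; exact hn hs.2
    omega
  simp only [List.length_map, List.length_append] at hlen
  set g : ℕ → Polynomial R := fun s => (1+X)^s * ((-X)^(m+1-s) * (1 + C (1-t) * X)) with hg
  have e1 : (ls ++ rs).map (wv (m+2) (m+1) t) = ls.map g ++ rs.map (fun s => (1+X)^(m+2) * (X^(s-m-3) * (C t + X))) := by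
    rw [List.map_append]
    congr 1
    · refine List.map_congr_left fun s hs => ?_
      unfold wv; rw [if_pos (hl1 s hs).2]
    · refine List.map_congr_left fun s hs => ?_
      have := hr1 s hs
      unfold wv; rw [if_neg (by omega), if_neg (by omega), show 2 * (m+2) - (m+1) - 1 = m+2 by omega, show m + 1 + s - 2 * (m+2) = s - m - 3 by omega]
  rw [e1, ← TL_gauge m (m+1) _ (by simp; omega), List.map_append, List.map_map]
  have e2 := TL_rot_all m g ls ((rs.map (fun s => (1+X)^(m+2) * (X^(s-m-3) * (C t + X)))).map (fun f => (1+X)^(m+1) * f)) (by simp; omega)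
  have e3 : (fun f => (1+X)^(m+1) * f) ∘ g = fun s => (1+X)^(m+1) * g s := rfl
  rw [e3, e2]
  have hZ : ∀ s, ∃ Z v : Polynomial R, (1+X)^(2*(m+1)-s+1) * Z + X^(m+1) * v = 1 := by
    intro s
    exact exists_trunc_inv _ (by rw [coeff_zero_eq_eval_zero]; simp) _
  choose Z v hZ using hZ
  have e4 := TP_mob_all m t Z (fun s _ _ => ⟨v s, hZ s⟩) ls hl1 (rs.map (fun s => (lab (m+1) s, C t + X))) (by simp; omega)
  have e5 : ls.map (fun s => (lab (m+1) s, C t + X)) = ls.map (fun s => (2*(m+1)-s, (C t + X : Polynomial R))) := by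
    refine List.map_congr_left fun s hs => ?_
    unfold lab; rw [if_pos (hl1 s hs).2]
  rw [List.map_append, e5]
  have hsq : (((-1:R)^m)^ls.length) * ((-1)^m)^ls.length = 1 := by
    rw [← mul_pow, ← mul_pow]; simp
  rw [TL_TP m (2*m+3) _ (rs.map (fun s => (lab (m+1) s, C t + X)) ++ ls.map (fun s => (m, Z s * ((-X)^(m+1-s) * (1 + C (1-t) * X))))) (by simp; omega), e4, ← mul_assoc, hsq, one_mul]
  rw [List.map_map]
  refine List.rel_append ?_ ?_
  · rw [List.forall₂_map_left_iff, List.forall₂_map_right_iff, List.forall₂_same]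
    intro s hs
    have := hr1 s hs
    refine ⟨s - m - 3, ?_, ?_⟩
    · unfold lab; rw [if_neg (by omega)]; omega
    · simp only [Function.comp_apply]
      have h3 : ((1+X)^(2*m+3):Polynomial R) = (1+X)^(m+1)*(1+X)^(m+2) := by rw [← pow_add]; congr 1; omega
      rw [h3, mul_assoc, sub_self]; exact dvd_zero _
  · rw [List.forall₂_map_left_iff, List.forall₂_map_right_iff, List.forall₂_same]
    intro s hs
    have := hl1 s hs
    refine ⟨0, by simp, ?_⟩
    refine ⟨g s * v s, ?_⟩
    have h2 := hZ s
    have h3 : ((1+X)^(2*m+3) : Polynomial R) = (1+X)^s * (1+X)^(2*(m+1)-s+1) := by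
      rw [← pow_add]; congr 1; omega
    simp only [hg, h3]
    linear_combination (-(1 + X) ^ s * ((-X) ^ (m + 1 - s) * (1 + C (1 - t) * X))) * h2

end Final


section LagrangeId
variable {k : ℕ}

theorem prod_erase_succAbove {K : Type*} [CommRing K] (f : Fin (k+1) → K) (i : Fin (k+1)) :
    ∏ j ∈ univ.erase i, f j = ∏ j : Fin k, f (i.succAbove j) := by
  rw [← Finset.compl_singleton, ← Fin.image_succAbove_univ, Finset.prod_image]
  intro a _ b _ h
  exact Fin.succAbove_right_injective h

theorem prod_neg_fin {K : Type*} [CommRing K] {k : ℕ} (f g : Fin k → K) (h : ∀ j, f j = - g j) :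
    ∏ j, f j = (-1)^k * ∏ j, g j := by
  simp only [h, Finset.prod_neg, Finset.card_univ, Fintype.card_fin]

theorem lagr {K : Type*} [Field K] (v : Fin (k+1) → K) (hv : Function.Injective v) (h0 : ∀ a, v a ≠ 0)
    (h1 : ∀ a, v a ≠ -1) (Q : Polynomial K) (hQ : Q.natDegree ≤ k+1) :
    ∑ a, Q.eval (v a) / (v a * (v a + 1) * ∏ j, (v (a.succAbove j) - v a)) =
      Q.eval 0 / ∏ a, v a - Q.eval (-1) / ∏ a, (1 + v a) := by
  set w : Fin (k+3) → K := Fin.cons 0 (Fin.cons (-1) v) with hw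
  have hwi : Function.Injective w := by
    rw [hw, Fin.cons_injective_iff, Fin.cons_injective_iff]
    refine ⟨?_, ?_, hv⟩
    · rintro ⟨i, hi⟩
      revert hi
      refine Fin.cases ?_ (fun i => ?_) i
      · simp
      · simpa using h0 i
    · rintro ⟨i, hi⟩; exact h1 i hi
  have := Lagrange.coeff_eq_sum (s := univ) (v := w) hwi.injOn (P := Q) (by
    refine lt_of_le_of_lt Polynomial.degree_le_natDegree ?_
    simp only [card_univ, Fintype.card_fin]
    exact_mod_cast by omega)
  rw [Polynomial.coeff_eq_zero_of_natDegree_lt (by simp; omega)] at this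
  simp only [prod_erase_succAbove] at this
  rw [Fin.sum_univ_succ, Fin.sum_univ_succ] at this
  simp only [Fin.prod_univ_succ (n := k+1), Fin.succAbove_zero, Fin.succ_succAbove_succ, Fin.succ_succAbove_zero, hw, Fin.cons_zero, Fin.cons_succ] at this
  simp only [Fin.prod_univ_succ (n := k), Fin.succAbove_zero, Fin.succ_succAbove_succ, Fin.succ_succAbove_zero, hw, Fin.cons_zero, Fin.cons_succ] at this
  have e1 : ∀ a, Q.eval (v a) / ((v a - 0) * ((v a - -1) * ∏ j, (v a - v (a.succAbove j)))) = (-1)^k * (Q.eval (v a) / (v a * (v a + 1) * ∏ j, (v (a.succAbove j) - v a))) := by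
    intro a
    have : ∏ j, (v a - v (a.succAbove j)) = (-1)^k * ∏ j, (v (a.succAbove j) - v a) := by
      exact prod_neg_fin _ _ fun j => by ring
    rw [this, sub_zero, sub_neg_eq_add]
    rcases neg_one_pow_eq_or K k with h | h <;> rw [h] <;> field_simp
  simp only [e1, ← Finset.mul_sum] at this
  have e2 : (0 - v 0) * ∏ i : Fin k, (0 - v i.succ) = (-1)^(k+1) * ∏ a, v a := by
    rw [← Fin.prod_univ_succ (fun i => 0 - v i)]
    exact prod_neg_fin _ _ fun j => by ring
  have e3 : (-1 - v 0) * ∏ i : Fin k, (-1 - v i.succ) = (-1)^(k+1) * ∏ a, (1 + v a) := by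
    rw [← Fin.prod_univ_succ (fun i => -1 - v i)]
    exact prod_neg_fin _ _ fun j => by ring
  rw [e2, e3] at this
  have n0 : ∏ a, v a ≠ 0 := Finset.prod_ne_zero_iff.mpr fun a _ => h0 a
  have n1 : ∏ a, (1 + v a) ≠ 0 := Finset.prod_ne_zero_iff.mpr fun a _ => fun h => h1 a (by linear_combination h)
  have s : ((-1:K)^k) * (-1)^k = 1 := by rw [← mul_pow]; simp
  rw [pow_succ] at this
  have s' : ((-1:K)^k) ≠ 0 := by intro h; simp [h] at s
  have t1 : Q.eval 0 / ((0 - -1) * ((-1)^k * -1 * ∏ a, v a)) = - (-1)^k * (Q.eval 0 / ∏ a, v a) := by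
    rcases neg_one_pow_eq_or K k with h | h <;> rw [h] <;> field_simp <;> ring
  have t2 : Q.eval (-1) / ((-1 - 0) * ((-1)^k * -1 * ∏ a, (1+v a))) = (-1)^k * (Q.eval (-1) / ∏ a, (1+v a)) := by
    rcases neg_one_pow_eq_or K k with h | h <;> rw [h] <;> field_simp <;> ring
  rw [t1, t2] at this
  generalize ∑ a, Q.eval (v a) / (v a * (v a + 1) * ∏ j, (v (a.succAbove j) - v a)) = U at *
  linear_combination (-(-1)^k) * this + (Q.eval 0 / ∏ a, v a - U - Q.eval (-1) / ∏ a, (1+v a)) * s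

theorem pairProd_symm {A : Type*} [CommRing A] (k' : A → A → A) (hk : ∀ a b, k' a b = k' b a) (x : Fin (k+1) → A)
    (e : Fin (k+1)) :
    pairProd k' x = (∏ p : Fin k, k' (x e) (x (e.succAbove p))) * pairProd k' (fun p => x (e.succAbove p)) := by
  rw [pairProd_succAbove k' x e]
  congr 1
  refine Finset.prod_congr rfl fun p _ => ?_
  rw [hk (x (e.succAbove p))]; simp

theorem alg_field {K : Type*} [Field K] (b : K → K → K) (v : K → K) (q : K → Polynomial K) (x : Fin (k+1) → K)
    (hv : Function.Injective fun a => v (x a)) (h0 : ∀ a, v (x a) ≠ 0) (h1 : ∀ a, v (x a) ≠ -1) (hx : ∀ a, x a ≠ 0)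
    (hq : ∀ y, (q y).natDegree ≤ 1) (q1 : ∀ a y, (q y).eval (v a) = b a y * (1 - a * y))
    (q2 : ∀ a, (1 - a) * (v a * (v a + 1)) = a * (q a).eval (v a)) (q3 : ∀ y, (q y).eval 0 * y = v y) 
    (q4 : ∀ y, (q y).eval (-1) = 1 + v y) :
    ∑ a, (1 - x a) * (∏ j, ((x a - x (a.succAbove j)) * b (x a) (x (a.succAbove j)) * x (a.succAbove j) * 
      (1 - x a * x (a.succAbove j)))) * pairProd (fun x y => -((x - y) * (v x - v y))) (fun j => x (a.succAbove j)) =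
    (1 - ∏ a, x a) * pairProd (fun x y => -((x - y) * (v x - v y))) x := by
  set E := pairProd (fun x y => -((x - y) * (v x - v y))) x with hE
  have hQ : (∏ a, q (x a)).natDegree ≤ k + 1 := by
    refine (Polynomial.natDegree_prod_le _ _).trans ?_
    refine (Finset.sum_le_sum fun i _ => hq _).trans ?_
    simp
  have L := lagr (fun a => v (x a)) hv h0 h1 (∏ a, q (x a)) hQ
  have n0 : ∏ a, v (x a) ≠ 0 := Finset.prod_ne_zero_iff.mpr fun a _ => h0 a
  have n1 : ∏ a, (1 + v (x a)) ≠ 0 := Finset.prod_ne_zero_iff.mpr fun a _ => fun h => h1 a (by linear_combination h)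
  have nx : ∏ a, x a ≠ 0 := Finset.prod_ne_zero_iff.mpr fun a _ => hx a
  simp only [Polynomial.eval_prod, q4, div_self n1] at L
  have e0 : (∏ a, (q (x a)).eval 0) / ∏ a, v (x a) = 1 / ∏ a, x a := by
    rw [div_eq_div_iff n0 nx, ← Finset.prod_mul_distrib]; simp [q3]
  rw [e0] at L
  have R : (1 - ∏ a, x a) = (∏ a, x a) * (1 / (∏ a, x a) - 1) := by field_simp
  rw [R, ← L, Finset.mul_sum, Finset.sum_mul]
  refine Finset.sum_congr rfl fun a _ => ?_
  rw [hE, pairProd_symm _ (fun a b => by ring) x a]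
  set E' := pairProd (fun x y => -((x - y) * (v x - v y))) (fun j => x (a.succAbove j))
  rw [Fin.prod_univ_succAbove x a, Fin.prod_univ_succAbove _ a]
  have hne : ∀ j, v (x (a.succAbove j)) - v (x a) ≠ 0 := fun j h => 
    Fin.succAbove_ne a j (hv (sub_eq_zero.mp h))
  have nd : ∏ j, (v (x (a.succAbove j)) - v (x a)) ≠ 0 := Finset.prod_ne_zero_iff.mpr fun j _ => hne j
  have nv : v (x a) + 1 ≠ 0 := fun h => h1 a (by linear_combination h)
  simp only [q1, Finset.prod_mul_distrib]
  have e1 : ∏ j, -((x a - x (a.succAbove j)) * (v (x a) - v (x (a.succAbove j)))) =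
     (∏ j, (x a - x (a.succAbove j))) * ∏ j, (v (x (a.succAbove j)) - v (x a)) := by
    rw [← Finset.prod_mul_distrib]; exact Finset.prod_congr rfl fun j _ => by ring
  rw [e1]
  have q2' := q2 (x a)
  rw [q1] at q2'
  have q2'' : x a * (b (x a) (x a) * (1 - x a * x a)) / (v (x a) * (v (x a) + 1)) = 1 - x a := by
    rw [← q2', mul_div_assoc, div_self (mul_ne_zero (h0 a) nv), mul_one]
  rw [← q2'']
  have := h0 a
  field_simp
end LagrangeId


section AlgRing
variable {k : ℕ}

/-- interpolating kernels: `ε = 1` is the AST one, `ε = 0` the Magog one -/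
def bE {A : Type*} [CommRing A] (ε : ℕ) (x y : A) : A := 1 + ε * (y + x * y)
def vE {A : Type*} [CommRing A] (ε : ℕ) (x : A) : A := x * (1 + ε * x)
def eE {A : Type*} [CommRing A] (ε : ℕ) (x y : A) : A := -((x - y) * (vE ε x - vE ε y))

def algL {A : Type*} [CommRing A] (ε : ℕ) (x : Fin (k+1) → A) : A :=
    ∑ a, (1 - x a) * (∏ j, ((x a - x (a.succAbove j)) * bE ε (x a) (x (a.succAbove j)) * x (a.succAbove j) * 
      (1 - x a * x (a.succAbove j)))) * pairProd (eE ε) (fun j => x (a.succAbove j))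

theorem map_bE {A B : Type*} [CommRing A] [CommRing B] (f : A →+* B) (ε : ℕ) (x y : A) : f (bE ε x y) = bE ε (f x) (f y) := by
  simp [bE]
theorem map_vE {A B : Type*} [CommRing A] [CommRing B] (f : A →+* B) (ε : ℕ) (x : A) : f (vE ε x) = vE ε (f x) := by
  simp [vE]
theorem map_eE {A B : Type*} [CommRing A] [CommRing B] (f : A →+* B) (ε : ℕ) (x y : A) : f (eE ε x y) = eE ε (f x) (f y) := by
  simp [eE, map_vE]

theorem map_algL {A B : Type*} [CommRing A] [CommRing B] (f : A →+* B) (ε : ℕ) (x : Fin (k+1) → A) :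
    f (algL ε x) = algL ε (fun i => f (x i)) := by
  unfold algL
  rw [map_sum]
  refine Finset.sum_congr rfl fun a _ => ?_
  simp only [map_mul, map_prod, map_sub, map_one, map_bE, pairProd_map f _ _ (map_eE f ε)]

theorem alg_ring {A : Type*} [CommRing A] (ε : ℕ) (hε : ε = 0 ∨ ε = 1) (x : Fin (k+1) → A) :
    algL ε x = (1 - ∏ a, x a) * pairProd (eE ε) x := by
  -- generic case
  have key : algL ε (fun i => (MvPolynomial.X i : MvPolynomial (Fin (k+1)) ℤ)) = (1 - ∏ a, MvPolynomial.X a) * pairProd (eE ε) MvPolynomial.X := by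
    set P := MvPolynomial (Fin (k+1)) ℤ
    set F := FractionRing P
    have hinj : Function.Injective (algebraMap P F) := IsFractionRing.injective P F
    apply hinj
    rw [map_algL, map_mul, map_sub, map_one, map_prod, pairProd_map _ _ _ (map_eE _ ε)]
    have ev : ∀ (p q : P) (c : Fin (k+1) → ℤ), MvPolynomial.eval c p ≠ MvPolynomial.eval c q → algebraMap P F p ≠ algebraMap P F q := by
      intro p q c h h2
      exact h (by rw [hinj h2])
    refine alg_field (bE ε) (vE ε) (fun y => Polynomial.C (1 + (ε:F) * y) - Polynomial.C (y * (1 - ε + ε * y)) * Polynomial.X) _ ?_ ?_ ?_ ?_ ?_ ?_ ?_ ?_ ?_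
    · intro a a' h
      by_contra hne
      simp only [← map_vE] at h
      refine ev _ _ (Pi.single a 1) ?_ h
      simp only [map_vE, MvPolynomial.eval_X]
      rw [Pi.single_eq_same, Pi.single_eq_of_ne (Ne.symm hne)]
      rcases hε with rfl | rfl <;> simp [vE]
    · intro a
      rw [← map_vE, ← map_zero (algebraMap P F)]
      refine ev _ _ (fun _ => 1) ?_
      simp only [map_vE, MvPolynomial.eval_X, map_zero]
      rcases hε with rfl | rfl <;> simp [vE]
    · intro a
      rw [← map_vE, ← map_one (algebraMap P F), ← map_neg]
      refine ev _ _ (fun _ => 1) ?_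
      simp only [map_vE, MvPolynomial.eval_X, map_neg, map_one]
      rcases hε with rfl | rfl <;> simp [vE]
    · intro a
      rw [← map_zero (algebraMap P F)]
      refine ev _ _ (fun _ => 1) ?_
      simp
    · intro y
      compute_degree
    all_goals intros; rcases hε with rfl | rfl <;> simp [vE, bE] <;> ring
  have := congrArg (MvPolynomial.eval₂Hom (Int.castRingHom A) x) key
  rw [map_algL, map_mul, map_sub, map_one, map_prod, pairProd_map _ _ _ (map_eE _ ε)] at this
  simpa using this

/-- sums over strictly increasing exponents, list version -/
def HL {A : Type*} [CommRing A] (r : ℕ) : ℕ → List A → A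
  | _, [] => 1
  | s, x :: l => ∑ b ∈ Ico s (r+1), x^b * HL r (b+1) l

theorem HL_shift {A : Type*} [CommRing A] (r : ℕ) (l : List A) (hl : ∀ x ∈ l, x^(r+1) = 0) (s : ℕ) :
    HL r (s+1) l = l.prod * HL r s l := by
  induction l generalizing s with
  | nil => simp [HL]
  | cons x l ih =>
    have ih := ih (fun y hy => hl y (by simp [hy]))
    rw [HL, HL, List.prod_cons, Finset.mul_sum]
    simp only [ih]
    have e : ∀ b, x * l.prod * (x^b * (l.prod * HL r b l)) = x^(b+1) * (l.prod * HL r (b+1) l) := by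
      intro b; rw [ih]; ring
    simp only [e]
    rcases Nat.lt_or_ge r s with h | h
    · rw [Finset.Ico_eq_empty (by omega), Finset.Ico_eq_empty (by omega)]; simp
    · rw [Finset.sum_Ico_succ_top h, hl x (by simp), zero_mul, add_zero]
      exact (Finset.sum_Ico_add' (fun b => x^b * (l.prod * HL r b l)) s r 1).symm

theorem HL_rec {A : Type*} [CommRing A] (r : ℕ) (x : A) (l : List A) (hx : x^(r+1) = 0) (hl : ∀ x ∈ l, x^(r+1) = 0) :
    (1 - x * l.prod) * HL r 0 (x :: l) = l.prod * HL r 0 l := by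
  have h1 := HL_shift r (x :: l) (by simp [hx]; exact hl) 0
  rw [List.prod_cons] at h1
  rw [sub_mul, one_mul, ← h1, HL, HL, Finset.sum_eq_sum_Ico_succ_bot (by omega), HL_shift r l hl]
  simp

theorem sum_perm_cons {A B : Type*} [AddCommMonoid B] (f : (Fin (k+1) → A) → B) (x : Fin (k+1) → A) :
    ∑ σ : Equiv.Perm (Fin (k+1)), f (fun i => x (σ i)) =
      ∑ a, ∑ τ : Equiv.Perm (Fin k), f (Fin.cons (x a) (fun j => x (a.succAbove (τ j)))) := by
  rw [← Equiv.sum_comp Equiv.Perm.decomposeFin.symm, Fintype.sum_prod_type]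
  refine Finset.sum_congr rfl fun a _ => ?_
  have : ∃ c : Equiv.Perm (Fin k), ∀ j, a.succAbove (c j) = Equiv.swap 0 a j.succ := by
    refine Fin.cases ?_ (fun i => ?_) a
    · exact ⟨1, fun j => by simp⟩
    · exact ⟨i.cycleRange, fun j => Fin.succAbove_cycleRange i j⟩
  obtain ⟨c, hc⟩ := this
  refine Fintype.sum_equiv (Equiv.mulLeft c) _ _ fun τ => ?_
  congr 1
  funext i
  refine Fin.cases ?_ (fun i => ?_) i
  · simp
  · simp [hc]

/-- symmetrised sum -/
def Psi {A : Type*} [CommRing A] (ε r : ℕ) (x : Fin k → A) : A :=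
  ∑ σ : Equiv.Perm (Fin k), pairProd (fun a b => (a - b) * bE ε a b) (fun i => x (σ i)) * HL r 0 (List.ofFn fun i => x (σ i))

theorem Psi_rec {A : Type*} [CommRing A] (ε r : ℕ) (x : Fin (k+1) → A) (hx : ∀ i, x i ^(r+1) = 0) :
    (1 - ∏ i, x i) * Psi ε r x = ∑ a, (∏ j, ((x a - x (a.succAbove j)) * bE ε (x a) (x (a.succAbove j)) * x (a.succAbove j))) *
      Psi ε r (fun j => x (a.succAbove j)) := by
  unfold Psi
  rw [sum_perm_cons (fun y => pairProd (fun a b => (a - b) * bE ε a b) y * HL r 0 (List.ofFn y)), Finset.mul_sum]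
  refine Finset.sum_congr rfl fun a _ => ?_
  rw [Finset.mul_sum, Finset.mul_sum]
  refine Finset.sum_congr rfl fun τ _ => ?_
  rw [pairProd_succ, List.ofFn_succ]
  simp only [Fin.cons_zero, Fin.cons_succ]
  have h1 := HL_rec r (x a) (List.ofFn fun j => x (a.succAbove (τ j))) (hx a) (by
    intro y hy
    rw [List.mem_ofFn] at hy
    obtain ⟨j, rfl⟩ := hy
    exact hx _)
  rw [List.prod_ofFn] at h1
  have h2 : ∏ j, x (a.succAbove (τ j)) = ∏ j, x (a.succAbove j) := Equiv.prod_comp τ (fun j => x (a.succAbove j))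
  have h3 : ∏ j, ((x a - x (a.succAbove (τ j))) * bE ε (x a) (x (a.succAbove (τ j)))) = ∏ j, ((x a - x (a.succAbove j)) * bE ε (x a) (x (a.succAbove j))) := 
    Equiv.prod_comp τ (fun j => (x a - x (a.succAbove j)) * bE ε (x a) (x (a.succAbove j)))
  rw [h2, ← Fin.prod_univ_succAbove x a] at h1
  rw [h3, Finset.prod_mul_distrib (f := fun j => (x a - x (a.succAbove j)) * bE ε (x a) (x (a.succAbove j)))]
  linear_combination (∏ j, ((x a - x (a.succAbove j)) * bE ε (x a) (x (a.succAbove j)))) * pairProd (fun a b => (a - b) * bE ε a b) (fun p => x (a.succAbove (τ p))) * h1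

theorem Psi_closed {A : Type*} [CommRing A] (ε : ℕ) (hε : ε = 0 ∨ ε = 1) (r : ℕ) (x : Fin k → A) (hx : ∀ i, x i ^(r+1) = 0) :
    (∏ i, (1 - x i)) * pairProd (fun a b => 1 - a * b) x * Psi ε r x = pairProd (eE ε) x := by
  induction k with
  | zero => simp [Psi, pairProd, HL]
  | succ k ih =>
    have hu : IsUnit (1 - ∏ i, x i) := by
      apply IsNilpotent.isUnit_one_sub
      rw [Fin.prod_univ_succ]
      exact (Commute.all _ _).isNilpotent_mul_right ⟨r+1, hx 0⟩
    apply hu.mul_left_cancel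
    rw [← alg_ring ε hε, algL, mul_left_comm, Psi_rec ε r x hx, Finset.mul_sum]
    refine Finset.sum_congr rfl fun a _ => ?_
    rw [← ih (fun j => x (a.succAbove j)) (fun j => hx _), Fin.prod_univ_succAbove _ a, pairProd_symm _ (fun a b => by ring) x a]
    rw [Finset.prod_mul_distrib (f := fun j => (x a - x (a.succAbove j)) * bE ε (x a) (x (a.succAbove j)) * x (a.succAbove j))]
    ring

theorem eE_one {A : Type*} [CommRing A] (x : Fin k → A) :
    pairProd (eE 1) x = pairProd (fun a b => 1 + a + b) x * pairProd (eE 0) x := by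
  rw [← pairProd_mul]
  congr 1; funext a b
  simp [eE, vE]; ring

/-- the two symmetrised sums agree -/
theorem Psi_eq {A : Type*} [CommRing A] (r : ℕ) (x : Fin k → A) (hx : ∀ i, x i ^(r+1) = 0) :
    Psi 1 r x = pairProd (fun a b => 1 + a + b) x * Psi 0 r x := by
  have hu : IsUnit ((∏ i, (1 - x i)) * pairProd (fun a b => 1 - a * b) x) := by
    refine IsUnit.mul ?_ ?_
    · rw [IsUnit.prod_univ_iff]
      exact fun i => IsNilpotent.isUnit_one_sub ⟨r+1, hx i⟩
    · unfold pairProd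
      rw [IsUnit.prod_univ_iff]; intro i
      rw [IsUnit.prod_univ_iff]; intro j
      split_ifs
      · exact IsNilpotent.isUnit_one_sub ((Commute.all _ _).isNilpotent_mul_right ⟨r+1, hx i⟩)
      · exact isUnit_one
  apply hu.mul_left_cancel
  rw [Psi_closed 1 (by simp) r x hx, mul_left_comm, Psi_closed 0 (by simp) r x hx, eE_one]
end AlgRing


section LamSec
variable {k : ℕ}

/-- strictly increasing exponent vectors in `[s, r]` -/
noncomputable def smF (k r s : ℕ) : Finset (Fin k → ℕ) := by
  classical
  exact (Fintype.piFinset fun _ => Ico s (r+1)).filter StrictMono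

theorem mem_smF (r s : ℕ) (b : Fin k → ℕ) : b ∈ smF k r s ↔ (∀ i, s ≤ b i ∧ b i ≤ r) ∧ StrictMono b := by
  simp [smF, Nat.lt_succ_iff]

theorem strictMono_cons_iff (c : ℕ) (b : Fin k → ℕ) : StrictMono (Fin.cons c b : Fin (k+1) → ℕ) ↔ (∀ j, c < b j) ∧ StrictMono b := by
  constructor
  · intro h
    refine ⟨fun j => ?_, fun i j hij => ?_⟩
    · have := h (Fin.succ_pos j); simpa using this
    · have := h (Fin.succ_lt_succ_iff.mpr hij); simpa using this
  · rintro ⟨h1, h2⟩ i j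
    refine Fin.cases ?_ (fun i => ?_) i <;> refine Fin.cases ?_ (fun j => ?_) j
    · simp
    · intro _; simpa using h1 j
    · intro h; simp at h
    · intro h; simpa using h2 (Fin.succ_lt_succ_iff.mp h)

theorem sum_smF_succ {B : Type*} [AddCommMonoid B] (r s : ℕ) (f : (Fin (k+1) → ℕ) → B) :
    ∑ b ∈ smF (k+1) r s, f b = ∑ c ∈ Ico s (r+1), ∑ b ∈ smF k r (c+1), f (Fin.cons c b) := by
  rw [Finset.sum_sigma']
  symm
  refine Finset.sum_bij' (fun p _ => Fin.cons p.1 p.2) (fun b _ => ⟨b 0, Fin.tail b⟩) ?_ ?_ ?_ ?_ ?_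
  · rintro ⟨c, b⟩ h
    simp only [mem_sigma, mem_Ico, mem_smF] at h
    rw [mem_smF, strictMono_cons_iff]
    refine ⟨fun i => ?_, fun j => by have := h.2.1 j; simp only at this ⊢; omega, h.2.2⟩
    refine Fin.cases ?_ (fun i => ?_) i
    · simp; omega
    · have := h.2.1 i; simp; omega
  · intro b h
    rw [mem_smF, ← Fin.cons_self_tail b, strictMono_cons_iff] at h
    simp only [mem_sigma, mem_Ico, mem_smF]
    have h0 := h.1 0
    simp only [Fin.cons_zero] at h0
    refine ⟨by omega, fun i => ?_, h.2.2⟩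
    have h1 := h.1 i.succ
    have h2 := h.2.1 i
    simp only [Fin.cons_succ] at h1
    omega
  · rintro ⟨c, b⟩ h
    simp
  · intro b h
    simp
  · intro a h; rfl

theorem HL_eq {A : Type*} [CommRing A] (r : ℕ) (x : Fin k → A) (s : ℕ) :
    HL r s (List.ofFn x) = ∑ b ∈ smF k r s, ∏ i, x i ^ b i := by
  induction k generalizing s with
  | zero =>
    have : smF 0 r s = {Fin.elim0} := by
      ext b
      rw [mem_smF, mem_singleton]
      exact ⟨fun _ => Subsingleton.elim _ _, fun _ => ⟨fun i => i.elim0, fun i => i.elim0⟩⟩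
    rw [this]; simp [HL]
  | succ k ih =>
    rw [sum_smF_succ, List.ofFn_succ, HL]
    refine Finset.sum_congr rfl fun c _ => ?_
    rw [ih, Finset.mul_sum]
    refine Finset.sum_congr rfl fun b _ => ?_
    rw [Fin.prod_univ_succ]; simp

open MvPolynomial
variable {R : Type*} [CommRing R]

/-- sum of the coefficients at strictly decreasing exponents `≤ r` -/
noncomputable def Lam (r : ℕ) (P : MvPolynomial (Fin k) R) : R :=
  ∑ b ∈ smF k r 0, co (fun i => r - b i) P

theorem Lam_eq (r : ℕ) (P : MvPolynomial (Fin k) R) :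
    Lam r P = co (fun _ => r) (P * HL r 0 (List.ofFn X)) := by
  rw [HL_eq, Finset.mul_sum, map_sum]
  refine Finset.sum_congr rfl fun b hb => ?_
  rw [mem_smF] at hb
  have := co_shift (fun i => r - b i) b P
  rw [← this, mul_comm]
  congr 1
  congr 1
  funext i
  have := hb.1 i
  omega

theorem rename_pairProd (κ : MvPolynomial (Fin k) R → MvPolynomial (Fin k) R → MvPolynomial (Fin k) R)
    (σ : Equiv.Perm (Fin k)) (h : ∀ a b, rename σ (κ a b) = κ (rename σ a) (rename σ b)) :
    rename σ (pairProd κ X) = pairProd κ (fun i => X (σ i)) := by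
  have := pairProd_map (rename σ : MvPolynomial (Fin k) R →ₐ[R] _).toRingHom κ κ h X
  simpa using this

theorem rename_HL {A B : Type*} [CommRing A] [CommRing B] (f : A →+* B) (r s : ℕ) (x : Fin k → A) :
    f (HL r s (List.ofFn x)) = HL r s (List.ofFn fun i => f (x i)) := by
  rw [HL_eq, HL_eq]; simp

theorem Lam_symm (ε r : ℕ) (F : MvPolynomial (Fin k) R) (hF : ∀ σ : Equiv.Perm (Fin k), rename σ F = F) :
    (Nat.factorial k : R) * Lam r (F * pairProd (fun a b => (a - b) * bE ε a b) X) = co (fun _ => r) (F * Psi ε r X) := by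
  rw [Psi, Finset.mul_sum, map_sum]
  have : ∀ σ : Equiv.Perm (Fin k), co (fun _ => r) (F * (pairProd (fun a b => (a - b) * bE ε a b) (fun i => X (σ i)) * HL r 0 (List.ofFn fun i => (X (σ i) : MvPolynomial (Fin k) R)))) = Lam r (F * pairProd (fun a b => (a - b) * bE ε a b) X) := by
    intro σ
    rw [Lam_eq, ← co_rename (fun _ => r) σ (F * _ * _), map_mul (rename σ), map_mul (rename σ), hF, rename_pairProd]
    · have := rename_HL (rename σ : MvPolynomial (Fin k) R →ₐ[R] _).toRingHom r 0 X
      simp only [AlgHom.toRingHom_eq_coe, RingHom.coe_coe, rename_X] at this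
      rw [this, mul_assoc]
    · intro a b; simp [bE]
  rw [Finset.sum_congr rfl fun σ _ => this σ]
  simp [Fintype.card_perm]

theorem perm_tail (σ : Equiv.Perm (Fin (k+1))) : ∃ τ : Equiv.Perm (Fin k), ∀ j, σ j.succ = (σ 0).succAbove (τ j) := by
  obtain ⟨⟨a, e⟩, rfl⟩ := Equiv.Perm.decomposeFin.symm.surjective σ
  have : ∃ c : Equiv.Perm (Fin k), ∀ j, a.succAbove (c j) = Equiv.swap 0 a j.succ := by
    refine Fin.cases ?_ (fun i => ?_) a
    · exact ⟨1, fun j => by simp⟩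
    · exact ⟨i.cycleRange, fun j => Fin.succAbove_cycleRange i j⟩
  obtain ⟨c, hc⟩ := this
  exact ⟨c * e, fun j => by simp [hc]⟩

theorem pairProd_perm {A : Type*} [CommRing A] (κ : A → A → A) (hκ : ∀ a b, κ a b = κ b a) (x : Fin k → A) (σ : Equiv.Perm (Fin k)) :
    pairProd κ (fun i => x (σ i)) = pairProd κ x := by
  induction k with
  | zero => simp [pairProd]
  | succ k ih =>
    obtain ⟨τ, hτ⟩ := perm_tail σ
    rw [pairProd_succ, pairProd_symm κ hκ x (σ 0)]
    simp only [hτ]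
    rw [ih (fun j => x ((σ 0).succAbove j)) τ]
    congr 1
    exact Equiv.prod_comp τ fun j => κ (x (σ 0)) (x ((σ 0).succAbove j))

theorem map_Psi {A B : Type*} [CommRing A] [CommRing B] (f : A →+* B) (ε r : ℕ) (x : Fin k → A) :
    f (Psi ε r x) = Psi ε r (fun i => f (x i)) := by
  unfold Psi
  rw [map_sum]
  refine Finset.sum_congr rfl fun σ _ => ?_
  rw [map_mul, rename_HL, pairProd_map f _ (fun a b => (a - b) * bE ε a b) (by simp [map_bE])]

theorem Lam_AM [IsDomain R] [CharZero R] (r : ℕ) (F : MvPolynomial (Fin k) R) (hF : ∀ σ : Equiv.Perm (Fin k), rename σ F = F) :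
    Lam r (F * pairProd (fun a b => (a - b) * (1 + b + a * b)) X) = Lam r (F * pairProd (fun a b => (a - b) * (1 + a + b)) X) := by
  have hk : (Nat.factorial k : R) ≠ 0 := by exact_mod_cast Nat.factorial_ne_zero k
  apply mul_left_cancel₀ hk
  have hS : ∀ σ : Equiv.Perm (Fin k), rename σ (pairProd (fun a b => 1 + a + b) (X : Fin k → MvPolynomial (Fin k) R)) = pairProd (fun a b => 1 + a + b) X := by
    intro σ
    rw [rename_pairProd _ _ (by simp)]
    exact pairProd_perm _ (fun a b => by ring) X σ
  have h1 := Lam_symm 1 r F hF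
  have h0 := Lam_symm 0 r (F * pairProd (fun a b => 1 + a + b) X) (by intro σ; rw [map_mul, hF, hS])
  have e1 : (fun a b : MvPolynomial (Fin k) R => (a - b) * bE 1 a b) = (fun a b => (a - b) * (1 + b + a * b)) := by
    funext a b; simp [bE, add_assoc]
  have e0 : F * pairProd (fun a b => 1 + a + b) X * pairProd (fun a b : MvPolynomial (Fin k) R => (a - b) * bE 0 a b) X = F * pairProd (fun a b => (a - b) * (1 + a + b)) X := by
    rw [mul_assoc, ← pairProd_mul]
    congr 2; funext a b; simp [bE]; ring
  rw [e1] at h1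
  rw [e0] at h0
  rw [h1, h0, ← sub_eq_zero, ← map_sub]
  apply co_ideal
  rw [← Ideal.Quotient.eq, map_mul, map_mul, map_mul, mul_assoc]
  congr 1
  rw [map_Psi, map_Psi, Psi_eq, pairProd_map _ (fun a b => 1 + a + b) (fun a b => 1 + a + b) (by simp)]
  intro i
  rw [← map_pow, Ideal.Quotient.eq_zero_iff_mem]
  exact Ideal.subset_span ⟨i, rfl⟩
end LamSec


section MagogCo
open MvPolynomial
variable {R : Type*} [CommRing R] {k : ℕ}

/-- Vandermonde kernel in `u = x (1 + x)` -/
def uk {A : Type*} [CommRing A] (a b : A) : A := (a - b) * (1 + a + b)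

theorem uk_eq {A : Type*} [CommRing A] (x : Fin k → A) : pairProd uk x = vsign A k * (Matrix.vandermonde fun i => x i * (1 + x i)).det := by
  rw [← pairProd_sub_eq]
  unfold pairProd
  refine Finset.prod_congr rfl fun i _ => Finset.prod_congr rfl fun j _ => ?_
  unfold uk
  split_ifs
  · ring
  · rfl

theorem co_tX (t : R) (e : Fin k → ℕ) (P : MvPolynomial (Fin k) R) :
    co e ((∏ p, (C t + X p)) * P) = ∑ e' ∈ Fintype.piFinset (fun p => Icc (e p - 1) (e p)),
      t ^ (univ.filter fun p => e' p = e p).card * co e' P := by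
  rw [Finset.prod_add, Finset.sum_mul, map_sum]
  have h1 : ∀ T ∈ (univ : Finset (Fin k)).powerset, co e ((∏ p ∈ T, C t) * (∏ p ∈ univ \ T, X p) * P) =
      if (∀ p ∉ T, 1 ≤ e p) then t ^ T.card * co (fun p => if p ∈ T then e p else e p - 1) P else 0 := by
    intro T _
    have hX : (∏ p ∈ univ \ T, (X p : MvPolynomial (Fin k) R)) = ∏ p, X p ^ (if p ∈ T then 0 else 1) := by
      rw [← Finset.prod_subset (Finset.subset_univ (univ \ T))]
      · exact Finset.prod_congr rfl fun p hp => by simp at hp; simp [hp]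
      · intro p _ hp; simp at hp; simp [hp]
    rw [Finset.prod_const, ← C_pow, mul_assoc, co_C_mul, hX, co_X_mul_perm, mul_ite, mul_zero]
    have hc : (∀ p, (if p ∈ T then 0 else 1) ≤ e p) ↔ (∀ p ∉ T, 1 ≤ e p) := by
      refine forall_congr' fun p => ?_
      by_cases hp : p ∈ T <;> simp [hp]
    simp only [hc]
    congr 4
    funext p
    by_cases hp : p ∈ T <;> simp [hp]
  rw [Finset.sum_congr rfl h1, ← Finset.sum_filter]
  refine Finset.sum_bij' (fun T _ => fun p => if p ∈ T then e p else e p - 1) (fun e' _ => univ.filter fun p => e' p = e p) ?_ ?_ ?_ ?_ ?_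
  · intro T _
    simp only [Fintype.mem_piFinset, mem_Icc]
    intro p; split_ifs <;> omega
  · intro e' he
    simp only [Fintype.mem_piFinset, mem_Icc] at he
    simp only [mem_filter, mem_powerset, subset_univ, true_and, mem_univ]
    intro p hp; have := he p; omega
  · intro T hT
    simp only [mem_filter, mem_powerset, subset_univ, true_and] at hT
    ext p
    simp only [mem_filter, mem_univ, true_and]
    by_cases hp : p ∈ T
    · simp [hp]
    · have := hT p hp; simp [hp]; omega
  · intro e' he
    simp only [Fintype.mem_piFinset, mem_Icc] at he
    funext p
    have := he p
    simp only [mem_filter, mem_univ, true_and]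
    split_ifs <;> omega
  · intro T hT
    simp only [mem_filter, mem_powerset, subset_univ, true_and] at hT
    congr 2
    congr 1
    ext p
    simp only [mem_filter, mem_univ, true_and]
    by_cases hp : p ∈ T
    · simp [hp]
    · have := hT p hp; simp [hp]; omega

theorem co_uk_eq [IsDomain R] [CharZero R] (e : Fin k → ℕ) (p q : Fin k) (hpq : p ≠ q) (he : e p = e q) :
    co e (pairProd uk (X : Fin k → MvPolynomial (Fin k) R)) = 0 := by
  have h1 : rename (Equiv.swap p q) (pairProd uk (X : Fin k → MvPolynomial (Fin k) R)) = - pairProd uk X := by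
    rw [rename_pairProd _ _ (by simp [uk]), uk_eq, uk_eq]
    have := Matrix.det_permute (Equiv.swap p q) (Matrix.vandermonde fun i : Fin k => (X i : MvPolynomial (Fin k) R) * (1 + X i))
    rw [Equiv.Perm.sign_swap hpq] at this
    have h2 : (Matrix.vandermonde fun i : Fin k => (X i : MvPolynomial (Fin k) R) * (1 + X i)).submatrix (Equiv.swap p q) id = Matrix.vandermonde (fun i => X (Equiv.swap p q i) * (1 + X (Equiv.swap p q i))) := by
      ext i j; simp [Matrix.vandermonde]
    rw [h2] at this
    rw [this]; simp
  have h2 := co_rename e (Equiv.swap p q) (pairProd uk (X : Fin k → MvPolynomial (Fin k) R))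
  rw [h1, map_neg] at h2
  have h3 : (fun i => e ((Equiv.swap p q).symm i)) = e := by
    funext i
    rw [Equiv.symm_swap, Equiv.swap_apply_def]
    split_ifs with h h' <;> simp_all
  rw [h3] at h2
  have : (2:R) * co e (pairProd uk (X : Fin k → MvPolynomial (Fin k) R)) = 0 := by linear_combination -h2
  simpa using this

theorem co_uk_pos (e : Fin (k+1) → ℕ) (he : ∀ p, 1 ≤ e p) :
    co e (pairProd uk (X : Fin (k+1) → MvPolynomial (Fin (k+1)) R)) = 0 := by
  rw [uk_eq, vsign_C, co_C_mul, Matrix.det_apply', map_sum]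
  rw [Finset.sum_eq_zero, mul_zero]
  intro σ _
  have hm : (((Equiv.Perm.sign σ : ℤ) : MvPolynomial (Fin (k+1)) R) * ∏ i, (Matrix.vandermonde fun i => (X i : MvPolynomial (Fin (k+1)) R) * (1 + X i)) (σ i) i) ∈ supported R ({σ 0}ᶜ : Set (Fin (k+1))) := by
    refine Subalgebra.mul_mem _ (intCast_mem _ _) (Subalgebra.prod_mem _ fun i _ => ?_)
    rw [Matrix.vandermonde_apply]
    by_cases hi : i = 0
    · subst hi; simp
    · have : (X (σ i) : MvPolynomial (Fin (k+1)) R) ∈ supported R ({σ 0}ᶜ : Set (Fin (k+1))) := by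
        refine Algebra.subset_adjoin ⟨σ i, ?_, rfl⟩
        simpa using hi
      exact Subalgebra.pow_mem _ (Subalgebra.mul_mem _ this (Subalgebra.add_mem _ (Subalgebra.one_mem _) this)) _
  rw [mem_supported] at hm
  rw [co_apply]
  by_contra hne
  have h1 := mem_support_iff.mpr hne
  have h2 : σ 0 ∈ (((Equiv.Perm.sign σ : ℤ) : MvPolynomial (Fin (k+1)) R) * ∏ i, (Matrix.vandermonde fun i => (X i : MvPolynomial (Fin (k+1)) R) * (1 + X i)) (σ i) i).vars := by
    rw [mem_vars]
    refine ⟨_, h1, ?_⟩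
    simp only [Finsupp.mem_support_iff, Finsupp.equivFunOnFinite_symm_apply_apply]
    have := he (σ 0); omega
  exact hm h2 rfl

theorem co_uk_zero (e : Fin (k+1) → ℕ) (h0 : e (Fin.last k) = 0) (he : ∀ p : Fin k, 1 ≤ e p.castSucc) :
    co e (pairProd uk (X : Fin (k+1) → MvPolynomial (Fin (k+1)) R)) = 
      co (fun p : Fin k => e p.castSucc - 1) ((∏ p, (1 + X p)) * pairProd uk (X : Fin k → MvPolynomial (Fin k) R)) := by
  have h1 : e = (Fin.last k).insertNth 0 (fun p : Fin k => e p.castSucc) := by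
    funext i
    refine Fin.lastCases ?_ (fun i => ?_) i <;> simp [h0]
  rw [h1, co_skip, pairProd_last, map_mul, map_prod]
  have hc : ∀ p : Fin k, killCompl (R := R) (Fin.succAbove_right_injective (p := Fin.last k)) (X p.castSucc) = X p := by
    intro p
    have := killCompl_rename_app (R := R) (Fin.succAbove_right_injective (p := Fin.last k)) (X p)
    rw [rename_X, Fin.succAbove_last_apply] at this
    exact this
  have hl : killCompl (R := R) (Fin.succAbove_right_injective (p := Fin.last k)) (X (Fin.last k)) = 0 := by
    rw [killCompl, aeval_X, dif_neg]
    rintro ⟨i, hi⟩; exact Fin.succAbove_ne _ _ hi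
  have hp := pairProd_map (killCompl (R := R) (Fin.succAbove_right_injective (p := Fin.last k))).toRingHom uk uk (by intro a b; simp [uk]) (fun p : Fin k => X p.castSucc)
  simp only [AlgHom.toRingHom_eq_coe, RingHom.coe_coe, hc] at hp
  rw [hp]
  have hq : ∀ p : Fin k, killCompl (R := R) (Fin.succAbove_right_injective (p := Fin.last k)) (uk (X p.castSucc) (X (Fin.last k))) = X p * (1 + X p) := by
    intro p
    simp only [uk, map_mul, map_sub, map_add, map_one]
    rw [hc, hl, sub_zero, add_zero]
  simp only [hq]
  have := co_shift (fun p : Fin k => e p.castSucc - 1) (fun _ => 1) ((∏ p, (1 + X p)) * pairProd uk (X : Fin k → MvPolynomial (Fin k) R))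
  rw [Finset.prod_mul_distrib, mul_assoc]
  simp only [pow_one] at this
  simp only [Fin.insertNth_last', Fin.snoc_castSucc]
  rw [← this]
  congr 2
  funext p
  have := he p; omega

theorem co_step [IsDomain R] [CharZero R] (t : R) (e : Fin (k+1) → ℕ) (he : StrictAnti e) :
    co e ((∏ p, (C t + X p)) * pairProd uk X) = ∑ e' ∈ (Fintype.piFinset (fun p => Icc (e p - 1) (e p))).filter (fun e' => (∀ p q, p < q → e' q < e' p) ∧ e' (Fin.last k) = 0),
      t ^ (univ.filter fun p => e' p = e p).card * co (fun p : Fin k => e' p.castSucc - 1) ((∏ p, (C 1 + X p)) * pairProd uk (X : Fin k → MvPolynomial (Fin k) R)) := by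
  rw [co_tX, Finset.sum_filter]
  refine Finset.sum_congr rfl fun e' he' => ?_
  simp only [Fintype.mem_piFinset, mem_Icc] at he'
  split_ifs with h
  · rw [co_uk_zero e' h.2, C_1]
    intro p; have := h.1 _ _ (Fin.castSucc_lt_last p); omega
  · by_cases h1 : ∃ p q, p ≠ q ∧ e' p = e' q
    · obtain ⟨p, q, h2, h3⟩ := h1
      rw [co_uk_eq e' p q h2 h3, mul_zero]
    · push Not at h1
      have h2 : ∀ p q, p < q → e' q < e' p := by
        intro p q hpq
        have a := he hpq
        have b := he' p
        have c := he' q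
        have d := h1 p q (ne_of_lt hpq)
        omega
      rw [co_uk_pos, mul_zero]
      intro p
      have h3 : e' (Fin.last k) ≠ 0 := fun h3 => h ⟨h2, h3⟩
      rcases eq_or_ne p (Fin.last k) with rfl | hp
      · omega
      · have := h2 p _ (lt_of_le_of_ne (Fin.le_last p) hp); omega
end MagogCo


section Chains
variable {R : Type*} [CommRing R] {St : Type*}

open Classical in
/-- transfer recursion -/
noncomputable def Wt (U : Finset St) (w : ℕ → St → St → R) (ini : St) : ℕ → St → R
  | 0, S => if S = ini then 1 else 0
  | i+1, S => ∑ S' ∈ U, w (i+1) S' S * Wt U w ini i S'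

open Classical in
/-- weight of a chain -/
noncomputable def chW (w : ℕ → St → St → R) (ini : St) (f : St → R) {N : ℕ} (c : Fin (N+1) → St) : R :=
  (if c 0 = ini then 1 else 0) * (∏ j : Fin N, w (j+1) (c j.castSucc) (c j.succ)) * f (c (Fin.last N))

theorem Wt_chain (U : Finset St) (w : ℕ → St → St → R) (ini : St) (N : ℕ) (f : St → R) :
    ∑ S ∈ U, f S * Wt U w ini N S = ∑ c ∈ Fintype.piFinset (fun _ : Fin (N+1) => U), chW w ini f c := by
  induction N generalizing f with
  | zero =>
    refine Finset.sum_bij' (fun S _ => fun _ => S) (fun c _ => c 0) ?_ ?_ ?_ ?_ ?_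
    · intro S hS; simpa using hS
    · intro c hc; exact Fintype.mem_piFinset.mp hc 0
    · intro S _; rfl
    · intro c _; funext i; exact congrArg c (Subsingleton.elim (α := Fin 1) _ _)
    · intro S _; simp [Wt, chW, mul_comm]
  | succ N ih =>
    have h1 : ∑ S ∈ U, f S * Wt U w ini (N+1) S = ∑ S' ∈ U, (∑ S ∈ U, f S * w (N+1) S' S) * Wt U w ini N S' := by
      simp only [Wt, Finset.mul_sum, Finset.sum_mul]
      rw [Finset.sum_comm]
      refine Finset.sum_congr rfl fun S' _ => Finset.sum_congr rfl fun S _ => by ring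
    rw [h1, ih]
    have h2 : ∀ c ∈ Fintype.piFinset (fun _ : Fin (N+1) => U), chW w ini (fun S' => ∑ S ∈ U, f S * w (N+1) S' S) c = ∑ S ∈ U, chW w ini f (Fin.snoc c S : Fin (N+2) → St) := by
      intro c _
      simp only [chW, Finset.mul_sum]
      refine Finset.sum_congr rfl fun S _ => ?_
      rw [Fin.prod_univ_castSucc]
      have e0 : (Fin.snoc c S : Fin (N+2) → St) 0 = c 0 := by
        rw [← Fin.castSucc_zero, Fin.snoc_castSucc]
      rw [e0]
      simp only [Fin.snoc_castSucc, Fin.snoc_last, Fin.succ_last, ← Fin.castSucc_succ, Fin.val_castSucc, Fin.val_last]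
      ring
    rw [Finset.sum_congr rfl h2, Finset.sum_sigma']
    refine Finset.sum_bij' (fun p _ => Fin.snoc p.1 p.2) (fun c _ => ⟨Fin.init c, c (Fin.last _)⟩) ?_ ?_ ?_ ?_ ?_
    · rintro ⟨c, S⟩ h
      simp only [mem_sigma, Fintype.mem_piFinset] at h ⊢
      intro i
      refine Fin.lastCases ?_ (fun i => ?_) i
      · simpa using h.2
      · simpa using h.1 i
    · intro c h
      simp only [mem_sigma, Fintype.mem_piFinset] at h ⊢
      exact ⟨fun i => h _, h _⟩
    · rintro ⟨c, S⟩ h; simp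
    · intro c h; simp
    · intro p h; rfl

open Polynomial in
theorem chain_count {α : Type*} (U : Finset St) (w : ℕ → St → St → Polynomial ℤ) (ini : St) (N : ℕ) (f : St → Polynomial ℤ)
    (e : α → (Fin (N+1) → St)) (stat : α → ℕ) (hi : Function.Injective e) (hU : ∀ a i, e a i ∈ U)
    (hW : ∀ a, chW w ini f (e a) = X ^ stat a) (hs : ∀ c : Fin (N+1) → St, (∀ i, c i ∈ U) → chW w ini f c ≠ 0 → ∃ a, e a = c) (s : ℕ) :
    (Nat.card {a // stat a = s} : ℤ) = (∑ S ∈ U, f S * Wt U w ini N S).coeff s := by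
  classical
  rw [Wt_chain, finsetSum_coeff]
  have h1 : ∀ c ∈ Fintype.piFinset (fun _ : Fin (N+1) => U), (chW w ini f c).coeff s = if (∃ a, e a = c ∧ stat a = s) then 1 else 0 := by
    intro c hc
    by_cases h0 : chW w ini f c = 0
    · rw [h0, if_neg]
      · simp
      · rintro ⟨a, rfl, _⟩
        rw [hW] at h0
        exact pow_ne_zero _ X_ne_zero h0
    · obtain ⟨a, rfl⟩ := hs c (Fintype.mem_piFinset.mp hc) h0
      rw [hW, coeff_X_pow]
      congr 1
      refine propext ⟨fun h => ⟨a, rfl, h.symm⟩, ?_⟩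
      rintro ⟨a', h, rfl⟩
      rw [hi h]
  rw [Finset.sum_congr rfl h1, ← Finset.sum_filter, Finset.sum_const, nsmul_eq_mul, mul_one]
  norm_cast
  rw [← Nat.card_eq_finsetCard]
  refine Nat.card_eq_of_bijective (fun a => ⟨e a.1, ?_⟩) ⟨?_, ?_⟩
  · simp only [mem_filter, Fintype.mem_piFinset]
    exact ⟨hU _, a.1, rfl, a.2⟩
  · intro a b h
    exact Subtype.ext (hi (Subtype.mk.inj h))
  · rintro ⟨c, hc⟩
    simp only [mem_filter] at hc
    obtain ⟨_, a, rfl, h⟩ := hc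
    exact ⟨⟨a, h⟩, rfl⟩
end Chains


section Magog

theorem strictAnti_gap {n : ℕ} (e : Fin n → ℕ) (he : ∀ p q, p < q → e q < e p) (p q : Fin n) (h : p ≤ q) :
    e q + q.val ≤ e p + p.val := by
  have : ∀ d : ℕ, ∀ q : Fin n, q.val = p.val + d → e q + d ≤ e p := by
    intro d
    induction d with
    | zero =>
      intro q hq
      have : q = p := Fin.ext (by omega)
      subst this; omega
    | succ d ih =>
      intro q hq
      have h1 := ih ⟨p.val + d, by omega⟩ rfl
      have h2 := he ⟨p.val + d, by omega⟩ q (Fin.lt_def.mpr (by simp; omega))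
      omega
  have h' : p.val ≤ q.val := h
  have := this (q.val - p.val) q (by omega)
  omega

/-- admissible growth step -/
def GS (M i : ℕ) (B' B : Fin M → ℕ) : Prop :=
  Antitone B' ∧ Antitone B ∧ (∀ p : Fin M, i ≤ p.val + 1 → B' p = 0) ∧ (∀ p : Fin M, i ≤ p.val → B p = 0) ∧
    ∀ p, B' p ≤ B p ∧ B p ≤ B' p + 1

variable {R : Type*} [CommRing R]

open Classical in
/-- growth weight -/
noncomputable def mw (M : ℕ) (t : R) (i : ℕ) (B' B : Fin M → ℕ) : R :=
  if GS M i B' B then (if i = M then t else 1) ^ (univ.filter fun p => B' p = B p).card else 0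

/-- box bounded states -/
def mU (M k : ℕ) : Finset (Fin M → ℕ) := Fintype.piFinset fun _ => range (k+1)

theorem Wt_magog [IsDomain R] [CharZero R] (M k : ℕ) (t : R) (i : ℕ) (hi : i ≤ M) (B : Fin M → ℕ) (hB : B ∈ mU M k)
    (ha : Antitone B) (hz : ∀ p : Fin M, i ≤ p.val → B p = 0) :
    Wt (mU M k) (mw M t) 0 i B = co (fun p : Fin i => B ⟨p, p.2.trans_le hi⟩ + (i - 1 - p.val))
      ((∏ p, (MvPolynomial.C (if i = M then t else 1) + MvPolynomial.X p)) * pairProd uk MvPolynomial.X) := by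
  classical
  induction i generalizing B with
  | zero =>
    have : B = 0 := funext fun p => hz p (Nat.zero_le _)
    rw [Wt, if_pos this]
    have h0 : (Finsupp.equivFunOnFinite.symm (fun p : Fin 0 => B ⟨p, p.2.trans_le hi⟩ + (0 - 1 - p.val))) = 0 := by
      ext p; exact p.elim0
    simp only [pairProd, co, univ_eq_empty, prod_empty, mul_one, MvPolynomial.lcoeff_apply, h0]
    simp
  | succ i ih =>
    have he : StrictAnti (fun p : Fin (i+1) => B ⟨p, p.2.trans_le hi⟩ + (i + 1 - 1 - p.val)) := by
      intro p q hpq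
      have h1 : B ⟨q, q.2.trans_le hi⟩ ≤ B ⟨p, p.2.trans_le hi⟩ := ha (Fin.le_def.mpr (le_of_lt hpq))
      have h2 : p.val < q.val := hpq
      have := q.2
      simp only
      omega
    rw [co_step _ _ he, Wt]
    rw [← Finset.sum_filter_add_sum_filter_not (mU M k) (fun B' => GS M (i+1) B' B)]
    rw [Finset.sum_eq_zero (s := (mU M k).filter fun B' => ¬ GS M (i+1) B' B), add_zero]
    swap
    · intro B' h
      rw [mem_filter] at h
      rw [mw, if_neg h.2, zero_mul]
    refine Finset.sum_bij' (fun B' _ => fun p : Fin (i+1) => B' ⟨p, p.2.trans_le hi⟩ + (i - p.val))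
      (fun e' _ => fun p : Fin M => if h : p.val < i+1 then e' ⟨p, h⟩ - (i - p.val) else 0) ?_ ?_ ?_ ?_ ?_
    · intro B' h
      rw [mem_filter] at h ⊢
      obtain ⟨hU, g1, g2, g3, g4, g5⟩ := h
      refine ⟨?_, ?_, ?_⟩
      · rw [Fintype.mem_piFinset]
        intro p
        have := g5 ⟨p, p.2.trans_le hi⟩
        rw [mem_Icc]; omega
      · intro p q hpq
        have h1 : B' ⟨q, q.2.trans_le hi⟩ ≤ B' ⟨p, p.2.trans_le hi⟩ := g1 (Fin.le_def.mpr (le_of_lt hpq))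
        have h2 : p.val < q.val := hpq
        have := q.2
        simp only
        omega
      · have := g3 ⟨i, by omega⟩ (le_refl _)
        simp [this]
    · intro e' h
      rw [mem_filter, Fintype.mem_piFinset] at h
      obtain ⟨h1, h2, h3⟩ := h
      have gap := strictAnti_gap e' h2
      have hb : ∀ p : Fin (i+1), e' p ≤ B ⟨p, p.2.trans_le hi⟩ + (i - p.val) ∧ B ⟨p, p.2.trans_le hi⟩ + (i - p.val) ≤ e' p + 1 ∧ i - p.val ≤ e' p := by
        intro p
        have a1 := h1 p
        rw [mem_Icc] at a1
        have a2 := gap p (Fin.last i) (Fin.le_last p)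
        rw [h3] at a2
        simp only [Fin.val_last] at a2
        omega
      have hBU : ∀ p, B p ≤ k := fun p => by
        have := Fintype.mem_piFinset.mp hB p
        rw [mem_range] at this; omega
      rw [mem_filter]
      refine ⟨?_, ?_, ha, ?_, hz, ?_⟩
      · rw [mU, Fintype.mem_piFinset]
        intro p
        rw [mem_range]
        split_ifs with hp
        · have := hb ⟨p, hp⟩
          have := hBU p
          simp only [Fin.eta] at *
          omega
        · omega
      · intro p q hpq
        have hpq' : p.val ≤ q.val := hpq
        simp only
        split_ifs with hp hq
        · have a1 := gap ⟨p, by omega⟩ ⟨q, by omega⟩ hpq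
          have a2 := hb ⟨p, by omega⟩
          have a3 := hb ⟨q, by omega⟩
          simp only at *
          omega
        · omega
        · omega
        · omega
      · intro p hp
        simp only
        split_ifs with hq
        · have : (⟨p.val, hq⟩ : Fin (i+1)) = Fin.last i := Fin.ext (by simp; omega)
          rw [this, h3]; simp
        · rfl
      · intro p
        simp only
        split_ifs with hp
        · have a2 := hb ⟨p, by omega⟩
          simp only [Fin.eta] at *
          omega
        · have := hz p (by omega)
          omega
    · intro B' h
      rw [mem_filter] at h
      obtain ⟨hU, g1, g2, g3, g4, g5⟩ := h
      funext p
      simp only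
      split_ifs with hp
      · simp only [Fin.eta]; omega
      · exact (g3 p (by omega)).symm
    · intro e' h
      rw [mem_filter, Fintype.mem_piFinset] at h
      obtain ⟨h1, h2, h3⟩ := h
      have gap := strictAnti_gap e' h2
      funext p
      have a2 := gap p (Fin.last i) (Fin.le_last p)
      rw [h3] at a2
      simp only [Fin.val_last] at a2
      simp only [p.2, dite_true, Fin.eta]
      omega
    · intro B' h
      rw [mem_filter] at h
      obtain ⟨hU, hg⟩ := h
      obtain ⟨g1, g2, g3, g4, g5⟩ := id hg
      rw [mw, if_pos hg, ih (by omega) B' hU g1 (fun p hp => g3 p (by omega)), if_neg (by omega : ¬ i = M)]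
      congr 1
      · by_cases hM : i + 1 = M
        · subst hM
          rw [if_pos rfl]
          congr 2
          ext p
          simp only [mem_filter, mem_univ, true_and]
          have : (⟨p.val, p.2⟩ : Fin (i+1)) = p := rfl
          simp only [Fin.eta]; omega
        · rw [if_neg hM, one_pow, one_pow]
      · refine congrFun (congrArg _ ?_) _
        refine congrArg _ (funext fun p => ?_)
        have := p.2
        simp only [Fin.val_castSucc]
        omega

open Classical in
theorem magog_Lam [IsDomain R] [CharZero R] (M k : ℕ) (hk : 1 ≤ k) (t : R) :
    ∑ B ∈ mU M k, (if Antitone B then 1 else 0) * Wt (mU M k) (mw M t) 0 M B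
     = Lam (M + k - 1) ((∏ p, (MvPolynomial.C t + MvPolynomial.X p)) * pairProd uk (MvPolynomial.X : Fin M → _)) := by
  simp only [ite_mul, one_mul, zero_mul]
  rw [← Finset.sum_filter, Lam]
  refine Finset.sum_bij' (fun B _ => fun p : Fin M => k + p.val - B p) (fun b _ => fun p : Fin M => k + p.val - b p) ?_ ?_ ?_ ?_ ?_
  · intro B h
    rw [mem_filter, mU, Fintype.mem_piFinset] at h
    rw [mem_smF]
    refine ⟨fun p => ?_, fun p q hpq => ?_⟩
    · have := p.2; omega
    · have h1 : B q ≤ B p := h.2 hpq.le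
      have h2 : p.val < q.val := hpq
      have := mem_range.mp (h.1 p)
      simp only
      omega
  · intro b h
    rw [mem_smF] at h
    have gap := strictAnti_gap (fun p => M + k - 1 - b p) (fun p q hpq => by have := h.2 hpq; have := h.1 q; omega)
    rw [mem_filter, mU, Fintype.mem_piFinset]
    have key : ∀ p : Fin M, p.val ≤ b p := fun p => by
      have := gap ⟨0, by have := p.2; omega⟩ p (Fin.le_def.mpr (by simp))
      simp only at this
      have := h.1 p
      omega
    refine ⟨fun p => ?_, fun p q hpq => ?_⟩
    · have := key p
      rw [mem_range]; omega
    · have := gap p q hpq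
      have h2 : p.val ≤ q.val := hpq
      have := h.1 p
      have := h.1 q
      simp only at *
      omega
  · intro B h
    rw [mem_filter, mU, Fintype.mem_piFinset] at h
    funext p
    have := mem_range.mp (h.1 p)
    simp only
    omega
  · intro b h
    rw [mem_smF] at h
    have gap := strictAnti_gap (fun p => M + k - 1 - b p) (fun p q hpq => by have := h.2 hpq; have := h.1 q; omega)
    funext p
    have := gap p ⟨M - 1, by have := p.2; omega⟩ (Fin.le_def.mpr (by have := p.2; simp; omega))
    have := h.1 p
    have := h.1 ⟨M - 1, by have := p.2; omega⟩
    have := p.2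
    simp only at *
    omega
  · intro B h
    rw [mem_filter] at h
    rw [Wt_magog M k t M le_rfl B h.1 h.2 (fun p hp => absurd p.2 (by omega)), if_pos rfl]
    refine congrFun (congrArg _ ?_) _
    refine congrArg _ (funext fun p => ?_)
    have := mem_range.mp (Fintype.mem_piFinset.mp h.1 p)
    have := p.2
    change B p + (M - 1 - p.val) = M + k - 1 - (k + p.val - B p)
    omega
end Magog


section MagogEnc

theorem init_card (k : ℕ) (P : ℕ → Prop) [DecidablePred P] (hP : ∀ x, 1 ≤ x → P (x+1) → P x) (x : ℕ) (h1 : 1 ≤ x) (h2 : x ≤ k) :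
    x ≤ ((Icc 1 k).filter P).card ↔ P x := by
  have hd : ∀ d y, 1 ≤ y → P (y + d) → P y := by
    intro d
    induction d with
    | zero => intro y _ h; exact h
    | succ d ih => intro y hy h; exact ih y hy (hP _ (by omega) h)
  constructor
  · intro h
    by_contra hx
    have : (Icc 1 k).filter P ⊆ Icc 1 (x-1) := by
      intro y hy
      rw [mem_filter, mem_Icc] at hy
      rw [mem_Icc]
      refine ⟨hy.1.1, ?_⟩
      by_contra hc
      refine hx (hd (y - x) x h1 ?_)
      rw [show x + (y - x) = y by omega]; exact hy.2
    have := card_le_card this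
    rw [Nat.card_Icc] at this
    omega
  · intro h
    have : Icc 1 x ⊆ (Icc 1 k).filter P := by
      intro y hy
      rw [mem_Icc] at hy
      rw [mem_filter, mem_Icc]
      refine ⟨by omega, hd (x - y) y hy.1 ?_⟩
      rw [show y + (x - y) = x by omega]; exact h
    have := card_le_card this
    rw [Nat.card_Icc] at this
    omega

theorem init_card_fin {M : ℕ} (Q : Fin M → Prop) [DecidablePred Q] (hQ : ∀ p q, p ≤ q → Q q → Q p) (p : Fin M) :
    p.val + 1 ≤ (univ.filter Q).card ↔ Q p := by
  constructor
  · intro h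
    by_contra hx
    have : univ.filter Q ⊆ Iio p := by
      intro y hy
      rw [mem_filter] at hy
      rw [mem_Iio]
      by_contra hc
      exact hx (hQ _ _ (not_lt.mp hc) hy.2)
    have := card_le_card this
    rw [Fin.card_Iio] at this
    omega
  · intro h
    have : Iic p ⊆ univ.filter Q := by
      intro y hy
      rw [mem_Iic] at hy
      rw [mem_filter]
      exact ⟨mem_univ _, hQ _ _ hy h⟩
    have := card_le_card this
    rw [Fin.card_Iic] at this
    omega

theorem card_Icc_filter_le (k b : ℕ) (h : b ≤ k) : ((Icc 1 k).filter fun x => x ≤ b).card = b := by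
  have : (Icc 1 k).filter (fun x => x ≤ b) = Icc 1 b := by
    ext x; simp only [mem_filter, mem_Icc]; omega
  rw [this, Nat.card_Icc]; omega

theorem card_fin_filter_lt (M b : ℕ) (h : b ≤ M) : (univ.filter fun p : Fin M => p.val < b).card = b := by
  rcases Nat.eq_or_lt_of_le h with rfl | h
  · rw [filter_true_of_mem (fun p _ => p.2)]; simp
  · have : (univ.filter fun p : Fin M => p.val < b) = Iio (⟨b, h⟩ : Fin M) := by
      ext p; simp [Fin.lt_def]
    rw [this, Fin.card_Iio]

variable {m k : ℕ}

/-- column counts -/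
def mB (a : MagogPentagon 0 (m+2) k (2*(m+2)-1)) (i : ℕ) (c : Fin (m+1)) : ℕ :=
  ((Icc 1 k).filter fun x => c.val + 2 ≤ a.entry (i+1) x).card

theorem mE_anti (a : MagogPentagon 0 (m+2) k (2*(m+2)-1)) (j x : ℕ) (hx : 1 ≤ x) : a.entry j (x+1) ≤ a.entry j x := by
  by_cases h : x + 1 ≤ k ∧ x + 1 ≤ j ∧ j ≤ m+2
  · obtain ⟨j, rfl⟩ : ∃ j', j = j' + 1 := ⟨j - 1, by omega⟩
    have h1 := a.colDec x j hx h.1 (by omega) h.2.2 (by omega)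
    have h2 := a.rowInc x j hx (by omega) (by omega) h.2.2 (by omega)
    omega
  · rw [a.outside (x+1) j (by omega)]; omega

theorem mE_bound (a : MagogPentagon 0 (m+2) k (2*(m+2)-1)) (x : ℕ) : ∀ j, a.entry j (x+1) ≤ j - x := by
  induction x with
  | zero =>
    intro j
    by_cases h : 1 ≤ j ∧ j ≤ m+2
    · have := a.bound j h.1 h.2; simp only [Nat.zero_add]; omega
    · rw [a.outside _ _ (by omega)]; omega
  | succ x ih =>
    intro j
    by_cases h : x + 1 + 1 ≤ k ∧ x + 1 + 1 ≤ j ∧ j ≤ m+2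
    · obtain ⟨j, rfl⟩ : ∃ j', j = j' + 1 := ⟨j - 1, by omega⟩
      have h1 := a.colDec (x+1) j (by omega) h.1 (by omega) h.2.2 (by omega)
      have := ih j
      omega
    · rw [a.outside _ _ (by omega)]; omega

theorem mB_gal (a : MagogPentagon 0 (m+2) k (2*(m+2)-1)) (i : ℕ) (c : Fin (m+1)) (x : ℕ) (h1 : 1 ≤ x) (h2 : x ≤ k) :
    x ≤ mB a i c ↔ c.val + 2 ≤ a.entry (i+1) x :=
  init_card k _ (fun x hx h => le_trans h (mE_anti a _ x hx)) x h1 h2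

theorem mB_le (a : MagogPentagon 0 (m+2) k (2*(m+2)-1)) (i : ℕ) (c : Fin (m+1)) : mB a i c ≤ k := by
  refine le_trans (card_filter_le _ _) (by simp)

theorem mB_GS (a : MagogPentagon 0 (m+2) k (2*(m+2)-1)) (i : ℕ) (hi : i < m+1) : GS (m+1) (i+1) (mB a i) (mB a (i+1)) := by
  have anti : ∀ i, Antitone (mB a i) := by
    intro i p q hpq
    refine card_le_card fun x hx => ?_
    have : p.val ≤ q.val := hpq
    rw [mem_filter] at hx ⊢
    exact ⟨hx.1, by omega⟩
  have zero : ∀ i (p : Fin (m+1)), i ≤ p.val → mB a i p = 0 := by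
    intro i p hp
    rw [mB, card_eq_zero, filter_eq_empty_iff]
    intro x hx
    rw [mem_Icc] at hx
    have := mE_bound a (x-1) (i+1)
    rw [show x - 1 + 1 = x by omega] at this
    omega
  refine ⟨anti _, anti _, fun p hp => zero _ _ (by omega), fun p hp => zero _ _ hp, fun p => ⟨?_, ?_⟩⟩
  · refine card_le_card fun x hx => ?_
    rw [mem_filter, mem_Icc] at hx ⊢
    refine ⟨hx.1, ?_⟩
    by_cases h : x ≤ i + 1
    · have := a.rowInc x (i+1) hx.1.1 hx.1.2 h (by omega) (by omega)
      omega
    · rw [a.outside x (i+1) (by omega)] at hx; omega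
  · by_contra hc
    push Not at hc
    have hk := mB_le a (i+1) p
    set y := mB a i p + 1 with hy
    have h1 := (mB_gal a (i+1) p (y+1) (by omega) (by omega)).mp (by omega)
    have h2 : y ≤ mB a i p := by
      rw [mB_gal a i p y (by omega) (by omega)]
      by_cases h : y ≤ i + 1
      · have := a.colDec y (i+1) (by omega) (by omega) (by omega) (by omega) (by omega)
        omega
      · rw [a.outside (y+1) (i+1+1) (by omega)] at h1; omega
    omega

theorem mE_eq (a : MagogPentagon 0 (m+2) k (2*(m+2)-1)) (i x : ℕ) (h1 : 1 ≤ x) (h2 : x ≤ k) (h3 : x ≤ i + 1) (h4 : i ≤ m+1) :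
    a.entry (i+1) x = 1 + (univ.filter fun p : Fin (m+1) => x ≤ mB a i p).card := by
  have hp := a.pos x (i+1) h1 h2 h3 (by omega) (by omega)
  have hb := mE_bound a (x-1) (i+1)
  rw [show x - 1 + 1 = x by omega] at hb
  have : (univ.filter fun p : Fin (m+1) => x ≤ mB a i p) = univ.filter fun p : Fin (m+1) => p.val < a.entry (i+1) x - 1 := by
    refine filter_congr fun p _ => ?_
    rw [mB_gal a i p x h1 h2]; omega
  rw [this, card_fin_filter_lt _ _ (by omega)]
  omega

/-- chain of a trapezoid -/
def mEnc (a : MagogPentagon 0 (m+2) k (2*(m+2)-1)) : Fin (m+1+1) → Fin (m+1) → ℕ := fun i => mB a i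

theorem mEnc_inj : Function.Injective (mEnc (m := m) (k := k)) := by
  intro a b h
  have hB : ∀ i ≤ m+1, mB a i = mB b i := fun i hi => congrFun h ⟨i, by omega⟩
  have he : a.entry = b.entry := by
    funext j x
    by_cases hc : 1 ≤ x ∧ x ≤ k ∧ x ≤ j ∧ j ≤ m+2
    · obtain ⟨j, rfl⟩ : ∃ j', j = j' + 1 := ⟨j - 1, by omega⟩
      rw [mE_eq a j x hc.1 hc.2.1 hc.2.2.1 (by omega), mE_eq b j x hc.1 hc.2.1 hc.2.2.1 (by omega), hB j (by omega)]
    · rw [a.outside _ _ hc, b.outside _ _ hc]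
  cases a; cases b; cases he; rfl

theorem mEnc_surj (c : Fin (m+1+1) → Fin (m+1) → ℕ) (hU : ∀ i, c i ∈ mU (m+1) k) (h0 : c 0 = 0)
    (hG : ∀ j : Fin (m+1), GS (m+1) (j.val+1) (c j.castSucc) (c j.succ)) : ∃ a : MagogPentagon 0 (m+2) k (2*(m+2)-1), mEnc a = c := by
  obtain ⟨B, hB⟩ : ∃ B : ℕ → Fin (m+1) → ℕ, ∀ i : Fin (m+1+1), B i = c i :=
    ⟨fun i => if h : i < m+1+1 then c ⟨i, h⟩ else 0, fun i => dif_pos i.2⟩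
  have g : ∀ i < m+1, GS (m+1) (i+1) (B i) (B (i+1)) := by
    intro i hi
    have := hG ⟨i, hi⟩
    rw [← hB, ← hB] at this
    exact this
  have b0 : B 0 = 0 := by rw [← h0]; exact hB 0
  have bk : ∀ i ≤ m+1, ∀ p, B i p ≤ k := by
    intro i hi p
    have := Fintype.mem_piFinset.mp (hU ⟨i, by omega⟩) p
    rw [← hB, mem_range] at this
    simp only at this; omega
  have anti : ∀ i ≤ m+1, Antitone (B i) := by
    intro i hi
    rcases i with _ | i
    · rw [b0]; exact fun _ _ _ => le_rfl
    · exact (g i (by omega)).2.1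
  have zero : ∀ i ≤ m+1, ∀ p : Fin (m+1), i ≤ p.val → B i p = 0 := by
    intro i hi p hp
    rcases i with _ | i
    · rw [b0]; rfl
    · exact (g i (by omega)).2.2.2.1 p hp
  have bi : ∀ i ≤ m+1, ∀ p, B i p ≤ i := by
    intro i
    induction i with
    | zero => intro _ p; rw [b0]; exact le_rfl
    | succ i ih =>
      intro hi p
      have h1 := ih (by omega) p
      have h2 := (g i (by omega)).2.2.2.2 p
      omega
  let E : ℕ → ℕ → ℕ := fun j x => if 1 ≤ x ∧ x ≤ k ∧ x ≤ j ∧ j ≤ m+2 then 1 + (univ.filter fun p : Fin (m+1) => x ≤ B (j-1) p).card else 0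
  have hE : ∀ j x, 1 ≤ x ∧ x ≤ k ∧ x ≤ j ∧ j ≤ m+2 → E j x = 1 + (univ.filter fun p : Fin (m+1) => x ≤ B (j-1) p).card :=
    fun j x h => if_pos h
  refine ⟨⟨E, ?_, ?_, ?_, ?_, ?_, ?_⟩, ?_⟩
  · intro i j h1 h2 h3 h4 _
    rw [hE _ _ ⟨h1, h2, h3, h4⟩]; omega
  · intro i j h1 h2 h3 h4 _
    rw [hE _ _ ⟨h1, h2, h3, by omega⟩, hE _ _ ⟨h1, h2, by omega, by omega⟩]
    refine Nat.add_le_add_left (card_le_card fun p hp => ?_) 1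
    rw [mem_filter] at hp ⊢
    have := ((g (j-1) (by omega)).2.2.2.2 p).1
    rw [show j - 1 + 1 = j by omega] at this
    rw [Nat.add_sub_cancel]
    exact ⟨hp.1, by omega⟩
  · intro i j h1 h2 h3 h4 _
    rw [hE _ _ ⟨by omega, h2, by omega, by omega⟩, hE _ _ ⟨h1, by omega, by omega, by omega⟩]
    refine Nat.add_le_add_left (card_le_card fun p hp => ?_) 1
    rw [mem_filter] at hp ⊢
    have := ((g (j-1) (by omega)).2.2.2.2 p).2
    rw [show j - 1 + 1 = j by omega] at this
    rw [Nat.add_sub_cancel] at hp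
    exact ⟨hp.1, by omega⟩
  · intro j h1 h2
    by_cases hk : 1 ≤ k
    · rw [hE _ _ ⟨le_rfl, hk, h1, h2⟩]
      have : (univ.filter fun p : Fin (m+1) => 1 ≤ B (j-1) p) ⊆ univ.filter fun p : Fin (m+1) => p.val < j-1 := by
        intro p hp
        rw [mem_filter] at hp ⊢
        refine ⟨hp.1, ?_⟩
        by_contra hc
        have := zero (j-1) (by omega) p (by omega)
        omega
      have := card_le_card this
      rw [card_fin_filter_lt _ _ (by omega)] at this
      omega
    · have : E j 1 = 0 := if_neg (by omega)
      omega
  · intro i j _ _ _ _ h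
    omega
  · intro i j h
    exact if_neg h
  · funext i p
    have hi := i.2
    rw [mEnc, ← hB, mB]
    have : (Icc 1 k).filter (fun x => p.val + 2 ≤ E (i.val+1) x) = (Icc 1 k).filter (fun x => x ≤ B i.val p) := by
      refine filter_congr fun x hx => ?_
      rw [mem_Icc] at hx
      by_cases h : x ≤ i.val + 1
      · rw [hE _ _ ⟨hx.1, hx.2, h, by omega⟩, Nat.add_sub_cancel]
        rw [← init_card_fin (fun p => x ≤ B i.val p) (fun p q hpq h => le_trans h (anti i.val (by omega) hpq)) p]
        omega
      · have h1 : E (i.val+1) x = 0 := if_neg (by omega)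
        have := bi i.val (by omega) p
        omega
    change ((Icc 1 k).filter (fun x => p.val + 2 ≤ E (i.val+1) x)).card = _
    rw [this, card_Icc_filter_le _ _ (bk _ (by omega) _)]

/-- the shifted statistic -/
def mStat (a : MagogPentagon 0 (m+2) k (2*(m+2)-1)) : ℕ := (univ.filter fun p : Fin (m+1) => mB a m p = mB a (m+1) p).card

theorem sum_card_swap (b : Fin (m+1) → ℕ) (hb : ∀ p, b p ≤ k) :
    ∑ x ∈ Icc 1 k, (univ.filter fun p : Fin (m+1) => x ≤ b p).card = ∑ p, b p := by
  simp only [card_filter]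
  rw [sum_comm]
  refine sum_congr rfl fun p _ => ?_
  rw [← card_filter, card_Icc_filter_le _ _ (hb p)]

theorem tau_eq (hk : k ≤ m+1) (a : MagogPentagon 0 (m+2) k (2*(m+2)-1)) : a.tau = (mStat a : ℤ) + 1 := by
  have h1 : ∑ x ∈ Icc 1 k, ((a.entry (m+2-1) x : ℤ) - (a.entry (m+2) x : ℤ)) = ∑ p, ((mB a m p : ℤ) - mB a (m+1) p) := by
    rw [sum_sub_distrib, sum_sub_distrib, ← Nat.cast_sum, ← Nat.cast_sum, ← Nat.cast_sum, ← Nat.cast_sum, ← sum_card_swap _ (mB_le a m), ← sum_card_swap _ (mB_le a (m+1))]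
    rw [sum_congr rfl (g := fun x => 1 + (univ.filter fun p : Fin (m+1) => x ≤ mB a m p).card), sum_congr (s₁ := Icc 1 k) (f := fun x => a.entry (m+2) x) rfl (g := fun x => 1 + (univ.filter fun p : Fin (m+1) => x ≤ mB a (m+1) p).card)]
    · rw [sum_add_distrib, sum_add_distrib]; push_cast; ring
    · intro x hx
      rw [mem_Icc] at hx
      exact mE_eq a (m+1) x hx.1 hx.2 (by omega) (by omega)
    · intro x hx
      rw [mem_Icc] at hx
      exact mE_eq a m x hx.1 hx.2 (by omega) (by omega)
  have h2 : ∑ p, ((mB a m p : ℤ) - mB a (m+1) p) = ∑ p : Fin (m+1), ((if mB a m p = mB a (m+1) p then 1 else 0) - 1) := by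
    refine sum_congr rfl fun p _ => ?_
    have := (mB_GS a m (by omega)).2.2.2.2 p
    split_ifs <;> omega
  rw [MagogPentagon.tau, h1, h2, sum_sub_distrib, mStat, card_filter]
  simp
  ring

open Polynomial in
theorem magog_count (hk1 : 1 ≤ k) (hk : k ≤ m+1) (s : ℕ) :
    (Nat.card {T : MagogPentagon 0 (m+2) k (2*(m+2)-1) // T.tau = ((s+1 : ℕ) : ℤ)} : ℤ) =
    (Lam (m + k) ((∏ p, (MvPolynomial.C (X : Polynomial ℤ) + MvPolynomial.X p)) * pairProd uk (MvPolynomial.X : Fin (m+1) → _))).coeff s := by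
  classical
  have h := magog_Lam (m+1) k hk1 (X : Polynomial ℤ)
  rw [show m + 1 + k - 1 = m + k by omega] at h
  rw [← h]
  have e : {T : MagogPentagon 0 (m+2) k (2*(m+2)-1) // T.tau = ((s+1 : ℕ) : ℤ)} ≃ {T : MagogPentagon 0 (m+2) k (2*(m+2)-1) // mStat T = s} :=
    Equiv.subtypeEquivRight fun T => by rw [tau_eq hk]; push_cast; omega
  rw [Nat.card_congr e]
  refine chain_count _ _ _ _ _ mEnc mStat mEnc_inj ?_ ?_ ?_ s
  · intro a i
    rw [mU, Fintype.mem_piFinset]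
    intro p
    rw [mem_range]
    exact Nat.lt_succ_of_le (mB_le a i p)
  · intro a
    rw [chW, if_pos, one_mul, if_pos, mul_one, Fin.prod_univ_castSucc, Finset.prod_eq_one, one_mul]
    · have := mB_GS a m (by omega)
      rw [mw, if_pos]
      · rw [if_pos (by simp)]; rfl
      · exact this
    · intro j _
      have := mB_GS a j.val (by omega)
      rw [mw, if_pos]
      · rw [if_neg (by have := j.2; simp; omega), one_pow]
      · exact this
    · exact (mB_GS a m (by omega)).2.1
    · funext p
      exact (mB_GS a 0 (by omega)).2.2.1 p (by omega)
  · intro c hc hne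
    refine mEnc_surj c hc ?_ ?_
    · by_contra h0
      rw [chW, if_neg h0] at hne; simp at hne
    · intro j
      by_contra h0
      apply hne
      rw [chW, Finset.prod_eq_zero (mem_univ j), mul_zero, zero_mul]
      rw [mw, if_neg h0]
end MagogEnc


section ASTLam
variable {R : Type*} [CommRing R]

theorem slist_emb (S : Finset ℕ) (c N : ℕ) (hS : S ⊆ Icc 1 c) (hc : S.card = N) :
    ∃ h : (slist S c).length = N, ∀ i : Fin N, (slist S c)[i.val]'(by rw [h]; exact i.2) = S.orderEmbOfFin hc i := by
  have hp : (slist S c).Pairwise (· < ·) := List.Pairwise.filter _ List.pairwise_lt_range'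
  have hm : ∀ x, x ∈ slist S c ↔ x ∈ S := by
    intro x
    simp only [slist, List.mem_filter, List.mem_range'_1, decide_eq_true_eq]
    constructor
    · exact fun h => h.2
    · intro h; have := mem_Icc.mp (hS h); exact ⟨by omega, h⟩
  have hlen : (slist S c).length = N := by
    rw [← hc, ← List.toFinset_card_of_nodup (hp.imp (fun h => ne_of_lt h))]
    congr 1; ext x; simp [hm]
  refine ⟨hlen, fun i => ?_⟩
  refine congrFun (Finset.orderEmbOfFin_unique hc (f := fun i : Fin N => (slist S c)[i.val]'(by rw [hlen]; exact i.2)) (fun x => ?_) ?_) i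
  · rw [← hm]; exact List.getElem_mem _
  · intro i j hij
    exact List.pairwise_iff_getElem.mp hp _ _ _ _ hij

theorem WW_TT [IsDomain R] [CharZero R] (m : ℕ) (t : R) (S : Finset ℕ) (hS : S ⊆ Icc 1 (2*m+3)) (hc : S.card = m+1)
    (hn : m+2 ∉ S) : WW (m+2) t (m+1) S = co (fun i => lab (m+1) (S.orderEmbOfFin hc i)) ((∏ p, (MvPolynomial.C t + MvPolynomial.X p)) * pairProd kk MvPolynomial.X) := by
  obtain ⟨hl, he⟩ := slist_emb S _ _ hS hc
  rw [WW_final m t S hS hc hn, TP_eq _ (m+1) (by rw [List.length_map, hl]) (fun i => lab (m+1) (S.orderEmbOfFin hc i)) (fun _ => Polynomial.C t + Polynomial.X), TT, mul_comm]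
  · refine congrArg _ ?_
    refine congrArg (· * _) (prod_congr rfl fun p _ => ?_)
    simp [MvPolynomial.algebraMap_eq]
  · intro i
    rw [List.getD_eq_getElem _ _ (by rw [List.length_map, hl]; exact i.2), List.getElem_map, he i]

open Classical in
/-- final state condition -/
noncomputable def aF (R : Type*) [CommRing R] (m r : ℕ) (S : Finset ℕ) : R :=
  if S.card = m+1 ∧ m+2 ∉ S ∧ ∀ s ∈ S, lab (m+1) s ≤ r then 1 else 0

/-- inverse of the column label -/
def unlab (m v : ℕ) : ℕ := if m + 1 ≤ v then 2*m+2-v else 2*m+3-v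

theorem ast_Lam [IsDomain R] [CharZero R] (m r : ℕ) (hr : r ≤ 2*m+1) (t : R) :
    ∑ S ∈ (Icc 1 (2*m+3)).powerset, aF R m r S * WW (m+2) t (m+1) S =
     Lam r ((∏ p, (MvPolynomial.C t + MvPolynomial.X p)) * pairProd kk (MvPolynomial.X : Fin (m+1) → _)) := by
  classical
  simp only [aF, ite_mul, one_mul, zero_mul]
  rw [← Finset.sum_filter, Lam]
  have hcard : ∀ S ∈ (Icc 1 (2*m+3)).powerset.filter (fun S => S.card = m+1 ∧ m+2 ∉ S ∧ ∀ s ∈ S, lab (m+1) s ≤ r), S.card = m+1 :=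
    fun S h => (mem_filter.mp h).2.1
  have hsm : ∀ b ∈ smF (m+1) r 0, StrictMono (fun i => unlab m (r - b i)) := by
    intro b hb i j hij
    rw [mem_smF] at hb
    have h1 := hb.2 hij
    have h2 := hb.1 i
    have h3 := hb.1 j
    simp only [unlab]
    split_ifs <;> omega
  have hcb : ∀ b ∈ smF (m+1) r 0, (univ.image (fun i => unlab m (r - b i))).card = m+1 := by
    intro b hb
    rw [card_image_of_injective _ (hsm b hb).injective]; simp
  refine Finset.sum_bij' (fun S h => fun i => r - lab (m+1) (S.orderEmbOfFin (hcard S h) i)) (fun b _ => univ.image (fun i => unlab m (r - b i))) ?_ ?_ ?_ ?_ ?_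
  · intro S h
    have hc := hcard S h
    rw [mem_filter, mem_powerset] at h
    rw [mem_smF]
    refine ⟨fun i => by omega, fun i j hij => ?_⟩
    have h1 : S.orderEmbOfFin hc i < S.orderEmbOfFin hc j := (S.orderEmbOfFin hc).strictMono hij
    have mi := S.orderEmbOfFin_mem hc i
    have mj := S.orderEmbOfFin_mem hc j
    have a1 := mem_Icc.mp (h.1 mi)
    have a2 := mem_Icc.mp (h.1 mj)
    have a3 := h.2.2.2 _ mi
    have a4 := h.2.2.2 _ mj
    have a5 : S.orderEmbOfFin hc i ≠ m+2 := fun e => h.2.2.1 (e ▸ mi)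
    have a6 : S.orderEmbOfFin hc j ≠ m+2 := fun e => h.2.2.1 (e ▸ mj)
    simp only [lab] at *
    split_ifs at * <;> omega
  · intro b hb
    have hc := hcb b hb
    rw [mem_smF] at hb
    rw [mem_filter, mem_powerset]
    refine ⟨?_, hc, ?_, ?_⟩
    · intro s hs
      obtain ⟨i, _, rfl⟩ := mem_image.mp hs
      have := hb.1 i
      rw [mem_Icc, unlab]; split_ifs <;> omega
    · intro hs
      obtain ⟨i, _, h⟩ := mem_image.mp hs
      have := hb.1 i
      rw [unlab] at h; split_ifs at h <;> omega
    · intro s hs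
      obtain ⟨i, _, rfl⟩ := mem_image.mp hs
      have := hb.1 i
      rw [unlab, lab]; split_ifs <;> omega
  · intro S h
    have hc := hcard S h
    rw [mem_filter, mem_powerset] at h
    have : (fun i => unlab m (r - (r - lab (m+1) (S.orderEmbOfFin hc i)))) = S.orderEmbOfFin hc := by
      funext i
      have mi := S.orderEmbOfFin_mem hc i
      have a1 := mem_Icc.mp (h.1 mi)
      have a3 := h.2.2.2 _ mi
      have a5 : S.orderEmbOfFin hc i ≠ m+2 := fun e => h.2.2.1 (e ▸ mi)
      simp only [lab, unlab] at *
      split_ifs at * <;> omega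
    simp only [this]
    exact image_orderEmbOfFin_univ S hc
  · intro b hb
    have hc := hcb b hb
    have hu := Finset.orderEmbOfFin_unique hc (f := fun i => unlab m (r - b i)) (fun i => mem_image_of_mem _ (mem_univ i)) (hsm b hb)
    rw [mem_smF] at hb
    funext i
    have := congrFun hu i
    change r - lab (m+1) ((univ.image (fun i => unlab m (r - b i))).orderEmbOfFin hc i) = b i
    rw [← this]
    have := hb.1 i
    rw [unlab, lab]; split_ifs <;> omega
  · intro S h
    have hc := hcard S h
    rw [mem_filter, mem_powerset] at h
    rw [WW_TT m t S h.1 hc h.2.2.1]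
    refine congrFun (congrArg _ ?_) _
    refine congrArg _ (funext fun i => ?_)
    have := h.2.2.2 _ (S.orderEmbOfFin_mem hc i)
    simp only
    omega

theorem WW_Wt (n : ℕ) (t : R) (i : ℕ) (S : Finset ℕ) : WW n t i S = Wt ((Icc 1 (2*n-1)).powerset) (fun i S' S => PW n i t S' S (2*n-1) 1) ∅ i S := by
  induction i generalizing S with
  | zero => rw [WW, Wt]; split_ifs <;> rfl
  | succ i ih => rw [WW, Wt]; exact sum_congr rfl fun S' _ => by rw [ih]
end ASTLam


section Alt

/-- partial sums -/
def ps (u : ℕ → ℤ) (c : ℕ) : ℤ := ∑ j ∈ Icc 1 c, u j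

theorem ps_zero (u : ℕ → ℤ) : ps u 0 = 0 := by simp [ps]

theorem ps_succ (u : ℕ → ℤ) (c : ℕ) : ps u (c+1) = ps u c + u (c+1) := by
  unfold ps; rw [Finset.sum_Icc_succ_top (by omega)]

/-- alternation of consecutive nonzero entries -/
def Alt (u : ℕ → ℤ) : Prop := ∀ j₁ j₂, j₁ < j₂ → u j₁ ≠ 0 → u j₂ ≠ 0 → (∀ j, j₁ < j → j < j₂ → u j = 0) → u j₁ * u j₂ = -1

theorem alt_ps (u : ℕ → ℤ) (h0 : u 0 = 0) (hu : ∀ j, u j = -1 ∨ u j = 0 ∨ u j = 1) (ha : Alt u)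
    (ht : ∀ j, u j ≠ 0 → (∀ j', j' < j → u j' = 0) → u j = 1) (c : ℕ) : ps u c = 0 ∨ ps u c = 1 := by
  have key : (ps u c = 0 ∧ ((∀ j ≤ c, u j = 0) ∨ ∃ j ≤ c, u j = -1 ∧ ∀ j', j < j' → j' ≤ c → u j' = 0)) ∨
      (ps u c = 1 ∧ ∃ j ≤ c, u j = 1 ∧ ∀ j', j < j' → j' ≤ c → u j' = 0) := by
    induction c with
    | zero =>
      left
      refine ⟨ps_zero u, Or.inl fun j hj => ?_⟩
      rw [Nat.le_zero.mp hj, h0]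
    | succ c ih =>
      by_cases hz : u (c+1) = 0
      · have hps : ps u (c+1) = ps u c := by rw [ps_succ, hz, add_zero]
        have ext : ∀ j, (∀ j', j < j' → j' ≤ c → u j' = 0) → ∀ j', j < j' → j' ≤ c+1 → u j' = 0 := by
          intro j h j' h1 h2
          rcases Nat.lt_or_ge c j' with h3 | h3
          · rw [show j' = c+1 by omega, hz]
          · exact h j' h1 h3
        rw [hps]
        rcases ih with ⟨h1, h2 | ⟨j, hj, hj1, hj2⟩⟩ | ⟨h1, j, hj, hj1, hj2⟩
        · left
          refine ⟨h1, Or.inl fun j hj => ?_⟩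
          rcases Nat.lt_or_ge c j with h3 | h3
          · rw [show j = c+1 by omega, hz]
          · exact h2 j h3
        · left
          exact ⟨h1, Or.inr ⟨j, by omega, hj1, ext j hj2⟩⟩
        · right
          exact ⟨h1, j, by omega, hj1, ext j hj2⟩
      · rw [ps_succ]
        rcases ih with ⟨h1, h2 | ⟨j, hj, hj1, hj2⟩⟩ | ⟨h1, j, hj, hj1, hj2⟩
        · have := ht (c+1) hz (fun j hj => h2 j (by omega))
          right
          exact ⟨by rw [h1, this]; rfl, c+1, le_rfl, this, fun j' _ _ => by omega⟩
        · have := ha j (c+1) (by omega) (by rw [hj1]; decide) hz (fun j' a b => hj2 j' a (by omega))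
          rw [hj1] at this
          right
          exact ⟨by omega, c+1, le_rfl, by omega, fun j' _ _ => by omega⟩
        · have := ha j (c+1) (by omega) (by rw [hj1]; decide) hz (fun j' a b => hj2 j' a (by omega))
          rw [hj1] at this
          left
          exact ⟨by omega, Or.inr ⟨c+1, le_rfl, by omega, fun j' _ _ => by omega⟩⟩
  rcases key with h | h
  · exact Or.inl h.1
  · exact Or.inr h.1

theorem alt_ps_total (u : ℕ → ℤ) (h0 : u 0 = 0) (hu : ∀ j, u j = -1 ∨ u j = 0 ∨ u j = 1) (ha : Alt u)
    (L : ℕ) (hL : ps u L = 1) (c : ℕ) : ps u c = 0 ∨ ps u c = 1 := by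
  by_cases ht : ∀ j, u j ≠ 0 → (∀ j', j' < j → u j' = 0) → u j = 1
  · exact alt_ps u h0 hu ha ht c
  · exfalso
    push Not at ht
    obtain ⟨j, h1, h2, h3⟩ := ht
    have := alt_ps (fun x => - u x) (by simp [h0]) (fun x => by rcases hu x with h | h | h <;> rw [h] <;> simp)
      (fun j₁ j₂ a b c d => by
        have := ha j₁ j₂ a (by simpa using b) (by simpa using c) (fun j x y => by simpa using d j x y)
        simp only; rw [← this]; ring)
      (fun x a b => by
        have hx : x = j := by
          rcases lt_trichotomy x j with h | h | h
          · exact absurd (h2 x h) (by simpa using a)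
          · exact h
          · exact absurd (by simpa using b j h) h1
        subst hx
        rcases hu x with h | h | h
        · simp [h]
        · exact absurd h h1
        · exact absurd h h3) L
    have e : ps (fun x => - u x) L = - ps u L := by simp [ps]
    rw [e, hL] at this
    omega

theorem ps_mono_zero (u : ℕ → ℤ) (a b : ℕ) (hab : a ≤ b) (h : ∀ j, a < j → j ≤ b → u j = 0) : ps u b = ps u a := by
  induction b, hab using Nat.le_induction with
  | base => rfl
  | succ b hb ih =>
    rw [ps_succ, h (b+1) (by omega) le_rfl, add_zero]
    exact ih fun j h1 h2 => h j h1 (by omega)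

theorem ps_alt (u : ℕ → ℤ) (L : ℕ) (h : ∀ c ≤ L, ps u c = 0 ∨ ps u c = 1) (j₁ j₂ : ℕ) (h1 : 1 ≤ j₁) (h12 : j₁ < j₂) (h2 : j₂ ≤ L)
    (n1 : u j₁ ≠ 0) (n2 : u j₂ ≠ 0) (hz : ∀ j, j₁ < j → j < j₂ → u j = 0) : u j₁ * u j₂ = -1 := by
  obtain ⟨a, rfl⟩ : ∃ a, j₁ = a + 1 := ⟨j₁ - 1, by omega⟩
  obtain ⟨b, rfl⟩ : ∃ b, j₂ = b + 1 := ⟨j₂ - 1, by omega⟩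
  have e1 := ps_succ u a
  have e2 := ps_succ u b
  have e3 := ps_mono_zero u (a+1) b (by omega) (fun j x y => hz j x (by omega))
  have a1 := h a (by omega)
  have a2 := h (a+1) (by omega)
  have a3 := h (b+1) (by omega)
  have : (u (a+1) = 1 ∧ u (b+1) = -1) ∨ (u (a+1) = -1 ∧ u (b+1) = 1) := by omega
  rcases this with ⟨x, y⟩ | ⟨x, y⟩ <;> rw [x, y] <;> rfl

theorem ps_top (u : ℕ → ℤ) (L : ℕ) (h : ∀ c ≤ L, ps u c = 0 ∨ ps u c = 1) (j : ℕ) (h1 : 1 ≤ j) (h2 : j ≤ L)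
    (n1 : u j ≠ 0) (hz : ∀ j', j' < j → u j' = 0) : u j = 1 := by
  obtain ⟨a, rfl⟩ : ∃ a, j = a + 1 := ⟨j - 1, by omega⟩
  have e1 := ps_succ u a
  have e3 := ps_mono_zero u 0 a (by omega) (fun j x y => hz j (by omega))
  rw [ps_zero] at e3
  have a2 := h (a+1) (by omega)
  omega

theorem sum_Icc_reflect {A : Type*} [AddCommMonoid A] (n : ℕ) (F : ℕ → A) : ∑ j ∈ Icc 1 (2*n-1), F (2*n-j) = ∑ j ∈ Icc 1 (2*n-1), F j := by
  refine Finset.sum_nbij' (fun j => 2*n-j) (fun j => 2*n-j) ?_ ?_ ?_ ?_ ?_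
  · intro j hj; rw [mem_Icc] at hj ⊢; omega
  · intro j hj; rw [mem_Icc] at hj ⊢; omega
  · intro j hj; rw [mem_Icc] at hj; omega
  · intro j hj; rw [mem_Icc] at hj; omega
  · intro j _; rfl

theorem prod_fin_Icc {A : Type*} [CommMonoid A] (F : ℕ → A) (M : ℕ) : ∏ j : Fin M, F (j.val+1) = ∏ i ∈ Icc 1 M, F i := by
  induction M with
  | zero => simp
  | succ M ih =>
    rw [Fin.prod_univ_castSucc, Finset.prod_Icc_succ_top (by omega), ← ih]; rfl
end Alt

section ASTEnc
variable {m : ℕ}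

namespace AST
variable (P : AST (m+2))

/-- partial column sums -/
def cp (i j : ℕ) : ℤ := ps (fun i => P.entry i j) i

theorem entry_out (i j : ℕ) (h : ¬ (1 ≤ i ∧ i ≤ m+2 ∧ i ≤ j ∧ j ≤ 2*(m+2)-i)) : P.entry i j = 0 := by
  by_contra hc
  exact h (P.support i j hc)

theorem cp_succ (i j : ℕ) : P.cp (i+1) j = P.cp i j + P.entry (i+1) j := ps_succ _ _

theorem cp_01 (i j : ℕ) : P.cp i j = 0 ∨ P.cp i j = 1 :=
  alt_ps (fun i => P.entry i j) (P.entry_out _ _ (by omega)) (fun i => P.entries i j) (fun a b h1 h2 h3 h4 => P.altCol j a b h1 h2 h3 h4)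
    (fun i h1 h2 => P.topOne i j h1 h2) i

theorem cp_colSum (i j : ℕ) (hi : i ≤ m+2) (h : ∀ i', i < i' → i' ≤ m+2 → P.entry i' j = 0) : P.colSum j = P.cp i j :=
  ps_mono_zero (fun i => P.entry i j) i (m+2) hi h

/-- mirrored row -/
def mrow (i s : ℕ) : ℤ := P.entry i (2*(m+2)-s)

theorem mrow_ps (i : ℕ) (h1 : 1 ≤ i) (h2 : i ≤ m+2) :
    ps (P.mrow i) (2*(m+2)-1) = 1 ∧ ∀ c, ps (P.mrow i) c = 0 ∨ ps (P.mrow i) c = 1 := by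
  have ht : ps (P.mrow i) (2*(m+2)-1) = 1 := by
    rw [← P.rowSum i h1 h2]
    unfold ps mrow
    rw [sum_Icc_reflect]
    symm
    refine Finset.sum_subset ?_ ?_
    · intro j hj; rw [mem_Icc] at hj ⊢; omega
    · intro j _ hj
      rw [mem_Icc] at hj
      exact P.entry_out _ _ (by omega)
  refine ⟨ht, alt_ps_total _ (P.entry_out _ _ (by omega)) (fun s => P.entries i _) ?_ _ ht⟩
  intro a b hab ha hb hz
  have s1 := P.support _ _ ha
  have s2 := P.support _ _ hb
  unfold mrow at *
  rw [mul_comm]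
  refine P.altRow i _ _ (by omega) hb ha ?_
  intro j hj1 hj2
  have := hz (2*(m+2)-j) (by omega) (by omega)
  rw [show 2*(m+2)-(2*(m+2)-j) = j by omega] at this
  exact this

/-- state after `i` rows -/
def aS (i : ℕ) : Finset ℕ := (Icc 1 (2*(m+2)-1)).filter fun s => P.cp i (2*(m+2)-s) = 1

theorem mem_aS (i s : ℕ) (h1 : 1 ≤ s) (h2 : s ≤ 2*(m+2)-1) : s ∈ P.aS i ↔ P.cp i (2*(m+2)-s) = 1 := by
  rw [aS, mem_filter, mem_Icc]; simp [h1, h2]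

theorem ind_aS (i s : ℕ) (h1 : 1 ≤ s) (h2 : s ≤ 2*(m+2)-1) : (if s ∈ P.aS i then (1:ℤ) else 0) = P.cp i (2*(m+2)-s) := by
  have hm := P.mem_aS i s h1 h2
  split_ifs with h
  · exact (hm.mp h).symm
  · rcases P.cp_01 i (2*(m+2)-s) with hc | hc
    · exact hc.symm
    · exact absurd (hm.mpr hc) h

theorem hs_aS (i c : ℕ) (hc : c ≤ 2*(m+2)-1) : hs (P.aS i) (P.aS (i+1)) c = ps (P.mrow (i+1)) c := by
  unfold hs ps mrow
  refine sum_congr rfl fun s hs => ?_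
  rw [mem_Icc] at hs
  rw [ind_aS _ _ _ hs.1 (by omega), ind_aS _ _ _ hs.1 (by omega), cp_succ]; ring

theorem aS_eq_of_entry (i s : ℕ) (h1 : 1 ≤ s) (h2 : s ≤ 2*(m+2)-1) (h : P.entry (i+1) (2*(m+2)-s) = 0) : s ∈ P.aS i ↔ s ∈ P.aS (i+1) := by
  rw [P.mem_aS i s h1 h2, P.mem_aS (i+1) s h1 h2, cp_succ, h, add_zero]

theorem ten_iff (i : ℕ) (hi : i < m+1) : P.IsTenCol (2*(m+2)-(i+1)) ↔ (i+1 ∈ P.aS i ∧ i+1 ∈ P.aS (i+1)) := by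
  rw [P.mem_aS _ _ (by omega) (by omega), P.mem_aS _ _ (by omega) (by omega), IsTenCol, bottom,
    P.cp_colSum (i+1) _ (by omega) (fun i' h1 h2 => P.entry_out _ _ (by omega)),
    show min (2*(m+2)-(i+1)) (2*(m+2)-(2*(m+2)-(i+1))) = i+1 by omega, cp_succ]
  omega

theorem eleven_iff (i : ℕ) (hi : i < m+1) : P.IsElevenCol (i+1) ↔ (2*(m+2)-(i+1) ∉ P.aS i ∧ 2*(m+2)-(i+1) ∈ P.aS (i+1)) := by
  rw [P.mem_aS _ _ (by omega) (by omega), P.mem_aS _ _ (by omega) (by omega), IsElevenCol, bottom,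
    P.cp_colSum (i+1) _ (by omega) (fun i' h1 h2 => P.entry_out _ _ (by omega)),
    show min (i+1) (2*(m+2)-(i+1)) = i+1 by omega, show 2*(m+2)-(2*(m+2)-(i+1)) = i+1 by omega, cp_succ]
  have := P.cp_01 i (i+1)
  omega

/-- shifted statistic -/
def aStat : ℕ := ((Icc 1 (m+1)).filter P.IsElevenCol).card + ((Icc 1 (m+1)).filter fun i => P.IsTenCol (2*(m+2)-i)).card

theorem rho_eq : P.rho = P.aStat + 1 := by
  have : ((Icc (m+2+1) (2*(m+2)-1)).filter P.IsTenCol).card = ((Icc 1 (m+1)).filter fun i => P.IsTenCol (2*(m+2)-i)).card := by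
    refine Finset.card_nbij' (fun j => 2*(m+2)-j) (fun j => 2*(m+2)-j) ?_ ?_ ?_ ?_
    · intro j hj
      simp only [coe_filter, mem_Icc, Set.mem_ofPred_eq] at hj ⊢
      rw [show 2*(m+2)-(2*(m+2)-j) = j by omega]
      exact ⟨by omega, hj.2⟩
    · intro j hj
      simp only [coe_filter, mem_Icc, Set.mem_ofPred_eq] at hj ⊢
      exact ⟨by omega, hj.2⟩
    · intro j hj
      simp only [coe_filter, mem_Icc, Set.mem_ofPred_eq] at hj
      simp only; omega
    · intro j hj
      simp only [coe_filter, mem_Icc, Set.mem_ofPred_eq] at hj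
      simp only; omega
  rw [rho, this, aStat, show m + 2 - 1 = m + 1 by omega]
  ring

variable {R : Type*} [CommRing R]

theorem PW_aS (t : R) (i : ℕ) (hi : i < m+1) : PW (m+2) (i+1) t (P.aS i) (P.aS (i+1)) (2*(m+2)-1) 1 =
    (if P.IsElevenCol (i+1) then t else 1) * (if P.IsTenCol (2*(m+2)-(i+1)) then t else 1) := by
  obtain ⟨h1, h2⟩ := P.mrow_ps (i+1) (by omega) (by omega)
  rw [PW, if_pos]
  swap
  · refine ⟨fun c hc => ?_, ?_⟩
    · rw [P.hs_aS i c hc]; exact h2 c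
    · rw [P.hs_aS i _ le_rfl]; exact h1
  have key : ∀ j ∈ Icc 1 (2*(m+2)-1), cw (m+2) (i+1) t j (decide (j ∈ P.aS i)) (decide (j ∈ P.aS (i+1))) =
      (if j = 2*(m+2)-(i+1) then (if P.IsElevenCol (i+1) then t else 1) else 1) * (if j = i+1 then (if P.IsTenCol (2*(m+2)-(i+1)) then t else 1) else 1) := by
    intro j hj
    rw [mem_Icc] at hj
    rw [cw]
    by_cases a1 : j < i+1 ∨ 2*(m+2) < j + (i+1)
    · have := P.aS_eq_of_entry i j hj.1 hj.2 (P.entry_out _ _ (by omega))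
      rw [if_pos a1, if_neg (by omega : ¬ j = 2*(m+2)-(i+1)), if_neg (by omega : ¬ j = i+1), one_mul]
      simp [this]
    · rw [if_neg a1]
      by_cases a2 : j = i+1
      · subst a2
        rw [if_pos rfl, if_neg (by omega : ¬ i+1 = 2*(m+2)-(i+1)), if_pos rfl, one_mul]
        refine if_congr ?_ rfl rfl
        rw [P.ten_iff i hi]
        simp [and_comm]
      · rw [if_neg a2, if_neg a2, mul_one]
        by_cases a3 : j + (i+1) = 2*(m+2)
        · obtain rfl : j = 2*(m+2)-(i+1) := by omega
          rw [if_pos a3, if_pos rfl]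
          refine if_congr ?_ rfl rfl
          rw [P.eleven_iff i hi]
          simp [and_comm]
        · rw [if_neg a3, if_neg (by omega)]
  rw [prod_congr rfl key, prod_mul_distrib, prod_ite_eq', prod_ite_eq', if_pos (mem_Icc.mpr (by omega) : 2*(m+2)-(i+1) ∈ Icc 1 (2*(m+2)-1)), if_pos (mem_Icc.mpr (by omega) : i+1 ∈ Icc 1 (2*(m+2)-1))]

theorem aS_zero : P.aS 0 = ∅ := by
  rw [aS, filter_eq_empty_iff]
  intro s _
  simp [cp, ps_zero]

theorem aS_card (i : ℕ) (hi : i ≤ m+2) : (P.aS i).card = i := by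
  induction i with
  | zero => rw [aS_zero]; rfl
  | succ i ih =>
    have h1 := (P.mrow_ps (i+1) (by omega) (by omega)).1
    rw [← P.hs_aS i _ le_rfl, hs, sum_sub_distrib] at h1
    have e : ∀ S : Finset ℕ, S ⊆ Icc 1 (2*(m+2)-1) → ∑ j ∈ Icc 1 (2*(m+2)-1), (if j ∈ S then (1:ℤ) else 0) = S.card := by
      intro S hS
      rw [← sum_filter, filter_mem_eq_inter, inter_eq_right.mpr hS]; simp
    rw [e (P.aS (i+1)) (filter_subset _ _), e (P.aS i) (filter_subset _ _), ih (by omega)] at h1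
    omega

theorem last_row (j : ℕ) : P.entry (m+2) j = if j = m+2 then 1 else 0 := by
  split_ifs with h
  · have := P.rowSum (m+2) (by omega) le_rfl
    rw [show 2*(m+2)-(m+2) = m+2 by omega, Icc_self, sum_singleton] at this
    rw [h, this]
  · exact P.entry_out _ _ (by omega)

theorem center_notMem : m+2 ∉ P.aS (m+1) := by
  rw [P.mem_aS _ _ (by omega) (by omega), show 2*(m+2)-(m+2) = m+2 by omega]
  have h1 := P.cp_succ (m+1) (m+2)
  rw [P.last_row, if_pos rfl] at h1
  have := P.cp_01 (m+1+1) (m+2)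
  omega

theorem label_lab (s : ℕ) (h1 : 1 ≤ s) (h2 : s ≤ 2*(m+2)-1) (h3 : s ≠ m+2) : label (m+2) (2*(m+2)-s) = lab (m+1) s := by
  rw [label, lab]; split_ifs <;> omega

theorem ext_entry (P Q : AST (m+2)) (h : P.entry = Q.entry) : P = Q := by
  cases P; cases Q; cases h; rfl

end AST
end ASTEnc


section ASTCount
variable {m : ℕ}

/-- admissible row transition -/
def RowOK (n i : ℕ) (S' S : Finset ℕ) : Prop :=
  (∀ c ≤ 2*n-1, hs S' S c = 0 ∨ hs S' S c = 1) ∧ hs S' S (2*n-1) = 1 ∧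
    ∀ j, 1 ≤ j → j ≤ 2*n-1 → (j < i ∨ 2*n < j + i) → (j ∈ S' ↔ j ∈ S)

theorem PW_ne {R : Type*} [CommRing R] (n i : ℕ) (t : R) (S' S : Finset ℕ) (h : PW n i t S' S (2*n-1) 1 ≠ 0) : RowOK n i S' S := by
  classical
  rw [PW] at h
  split_ifs at h with hc
  · refine ⟨hc.1, hc.2, fun j h1 h2 hj => ?_⟩
    by_contra hn
    apply h
    refine prod_eq_zero (mem_Icc.mpr ⟨h1, h2⟩) ?_
    rw [cw, if_pos hj, if_neg]
    intro e
    exact hn (by simpa using e)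
  · exact absurd rfl h

/-- indicator -/
def chi (S : Finset ℕ) (s : ℕ) : ℤ := if s ∈ S then 1 else 0

theorem chi_01 (S : Finset ℕ) (s : ℕ) : chi S s = 0 ∨ chi S s = 1 := by
  unfold chi; split_ifs <;> simp

theorem chi_iff (S : Finset ℕ) (s : ℕ) : chi S s = 1 ↔ s ∈ S := by
  unfold chi; split_ifs with h <;> simp [h]

theorem chi_congr (S S' : Finset ℕ) (s : ℕ) (h : s ∈ S ↔ s ∈ S') : chi S s = chi S' s := by
  unfold chi; simp [h]

theorem ast_build (B : ℕ → Finset ℕ) (h0 : B 0 = ∅) (hB : ∀ i, B i ⊆ Icc 1 (2*(m+2)-1)) (hc : ∀ i, m+2 ≤ i → B i = B (m+2))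
    (hR : ∀ i, i < m+2 → RowOK (m+2) (i+1) (B i) (B (i+1))) :
    ∃ P : AST (m+2), (∀ i, P.aS i = B i) ∧ ∀ i j, P.cp i j = chi (B i) (2*(m+2)-j) := by
  have out : ∀ i s, ¬ (1 ≤ s ∧ s ≤ 2*(m+2)-1) → chi (B i) s = 0 := by
    intro i s h
    refine if_neg fun hs => h (mem_Icc.mp (hB i hs))
  let E : ℕ → ℕ → ℤ := fun i j => chi (B i) (2*(m+2)-j) - chi (B (i-1)) (2*(m+2)-j)
  have hE : ∀ i j, E i j = chi (B i) (2*(m+2)-j) - chi (B (i-1)) (2*(m+2)-j) := fun _ _ => rfl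
  have cps : ∀ i j, ps (fun i => E i j) i = chi (B i) (2*(m+2)-j) := by
    intro i j
    induction i with
    | zero => rw [ps_zero, h0]; simp [chi]
    | succ i ih => rw [ps_succ, ih, hE]; simp
  have sup : ∀ i j, E i j ≠ 0 → 1 ≤ i ∧ i ≤ m+2 ∧ i ≤ j ∧ j ≤ 2*(m+2)-i := by
    intro i j h
    have hs : 1 ≤ 2*(m+2)-j ∧ 2*(m+2)-j ≤ 2*(m+2)-1 := by
      by_contra hs
      apply h
      rw [hE, out _ _ hs, out _ _ hs, sub_zero]
    have h1 : 1 ≤ i := by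
      by_contra h1
      apply h
      rw [hE, show i = 0 by omega, sub_self]
    have h2 : i ≤ m+2 := by
      by_contra h2
      apply h
      rw [hE, hc i (by omega), hc (i-1) (by omega), sub_self]
    obtain ⟨i, rfl⟩ : ∃ i', i = i' + 1 := ⟨i - 1, by omega⟩
    have h3 : ¬ (2*(m+2)-j < i+1 ∨ 2*(m+2) < 2*(m+2)-j + (i+1)) := by
      intro h3
      apply h
      rw [hE, Nat.add_sub_cancel, chi_congr _ _ _ ((hR i (by omega)).2.2 _ hs.1 hs.2 h3), sub_self]
    omega
  have rps : ∀ i c, ps (fun s => chi (B (i+1)) s - chi (B i) s) c = hs (B i) (B (i+1)) c := fun i c => rfl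
  let P : AST (m+2) := {
    entry := E
    support := sup
    entries := by
      intro i j
      have := chi_01 (B i) (2*(m+2)-j)
      have := chi_01 (B (i-1)) (2*(m+2)-j)
      rw [hE]; omega
    rowSum := by
      intro i h1 h2
      obtain ⟨i, rfl⟩ : ∃ i', i = i' + 1 := ⟨i - 1, by omega⟩
      have h3 := (hR i (by omega)).2.1
      rw [← rps, ps, ← sum_Icc_reflect] at h3
      rw [← h3]
      refine Finset.sum_subset ?_ ?_
      · intro j hj; rw [mem_Icc] at hj ⊢; omega
      · intro j _ hj
        rw [mem_Icc] at hj
        by_contra hn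
        have := sup _ _ hn
        omega
    altRow := by
      intro i j₁ j₂ h12 n1 n2 hz
      have s1 := sup _ _ n1
      have s2 := sup _ _ n2
      obtain ⟨i, rfl⟩ : ∃ i', i = i' + 1 := ⟨i - 1, by omega⟩
      have := ps_alt (fun s => chi (B (i+1)) s - chi (B i) s) (2*(m+2)-1) (fun c hc => by rw [rps]; exact (hR i (by omega)).1 c hc)
        (2*(m+2)-j₂) (2*(m+2)-j₁) (by omega) (by omega) (by omega) n2 n1 (fun s a b => by
          have := hz (2*(m+2)-s) (by omega) (by omega)
          rw [hE, show 2*(m+2)-(2*(m+2)-s) = s by omega] at this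
          exact this)
      rw [mul_comm]; exact this
    altCol := by
      intro j i₁ i₂ h12 n1 n2 hz
      have s1 := sup _ _ n1
      exact ps_alt (fun i => E i j) i₂ (fun c _ => by rw [cps]; exact chi_01 _ _) i₁ i₂ s1.1 h12 le_rfl n1 n2 hz
    topOne := by
      intro i j n1 hz
      have s1 := sup _ _ n1
      exact ps_top (fun i => E i j) i (fun c _ => by rw [cps]; exact chi_01 _ _) i s1.1 le_rfl n1 hz }
  have hcp : ∀ i j, P.cp i j = chi (B i) (2*(m+2)-j) := cps
  refine ⟨P, fun i => ?_, hcp⟩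
  ext s
  by_cases hs : 1 ≤ s ∧ s ≤ 2*(m+2)-1
  · rw [P.mem_aS i s hs.1 hs.2, hcp, chi_iff, show 2*(m+2)-(2*(m+2)-s) = s by omega]
  · constructor
    · intro h; exact absurd (mem_Icc.mp (mem_filter.mp h).1) hs
    · intro h; exact absurd (mem_Icc.mp (hB i h)) hs

theorem rowOK_center (S : Finset ℕ) (h : m+2 ∉ S) : RowOK (m+2) (m+2) S (insert (m+2) S) := by
  have e : ∀ c, hs S (insert (m+2) S) c = if m+2 ≤ c then 1 else 0 := by
    intro c
    induction c with
    | zero => rw [hs_zero]; simp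
    | succ c ih =>
      rw [hs_succ, ih]
      by_cases hc : c + 1 = m+2
      · rw [hc, if_pos (mem_insert_self _ _), if_neg h, if_neg (by omega), if_pos le_rfl]; simp
      · have : (c+1 ∈ insert (m+2) S ↔ c+1 ∈ S) := by rw [mem_insert]; simp only [hc, false_or]
        simp only [this, sub_self, add_zero]
        refine if_congr ?_ rfl rfl
        omega
  refine ⟨fun c _ => ?_, ?_, ?_⟩
  · rw [e]; split_ifs <;> simp
  · rw [e, if_pos (by omega)]
  · intro j h1 h2 hj
    have : j ≠ m+2 := by omega
    simp [this]

open Polynomial in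
theorem ast_count (r : ℕ) (hr : r ≤ 2*m+1) (s : ℕ) :
    (Nat.card {P : AST (m+2) // P.IsASP 0 r ∧ P.rho = s+1} : ℤ) =
    (Lam r ((∏ p, (MvPolynomial.C (X : Polynomial ℤ) + MvPolynomial.X p)) * pairProd kk (MvPolynomial.X : Fin (m+1) → _))).coeff s := by
  classical
  rw [← ast_Lam m r hr (X : Polynomial ℤ)]
  simp only [WW_Wt]
  have e : {P : AST (m+2) // P.IsASP 0 r ∧ P.rho = s+1} ≃ {a : {P : AST (m+2) // P.IsASP 0 r} // a.1.aStat = s} :=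
    (Equiv.subtypeEquivRight fun P => by rw [P.rho_eq]; simp).trans (Equiv.subtypeSubtypeEquivSubtypeInter (fun P : AST (m+2) => P.IsASP 0 r) (fun P => P.aStat = s)).symm
  rw [Nat.card_congr e]
  refine chain_count ((Icc 1 (2*(m+2)-1)).powerset) _ _ _ _ (fun a : {P : AST (m+2) // P.IsASP 0 r} => fun i : Fin (m+1+1) => a.1.aS i) (fun a => a.1.aStat) ?_ ?_ ?_ ?_ s
  · intro a b hab
    have hS : ∀ i ≤ m+1, a.1.aS i = b.1.aS i := fun i hi => congrFun hab ⟨i, by omega⟩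
    refine Subtype.ext (AST.ext_entry _ _ ?_)
    have hcp : ∀ i ≤ m+1, ∀ j, 1 ≤ j → j ≤ 2*(m+2)-1 → a.1.cp i j = b.1.cp i j := by
      intro i hi j h1 h2
      have h3 := a.1.ind_aS i (2*(m+2)-j) (by omega) (by omega)
      have h4 := b.1.ind_aS i (2*(m+2)-j) (by omega) (by omega)
      rw [show 2*(m+2)-(2*(m+2)-j) = j by omega] at h3 h4
      rw [← h3, ← h4, hS i hi]
    funext i j
    by_cases h : 1 ≤ i ∧ i ≤ m+1 ∧ 1 ≤ j ∧ j ≤ 2*(m+2)-1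
    · obtain ⟨i, rfl⟩ : ∃ i', i = i' + 1 := ⟨i - 1, by omega⟩
      have h1 := a.1.cp_succ i j
      have h2 := b.1.cp_succ i j
      have h3 := hcp i (by omega) j (by omega) (by omega)
      have h4 := hcp (i+1) (by omega) j (by omega) (by omega)
      omega
    · by_cases hi : i = m+2
      · rw [hi, a.1.last_row, b.1.last_row]
      · rw [a.1.entry_out _ _ (by omega), b.1.entry_out _ _ (by omega)]
  · intro a i
    rw [mem_powerset]
    exact filter_subset _ _
  · intro a
    rw [chW, if_pos (by exact a.1.aS_zero), one_mul]
    have hf : aF (Polynomial ℤ) m r (a.1.aS (m+1)) = 1 := by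
      refine if_pos ⟨a.1.aS_card _ (by omega), a.1.center_notMem, fun s hs => ?_⟩
      have hs1 := mem_Icc.mp (mem_filter.mp hs).1
      have hs2 : s ≠ m+2 := fun e => a.1.center_notMem (e ▸ hs)
      rw [← AST.label_lab s hs1.1 hs1.2 hs2]
      refine (a.2 (2*(m+2)-s) (by omega) (by omega) (by omega) ?_).2
      rw [AST.IsOneCol, a.1.cp_colSum (m+1) _ (by omega), ← a.1.mem_aS _ _ hs1.1 hs1.2]
      · exact hs
      · intro i' h1 h2
        rw [show i' = m+2 by omega, a.1.last_row, if_neg (by omega)]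
    rw [show a.1.aS (Fin.last (m+1)).val = a.1.aS (m+1) from rfl, hf, mul_one]
    have hprod : ∀ j ∈ (univ : Finset (Fin (m+1))), PW (m+2) (j.val+1) (X : Polynomial ℤ) (a.1.aS j.castSucc.val) (a.1.aS j.succ.val) (2*(m+2)-1) 1 =
        (fun i => (if a.1.IsElevenCol i then (X : Polynomial ℤ) else 1) * (if a.1.IsTenCol (2*(m+2)-i) then X else 1)) (j.val+1) :=
      fun j _ => a.1.PW_aS X j.val j.2
    rw [prod_congr rfl hprod]
    rw [prod_fin_Icc (fun i => (if a.1.IsElevenCol i then (X : Polynomial ℤ) else 1) * (if a.1.IsTenCol (2*(m+2)-i) then X else 1)), prod_mul_distrib, prod_ite, prod_ite]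
    simp only [prod_const, one_pow, mul_one]
    rw [← pow_add, AST.aStat]
  · intro c hU hne
    have h0 : c 0 = ∅ := by
      by_contra h0
      rw [chW, if_neg h0] at hne; simp at hne
    have hG : ∀ j : Fin (m+1), RowOK (m+2) (j.val+1) (c j.castSucc) (c j.succ) := by
      intro j
      refine PW_ne _ _ (X : Polynomial ℤ) _ _ fun hz => hne ?_
      rw [chW, Finset.prod_eq_zero (mem_univ j) hz, mul_zero, zero_mul]
    have hF : (c (Fin.last (m+1))).card = m+1 ∧ m+2 ∉ c (Fin.last (m+1)) ∧ ∀ s ∈ c (Fin.last (m+1)), lab (m+1) s ≤ r := by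
      by_contra hF
      rw [chW, aF, if_neg hF, mul_zero] at hne
      exact hne rfl
    obtain ⟨B, hB, hBc⟩ : ∃ B : ℕ → Finset ℕ, (∀ i : Fin (m+1+1), B i = c i) ∧ ∀ i, m+2 ≤ i → B i = insert (m+2) (c (Fin.last (m+1))) :=
      ⟨fun i => if h : i < m+1+1 then c ⟨i, h⟩ else insert (m+2) (c (Fin.last (m+1))), fun i => dif_pos i.2, fun i hi => dif_neg (by omega)⟩
    have hBl : B (m+1) = c (Fin.last (m+1)) := hB (Fin.last (m+1))
    obtain ⟨P, hP1, hP2⟩ := ast_build (m := m) B ((hB 0).trans h0) (fun i => by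
        rcases Nat.lt_or_ge i (m+2) with hi | hi
        · rw [show B i = c ⟨i, hi⟩ from hB ⟨i, hi⟩]; exact mem_powerset.mp (hU _)
        · rw [hBc i hi]
          refine insert_subset (mem_Icc.mpr (by omega)) (mem_powerset.mp (hU _))) (fun i hi => by rw [hBc i hi, hBc (m+2) le_rfl]) (fun i hi => by
        rcases Nat.lt_or_ge i (m+1) with h | h
        · have := hG ⟨i, h⟩
          rw [← hB, ← hB] at this
          exact this
        · obtain rfl : i = m+1 := by omega
          rw [hBl, hBc (m+1+1) le_rfl]
          exact rowOK_center _ hF.2.1)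
    refine ⟨⟨P, ?_⟩, ?_⟩
    · intro j h1 h2 hj h
      refine ⟨Nat.zero_le _, ?_⟩
      rw [AST.IsOneCol, P.cp_colSum (m+2) j le_rfl (fun i' a b => by omega), hP2, chi_iff, hBc _ le_rfl, mem_insert] at h
      have h3 : 2*(m+2)-j ∈ c (Fin.last (m+1)) := by
        rcases h with h | h
        · omega
        · exact h
      have h4 := AST.label_lab (m := m) (2*(m+2)-j) (by omega) (by omega) (by omega)
      rw [show 2*(m+2)-(2*(m+2)-j) = j by omega] at h4
      rw [h4]
      exact hF.2.2 _ h3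
    · funext i
      exact (hP1 i).trans (hB i)

open Polynomial in
theorem count_eq (m r p : ℕ) (hp : 1 ≤ p) (hr1 : m + 2 ≤ r+1) (hr2 : r + 3 ≤ 2*(m+2)) :
    Nat.card {P : AST (m+2) // P.IsASP 0 r ∧ P.rho = p} =
      Nat.card {T : MagogPentagon 0 (m+2) (r+2-(m+2)) (2*(m+2)-1) // T.tau = (p : ℤ)} := by
  obtain ⟨s, rfl⟩ : ∃ s, p = s+1 := ⟨p-1, by omega⟩
  have h1 := ast_count (m := m) r (by omega) s
  have h2 := magog_count (m := m) (k := r+2-(m+2)) (by omega) (by omega) s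
  rw [show m + (r+2-(m+2)) = r by omega] at h2
  have h3 := Lam_AM (k := m+1) r (∏ p, (MvPolynomial.C (X : Polynomial ℤ) + MvPolynomial.X p)) (fun σ => by
    rw [map_prod]
    simp only [map_add, MvPolynomial.rename_C, MvPolynomial.rename_X]
    exact Equiv.prod_comp σ (fun p => MvPolynomial.C (X : Polynomial ℤ) + MvPolynomial.X p))
  have h4 : (Nat.card {P : AST (m+2) // P.IsASP 0 r ∧ P.rho = s+1} : ℤ) = Nat.card {T : MagogPentagon 0 (m+2) (r+2-(m+2)) (2*(m+2)-1) // T.tau = ((s+1 : ℕ) : ℤ)} := by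
    rw [h1, h2]
    exact congrArg (fun q => Polynomial.coeff q s) h3
  exact_mod_cast h4

theorem part_one (n r : ℕ) (hr1 : n ≤ r + 1) (hr2 : r + 3 ≤ 2 * n) (M : MagogPentagon 0 n (r + 2 - n) r) :
    ∃ T : MagogPentagon 0 n (r + 2 - n) (2 * n - 1), T.entry = M.entry := by
  have hpos : ∀ i j, 1 ≤ i → i ≤ r+2-n → i ≤ j → j ≤ n → 1 ≤ M.entry j i := by
    intro i j h1 h2 h3 h4
    by_cases h : n + 2*i ≤ r + j + 1
    · exact M.pos i j h1 h2 h3 h4 h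
    · rw [M.cut i j h1 h2 h3 h4 (by omega)]
  refine ⟨⟨M.entry, fun i j h1 h2 h3 h4 _ => hpos i j h1 h2 h3 h4, ?_, ?_, M.bound, ?_, M.outside⟩, rfl⟩
  · intro i j h1 h2 h3 h4 _
    by_cases h : n + 2*i ≤ r + j + 1
    · exact M.rowInc i j h1 h2 h3 h4 h
    · rw [M.cut i j h1 h2 h3 (by omega) (by omega)]
      exact hpos _ _ h1 h2 (by omega) h4
  · intro i j h1 h2 h3 h4 _
    by_cases h : n + 2*(i+1) ≤ r + (j+1) + 1
    · exact M.colDec i j h1 h2 h3 h4 h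
    · rw [M.cut (i+1) (j+1) (by omega) h2 (by omega) h4 (by omega)]
      exact hpos _ _ h1 (by omega) h3 (by omega)
  · intro i j _ _ _ _ h
    omega
end ASTCount

theorem magogPentagon_r_eq_trapezoid_and_count (n r p : ℕ) (hp1 : 1 ≤ p) (hpn : p ≤ n)
    (hr1 : n ≤ r + 1) (hr2 : r + 3 ≤ 2 * n) :
    (∀ M : MagogPentagon 0 n (r + 2 - n) r,
        ∃ T : MagogPentagon 0 n (r + 2 - n) (2 * n - 1), T.entry = M.entry) ∧
    Nat.card {P : AST n // P.IsASP 0 r ∧ P.rho = p}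
      = Nat.card {T : MagogPentagon 0 n (r + 2 - n) (2 * n - 1) // T.tau = (p : ℤ)} := by
  refine ⟨part_one n r hr1 hr2, ?_⟩
  obtain ⟨m, rfl⟩ : ∃ m, n = m + 2 := ⟨n - 2, by omega⟩
  exact count_eq m r p hp1 hr1 hr2
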